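/- arXiv:1901.03980 — 2 statements merged into one kernel-verified Lean document; each statement's English description precedes it below -/
import Mathlib

section
/- Let n ≥ 3 be an odd integer and let G be a dihedral group of order 2n (so that D(G) = 2n). A sequence S over G of length 2n is a minimal product-one sequence if and only if one of the following two statements holds: (a) there exist α, τ ∈ G generating G with α^n = τ^2 = 1_G and τα = α^{-1}τ such that S = α^{[2n-2]} · τ^{[2]}; (b) there exist α, τ ∈ G generating G with α^n = τ^2 = 1_G and τα = α^{-1}τ, and integers i, j ∈ [0, n-1] with gcd(i-j, n) = 1, such that S = (α^i τ)^{[n]} · (α^j τ)^{[n]}. -/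
/-- A multiset over a group is a *product-one sequence* if its terms can be
ordered so that their product is `1`. -/
def IsProductOne {G : Type*} [Group G] (S : Multiset G) : Prop :=
  ∃ l : List G, (l : Multiset G) = S ∧ l.prod = 1

/-- A product-one sequence is *minimal* if it is non-trivial and cannot be written
as a concatenation of two non-trivial product-one sequences. -/
def IsMinimalProductOne {G : Type*} [Group G] (S : Multiset G) : Prop :=
  S ≠ 0 ∧ IsProductOne S ∧
    ∀ T₁ T₂ : Multiset G, T₁ ≠ 0 → T₂ ≠ 0 → IsProductOne T₁ → IsProductOne T₂ →
      S ≠ T₁ + T₂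

/-- The finite set of subsequence sums. -/
def SS {G : Type*} [AddCommGroup G] [DecidableEq G] (T : Multiset G) : Finset G :=
  (T.powerset.map Multiset.sum).toFinset

section general
set_option linter.unusedSectionVars false
open Pointwise
variable {G : Type*} [AddCommGroup G] [DecidableEq G]

lemma zadd (X : Finset G) : ({0} : Finset G) + X = X := by
  rw [Finset.singleton_zero, zero_add]

lemma addz (X : Finset G) : X + ({0} : Finset G) = X := by
  rw [Finset.singleton_zero, add_zero]

lemma mem_SS {T : Multiset G} {x : G} : x ∈ SS T ↔ ∃ U ≤ T, U.sum = x := by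
  simp [SS]

lemma zero_mem_SS (T : Multiset G) : (0 : G) ∈ SS T := mem_SS.2 ⟨0, by simp, by simp⟩

lemma SS_mono {T T' : Multiset G} (h : T ≤ T') : SS T ⊆ SS T' := by
  intro x hx
  obtain ⟨U, hU, rfl⟩ := mem_SS.1 hx
  exact mem_SS.2 ⟨U, hU.trans h, rfl⟩

lemma le_add_split {α : Type*} [DecidableEq α] {U S T : Multiset α} (h : U ≤ S + T) :
    ∃ U₁ ≤ S, ∃ U₂ ≤ T, U = U₁ + U₂ := by
  refine ⟨U ∩ S, Multiset.inter_le_right, U - S, ?_, ?_⟩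
  · exact (Multiset.sub_le_iff_le_add').2 h
  · rw [add_comm, Multiset.sub_add_inter]

lemma SS_add (S T : Multiset G) : SS (S + T) = SS S + SS T := by
  ext x
  rw [Finset.mem_add]
  constructor
  · intro hx
    obtain ⟨U, hU, rfl⟩ := mem_SS.1 hx
    obtain ⟨U₁, h1, U₂, h2, rfl⟩ := le_add_split hU
    exact ⟨_, mem_SS.2 ⟨U₁, h1, rfl⟩, _, mem_SS.2 ⟨U₂, h2, rfl⟩, by simp⟩
  · rintro ⟨y, hy, z, hz, rfl⟩
    obtain ⟨U₁, h1, rfl⟩ := mem_SS.1 hy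
    obtain ⟨U₂, h2, rfl⟩ := mem_SS.1 hz
    exact mem_SS.2 ⟨U₁ + U₂, add_le_add h1 h2, by simp⟩

/-- The stabilizer of a finite set. -/
def stb (X : Finset G) : AddSubgroup G where
  carrier := {x | ∀ y, y ∈ X ↔ x + y ∈ X}
  zero_mem' := by simp
  add_mem' := by
    intro a b ha hb y
    rw [hb y, ha (b + y), add_assoc]
  neg_mem' := by
    intro a ha y
    rw [ha (-a + y)]
    simp

lemma mem_stb {X : Finset G} {x : G} : x ∈ stb X ↔ ∀ y, y ∈ X ↔ x + y ∈ X := Iff.rfl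

lemma mem_stb_of {X : Finset G} {x : G} (h : ∀ y ∈ X, x + y ∈ X) : x ∈ stb X := by
  have himg : X.image (x + ·) = X := by
    apply Finset.eq_of_subset_of_card_le
    · intro z hz
      obtain ⟨y, hy, rfl⟩ := Finset.mem_image.1 hz
      exact h y hy
    · rw [Finset.card_image_of_injective _ (add_right_injective x)]
  rw [mem_stb]
  intro y
  refine ⟨h y, fun hy => ?_⟩
  rw [← himg] at hy
  obtain ⟨z, hz, hzy⟩ := Finset.mem_image.1 hy
  have : z = y := add_left_cancel hzy
  exact this ▸ hz

lemma stb_add_left (X Y : Finset G) : stb X ≤ stb (X + Y) := by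
  intro x hx
  apply mem_stb_of
  intro z hz
  obtain ⟨a, ha, b, hb, rfl⟩ := Finset.mem_add.1 hz
  rw [← add_assoc]
  exact Finset.add_mem_add ((hx a).1 ha) hb

lemma absorb {X : Finset G} {T T' : Multiset G} (hle : T' ≤ T)
    (h : ∀ x ∈ T - T', x ∈ stb (X + SS T')) : X + SS T = X + SS T' := by
  apply Finset.Subset.antisymm
  · intro z hz
    obtain ⟨a, ha, b, hb, rfl⟩ := Finset.mem_add.1 hz
    obtain ⟨U, hU, rfl⟩ := mem_SS.1 hb
    have e : U.sum = (U - T').sum + (U ∩ T').sum := by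
      rw [← Multiset.sum_add, Multiset.sub_add_inter]
    have h1 : (U - T').sum ∈ stb (X + SS T') := by
      apply AddSubgroup.multiset_sum_mem
      intro x hx
      exact h x (Multiset.mem_of_le (tsub_le_tsub_right hU T') hx)
    have h2 : a + (U ∩ T').sum ∈ X + SS T' :=
      Finset.add_mem_add ha (mem_SS.2 ⟨_, Multiset.inter_le_right, rfl⟩)
    have h3 := (h1 _).1 h2
    rw [e]
    convert h3 using 1
    abel
  · exact Finset.add_subset_add_left (SS_mono hle)

lemma SS_singleton (x : G) : SS ({x} : Multiset G) = {0, x} := by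
  ext y
  rw [mem_SS]
  simp only [Multiset.le_singleton, Finset.mem_insert, Finset.mem_singleton]
  constructor
  · rintro ⟨U, rfl | rfl, rfl⟩ <;> simp
  · rintro (rfl | rfl)
    · exact ⟨0, by simp, by simp⟩
    · exact ⟨{y}, by simp, by simp⟩

lemma greedy [Finite G] (H : AddSubgroup G) (T : Multiset G) :
    ∀ X : Finset G, H ≤ stb X → ∃ T' ≤ T,
      T'.card * Nat.card H + X.card ≤ (X + SS T').card ∧
      ∀ x ∈ T - T', x ∈ stb (X + SS T') := by
  induction hk : T.card generalizing T with
  | zero =>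
    intro X _
    have : T = 0 := Multiset.card_eq_zero.1 hk
    subst this
    refine ⟨0, le_rfl, ?_, by simp⟩
    have : SS (0 : Multiset G) = {0} := by ext; simp [mem_SS, eq_comm]
    simp [this]
  | succ k ih =>
    intro X hX
    have hz : SS (0 : Multiset G) = {0} := by ext; simp [mem_SS, eq_comm]
    by_cases hall : ∀ x ∈ T, x ∈ stb X
    · refine ⟨0, by simp, ?_, ?_⟩
      · simp [hz]
      · simpa [hz, addz] using hall
    · push Not at hall
      obtain ⟨x, hxT, hx⟩ := hall
      have hx' : ∃ z ∈ X, x + z ∉ X := by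
        by_contra hcon
        push Not at hcon
        exact hx (mem_stb_of hcon)
      obtain ⟨z, hzX, hxz⟩ := hx'
      have hX1 : H ≤ stb (X + SS {x}) := hX.trans (stb_add_left _ _)
      obtain ⟨T₁, hT₁, hc, hs⟩ := ih (T.erase x)
        (by rw [Multiset.card_erase_of_mem hxT, hk]; rfl) _ hX1
      have e : X + SS (x ::ₘ T₁) = X + SS {x} + SS T₁ := by
        rw [add_assoc, ← SS_add, Multiset.singleton_add]
      have hTe : x ::ₘ T₁ ≤ T := by
        rw [← Multiset.cons_erase hxT]
        exact Multiset.cons_le_cons x hT₁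
      refine ⟨x ::ₘ T₁, hTe, ?_, ?_⟩
      · rw [e]
        refine le_trans ?_ hc
        rw [Multiset.card_cons, add_mul, one_mul]
        have : Nat.card H + X.card ≤ (X + SS {x}).card := by
          classical
          have hfin : (H : Set G).Finite := Set.toFinite _
          let C : Finset G := hfin.toFinset.image (· + (x + z))
          have hC : C.card = Nat.card H := by
            rw [Finset.card_image_of_injective _ (add_left_injective _)]
            exact (Nat.card_eq_card_finite_toFinset hfin).symm
          have hdisj : Disjoint C X := by
            rw [Finset.disjoint_left]
            intro w hw hwX
            obtain ⟨h, hh, rfl⟩ := Finset.mem_image.1 hw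
            have hhH : h ∈ H := by simpa using hh
            exact hxz ((hX hhH _).2 hwX)
          rw [← hC, ← Finset.card_union_of_disjoint hdisj]
          apply Finset.card_le_card
          intro w hw
          rcases Finset.mem_union.1 hw with hw | hw
          · obtain ⟨h, hh, rfl⟩ := Finset.mem_image.1 hw
            have hhH : h ∈ H := by simpa using hh
            have : z + x ∈ X + SS {x} :=
              Finset.add_mem_add hzX (by simp [SS_singleton])
            rw [add_comm z x] at this
            exact (hX1 hhH _).1 this
          · have := Finset.add_mem_add hw (zero_mem_SS ({x} : Multiset G))
            simpa using this
        omega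
      · rw [e]
        intro y hy
        apply hs
        have : T - x ::ₘ T₁ = T.erase x - T₁ := by
          rw [Multiset.sub_cons]
        rwa [this] at hy

lemma greedy0 [Finite G] (T : Multiset G) :
    ∃ T' ≤ T, T'.card + 1 ≤ (SS T').card ∧ (∀ x ∈ T - T', x ∈ stb (SS T')) ∧ SS T = SS T' := by
  obtain ⟨T', h1, h2, h3⟩ := greedy (⊥ : AddSubgroup G) T {0} bot_le
  have h4 := absorb h1 h3
  simp only [zadd, Finset.card_singleton, AddSubgroup.card_bot, mul_one] at h2 h3 h4
  exact ⟨T', h1, h2, h3, h4⟩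

/-- zero-sum free -/
def ZSF (T : Multiset G) : Prop := ∀ U ≤ T, U.sum = 0 → U = 0

lemma ZSF.card_lt [Finite G] {T : Multiset G} (h : ZSF T) : T.card + 1 ≤ (SS T).card := by
  obtain ⟨T', h1, h2, h3, h4⟩ := greedy0 T
  have : T - T' = 0 := by
    rw [Multiset.eq_zero_iff_forall_notMem]
    intro x hx
    have h5 := (AddSubgroup.neg_mem _ (h3 x hx) 0).1 (zero_mem_SS T')
    obtain ⟨U, hU, hs⟩ := mem_SS.1 h5
    have h6 : x ::ₘ U ≤ T := by
      rw [← tsub_add_cancel_of_le h1, ← Multiset.singleton_add]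
      exact add_le_add (Multiset.singleton_le.2 hx) hU
    have := h _ h6 (by simp [hs])
    simp at this
  have h5 : T ≤ T' := tsub_eq_zero_iff_le.1 this
  have := le_antisymm h5 h1
  subst this
  exact h2

lemma card_SS_le [Finite G] {T : Multiset G} (H : AddSubgroup G) (hT : ∀ x ∈ T, x ∈ H) :
    (SS T).card ≤ Nat.card H := by
  have hfin : (H : Set G).Finite := Set.toFinite _
  have : Nat.card H = hfin.toFinset.card := Nat.card_eq_card_finite_toFinset hfin
  rw [this]
  apply Finset.card_le_card
  intro y hy
  obtain ⟨U, hU, rfl⟩ := mem_SS.1 hy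
  simp only [Set.Finite.mem_toFinset, SetLike.mem_coe]
  exact AddSubgroup.multiset_sum_mem _ _ (fun a ha => hT a (Multiset.mem_of_le hU ha))

lemma ZSF.card_sub [Finite G] {T : Multiset G} (h : ZSF T) (H : AddSubgroup G)
    (hT : ∀ x ∈ T, x ∈ H) : T.card + 1 ≤ Nat.card H := h.card_lt.trans (card_SS_le H hT)

lemma refined [Fintype G] (T : Multiset G) (hT : SS T ≠ Finset.univ) :
    ∃ H : AddSubgroup G, H ≠ ⊤ ∧ ∃ T' ≤ T, (∀ x ∈ T - T', x ∈ H) ∧ H ≤ stb (SS T') ∧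
      T'.card + 3 ≤ H.index + Nat.card H := by
  classical
  set H := stb (SS T) with hH
  have hHtop : H ≠ ⊤ := by
    intro h
    apply hT
    ext y
    simp only [Finset.mem_univ, iff_true]
    have : y ∈ H := by rw [h]; trivial
    have := (this 0).1 (zero_mem_SS T)
    simpa using this
  set To := T.filter (· ∉ H) with hTo
  set Ti := T.filter (· ∈ H) with hTi
  have hsplit : To + Ti = T := by
    rw [add_comm]; exact Multiset.filter_add_not _ _
  have hfin : (H : Set G).Finite := Set.toFinite _
  set F := hfin.toFinset with hF
  have hFm : ∀ x, x ∈ F ↔ x ∈ H := by intro x; simp [hF]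
  have hFc : F.card = Nat.card H := (Nat.card_eq_card_finite_toFinset hfin).symm
  have hFs : H ≤ stb F := by
    intro x hx
    apply mem_stb_of
    intro y hy
    rw [hFm] at *
    exact H.add_mem hx hy
  have hFT : F + SS To = SS T := by
    apply Finset.Subset.antisymm
    · intro z hz
      obtain ⟨a, ha, b, hb, rfl⟩ := Finset.mem_add.1 hz
      have := SS_mono (Multiset.filter_le _ T : To ≤ T) hb
      rw [hFm] at ha
      exact (ha _).1 this
    · rw [← hsplit, SS_add, add_comm]
      intro z hz
      obtain ⟨a, ha, b, hb, rfl⟩ := Finset.mem_add.1 hz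
      refine Finset.add_mem_add ?_ hb
      rw [hFm]
      obtain ⟨U, hU, rfl⟩ := mem_SS.1 ha
      refine AddSubgroup.multiset_sum_mem _ _ (fun a ha => ?_)
      exact (Multiset.mem_filter.1 (Multiset.mem_of_le hU ha)).2
  obtain ⟨T₁, h1, h2, h3⟩ := greedy H To F hFs
  have h4 := absorb h1 h3
  rw [← h4, hFT] at h3 h2
  have h5 : To - T₁ = 0 := by
    rw [Multiset.eq_zero_iff_forall_notMem]
    intro x hx
    exact (Multiset.mem_filter.1 (Multiset.mem_of_le (tsub_le_self) hx)).2 (h3 x hx)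
  have h6 : T₁ = To := le_antisymm h1 (tsub_eq_zero_iff_le.1 h5)
  rw [h6] at h2
  have h7 : (SS T).card < Fintype.card G := by
    rw [← Finset.card_univ]
    exact Finset.card_lt_card (Finset.ssubset_univ_iff.2 hT)
  have h8 : Nat.card H * H.index = Fintype.card G := by
    rw [AddSubgroup.card_mul_index, Nat.card_eq_fintype_card]
  have h9 : To.card + 1 < H.index := by
    rw [hFc] at h2
    have : (To.card + 1) * Nat.card H < H.index * Nat.card H := by
      rw [mul_comm H.index, h8]; linarith
    exact lt_of_mul_lt_mul_right this (Nat.zero_le _)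
  obtain ⟨T₂, g1, g2, g3, g4⟩ := greedy0 Ti
  have g5 : (SS T₂).card ≤ Nat.card H := card_SS_le H (fun x hx =>
    (Multiset.mem_filter.1 (Multiset.mem_of_le g1 hx)).2)
  refine ⟨H, hHtop, To + T₂, ?_, ?_, ?_, ?_⟩
  · rw [← hsplit]; exact add_le_add le_rfl g1
  · intro x hx
    rw [← hsplit, add_tsub_add_eq_tsub_left] at hx
    exact (Multiset.mem_filter.1 (Multiset.mem_of_le (tsub_le_self) hx)).2
  · rw [SS_add, ← g4, ← SS_add, hsplit]
  · rw [Multiset.card_add]; omega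

/-- a signing with sum zero exists -/
def Good (T : Multiset G) : Prop := ∃ U ≤ T, U.sum + U.sum = T.sum

lemma exists_half [Fintype G] (hodd : Odd (Fintype.card G)) (H : AddSubgroup G) {l : G}
    (hl : l ∈ H) : ∃ k ∈ H, k + k = l := by
  obtain ⟨c, hc⟩ := hodd
  refine ⟨(c + 1) • l, H.nsmul_mem hl _, ?_⟩
  rw [← add_nsmul]
  have : c + 1 + (c + 1) = Fintype.card G + 1 := by omega
  rw [this, add_nsmul, card_nsmul_eq_zero]
  simp

lemma good_of_stb [Fintype G] (hodd : Odd (Fintype.card G)) (H : AddSubgroup G)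
    {P T T₁ : Multiset G} (hH : H ≤ stb (SS P)) (hTP : ∀ x ∈ T - P, x ∈ H)
    (h1 : P ≤ T₁) (h2 : T₁ ≤ T) (hg : Good T) : Good T₁ := by
  have e := absorb (X := {0}) (h1.trans h2) (by rw [zadd]; exact fun x hx => hH (hTP x hx))
  simp only [zadd] at e
  obtain ⟨U, hU, hs⟩ := hg
  have hl : (T - T₁).sum ∈ H := AddSubgroup.multiset_sum_mem _ _ (fun x hx =>
    hTP x (Multiset.mem_of_le (tsub_le_tsub_left h1 T) hx))
  obtain ⟨k, hk, hkk⟩ := exists_half hodd H hl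
  have hu : U.sum ∈ SS P := by
    have : U.sum ∈ SS T := mem_SS.2 ⟨U, hU, rfl⟩
    rwa [e] at this
  have hv := (hH (H.neg_mem hk) _).1 hu
  obtain ⟨V, hV, hVs⟩ := mem_SS.1 hv
  refine ⟨V, hV.trans h1, ?_⟩
  have hT : T.sum = (T - T₁).sum + T₁.sum := by
    rw [← Multiset.sum_add, tsub_add_cancel_of_le h2]
  rw [hVs]
  rw [hT, ← hkk] at hs
  have : T₁.sum = U.sum + U.sum - (k + k) := by rw [hs]; abel
  rw [this]; abel

lemma good_of_univ [Fintype G] (hodd : Odd (Fintype.card G)) {T T₁ : Multiset G}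
    (h : SS T = Finset.univ) (hle : T ≤ T₁) : Good T₁ := by
  obtain ⟨k, -, hk⟩ := exists_half hodd ⊤ (l := T₁.sum) trivial
  have : k ∈ SS T := by rw [h]; simp
  obtain ⟨U, hU, rfl⟩ := mem_SS.1 this
  exact ⟨U, hU.trans hle, hk⟩

/-- differences of pairs -/
def dlt (D : Multiset (G × G)) : Multiset G := D.map (fun p => p.1 - p.2)

lemma dlt_add (D E : Multiset (G × G)) : dlt (D + E) = dlt D + dlt E := by simp [dlt]

lemma exists_le_of_le_map {α β : Type*} [DecidableEq β] {f : α → β} {s : Multiset α} :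
    ∀ {U : Multiset β}, U ≤ s.map f → ∃ t ≤ s, t.map f = U := by
  induction s using Multiset.induction_on with
  | empty => intro U hU; exact ⟨0, le_rfl, by simp at hU; simp [hU]⟩
  | cons a s ih =>
    intro U hU
    rw [Multiset.map_cons, ← Multiset.singleton_add] at hU
    obtain ⟨U₁, h1, U₂, h2, rfl⟩ := le_add_split hU
    obtain ⟨t, ht, rfl⟩ := ih h2
    rcases Multiset.le_singleton.1 h1 with rfl | rfl
    · exact ⟨t, ht.trans (Multiset.le_cons_self _ _), by simp⟩
    · exact ⟨a ::ₘ t, Multiset.cons_le_cons a ht, by simp⟩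

lemma nonstuck [Fintype G] (hodd : Odd (Fintype.card G)) (A : Multiset G)
    (E D : Multiset (G × G)) (hg : Good (A + dlt (E + D)))
    (hA : ∀ A₀ ≤ A, A₀ ≠ 0 → A₀.sum = 0 → ¬ Good (A - A₀ + dlt (E + D)))
    (hD : ∀ D₀ ≤ D, D₀ ≠ 0 → (dlt D₀).sum = 0 → ¬ Good (A + dlt (E + (D - D₀))))
    (hc : Fintype.card G ≤ A.card + D.card + 1) :
    SS (A + dlt D) = Finset.univ := by
  classical
  by_contra hne
  obtain ⟨H, hH, T', hT', hL, hst, hcard⟩ := refined _ hne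
  obtain ⟨A', hA', C', hC', rfl⟩ := le_add_split hT'
  obtain ⟨D', hD', hCD⟩ := exists_le_of_le_map hC'
  change dlt D' = C' at hCD
  subst hCD
  set P := A' + dlt D' + dlt E with hP
  have hPst : H ≤ stb (SS P) := by
    rw [hP, SS_add]; exact hst.trans (stb_add_left _ _)
  have hdl : dlt (D - D') + dlt D' = dlt D := by
    rw [← dlt_add, tsub_add_cancel_of_le hD']
  have hdiff : A + dlt D - (A' + dlt D') = (A - A') + dlt (D - D') := by
    apply tsub_eq_of_eq_add
    rw [add_add_add_comm, tsub_add_cancel_of_le hA', hdl]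
  have hdiffP : A + dlt (E + D) - P = (A - A') + dlt (D - D') := by
    rw [← hdiff, hP, dlt_add, add_comm (dlt E), ← add_assoc, add_tsub_add_eq_tsub_right]
  rw [hdiff] at hL
  have zA : ZSF (A - A') := by
    intro U hU hs
    by_contra hU0
    refine hA U (hU.trans tsub_le_self) hU0 hs ?_
    refine good_of_stb hodd H hPst (by rw [hdiffP]; exact hL) ?_ ?_ hg
    · rw [hP, dlt_add, add_comm (dlt E), ← add_assoc]
      refine add_le_add (add_le_add ?_ ?_) le_rfl
      · have : A' + U ≤ A := by
          rw [add_comm]; exact (le_tsub_iff_right hA').1 hU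
        exact le_tsub_of_add_le_right this
      · rw [← hdl]; exact Multiset.le_add_left _ _
    · exact add_le_add tsub_le_self le_rfl
  have zD : ZSF (dlt (D - D')) := by
    intro U hU hs
    by_contra hU0
    obtain ⟨D₀, hD₀, hDU⟩ := exists_le_of_le_map hU
    have hD00 : D₀ ≠ 0 := by rintro rfl; exact hU0 (by simpa using hDU.symm)
    change dlt D₀ = U at hDU
    subst hDU
    refine hD D₀ (hD₀.trans tsub_le_self) hD00 hs ?_
    refine good_of_stb hodd H hPst (by rw [hdiffP]; exact hL) ?_ ?_ hg
    · rw [hP, dlt_add, add_comm (dlt E), ← add_assoc]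
      refine add_le_add (add_le_add hA' ?_) le_rfl
      have : D' + D₀ ≤ D := by
          rw [add_comm]; exact (le_tsub_iff_right hD').1 hD₀
      exact Multiset.map_le_map (le_tsub_of_add_le_right this)
    · exact add_le_add le_rfl (Multiset.map_le_map (add_le_add le_rfl tsub_le_self))
  have c1 := zA.card_sub H (fun x hx => hL x (Multiset.mem_add.2 (Or.inl hx)))
  have c2 := zD.card_sub H (fun x hx => hL x (Multiset.mem_add.2 (Or.inr hx)))
  have c3 : (dlt (D - D')).card = D.card - D'.card := by
    simp [dlt, Multiset.card_sub hD']
  have c4 : (dlt D').card = D'.card := by simp [dlt]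
  have c5 : (A - A').card = A.card - A'.card := Multiset.card_sub hA'
  have c6 := Multiset.card_le_card hA'
  have c7 := Multiset.card_le_card hD'
  rw [Multiset.card_add, c4] at hcard
  have h8 : Nat.card H * H.index = Fintype.card G := by
    rw [AddSubgroup.card_mul_index, Nat.card_eq_fintype_card]
  have hi1 : H.index ≠ 1 := fun h => hH (AddSubgroup.index_eq_one.1 h)
  have hio : Odd H.index := by
    rw [← h8, Nat.odd_mul] at hodd; exact hodd.2
  have hi3 : 3 ≤ H.index := by
    obtain ⟨c, hc⟩ := hio; omega
  have hk1 : 1 ≤ Nat.card H := by omega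
  obtain ⟨u, hu⟩ := Nat.exists_eq_add_of_le hi3
  obtain ⟨v, hv⟩ := Nat.exists_eq_add_of_le hk1
  have hb : A.card + D.card + 5 ≤ H.index + 3 * Nat.card H := by omega
  rw [hu, hv] at h8 hb
  nlinarith [Nat.zero_le (u * v)]

lemma ZSF.mono {T T' : Multiset G} (h : ZSF T) (hle : T' ≤ T) : ZSF T' :=
  fun U hU hs => h U (hU.trans hle) hs

lemma zsf_eq [Fintype G] {x y : G} {R : Multiset G} (h : ZSF (x ::ₘ y ::ₘ R))
    (hc : Fintype.card G ≤ R.card + 3) : x = y := by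
  have hR : ZSF R := h.mono ((Multiset.le_cons_self _ _).trans (Multiset.le_cons_self _ _))
  have c := hR.card_lt
  by_contra hxy
  have hx : ∀ s ∈ SS R, x + s ≠ 0 := by
    intro s hs h0
    obtain ⟨U, hU, rfl⟩ := mem_SS.1 hs
    have := h (x ::ₘ U) (Multiset.cons_le_cons x (hU.trans (Multiset.le_cons_self _ _)))
      (by simpa using h0)
    simp at this
  have hy : ∀ s ∈ SS R, y + s ≠ 0 := by
    intro s hs h0
    obtain ⟨U, hU, rfl⟩ := mem_SS.1 hs
    have := h (y ::ₘ U) ((Multiset.cons_le_cons y hU).trans (Multiset.le_cons_self _ _))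
      (by simpa using h0)
    simp at this
  have hxys : ∀ s ∈ SS R, x + y + s ≠ 0 := by
    intro s hs h0
    obtain ⟨U, hU, rfl⟩ := mem_SS.1 hs
    have := h (x ::ₘ y ::ₘ U) (Multiset.cons_le_cons x (Multiset.cons_le_cons y hU))
      (by simpa [add_assoc] using h0)
    simp at this
  have hx0 : x ≠ 0 := by simpa using hx 0 (zero_mem_SS R)
  have hy0 : y ≠ 0 := by simpa using hy 0 (zero_mem_SS R)
  let I := (SS R).image (x + y + ·)
  have hI : I.card = (SS R).card := Finset.card_image_of_injective _ (add_right_injective _)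
  have n0 : (0 : G) ∉ I := by
    intro h0
    obtain ⟨s, hs, he⟩ := Finset.mem_image.1 h0
    exact hxys s hs he
  have nx : x ∉ I := by
    intro h0
    obtain ⟨s, hs, he⟩ := Finset.mem_image.1 h0
    rw [add_assoc, add_eq_left] at he
    exact hy s hs he
  have ny : y ∉ I := by
    intro h0
    obtain ⟨s, hs, he⟩ := Finset.mem_image.1 h0
    rw [add_comm x y, add_assoc, add_eq_left] at he
    exact hx s hs he
  have : (insert 0 (insert x (insert y I))).card ≤ Fintype.card G := Finset.card_le_univ _
  rw [Finset.card_insert_of_notMem, Finset.card_insert_of_notMem,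
    Finset.card_insert_of_notMem ny, hI] at this
  · omega
  · simp [hxy, nx]
  · simp [hx0.symm, hy0.symm, n0]

lemma zsf_replicate [Fintype G] {T : Multiset G} (h : ZSF T) (h0 : T ≠ 0)
    (hc : Fintype.card G ≤ T.card + 1) : ∃ g, T = Multiset.replicate T.card g := by
  obtain ⟨g, hg⟩ := Multiset.exists_mem_of_ne_zero h0
  refine ⟨g, Multiset.eq_replicate.2 ⟨rfl, ?_⟩⟩
  intro b hb
  obtain ⟨R, rfl⟩ := Multiset.exists_cons_of_mem hg
  rcases Multiset.mem_cons.1 hb with hb | hb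
  · exact hb
  · obtain ⟨R', rfl⟩ := Multiset.exists_cons_of_mem hb
    exact (zsf_eq h (by simpa using hc)).symm

end general

section dihedral
open DihedralGroup Pointwise
set_option linter.unusedSectionVars false

lemma unmerge {G : Type*} [Group G] {g h : G} {S : Multiset G}
    (hp : IsProductOne ((g * h) ::ₘ S)) : IsProductOne (g ::ₘ h ::ₘ S) := by
  obtain ⟨l, hl, hprod⟩ := hp
  have hm : g * h ∈ l := by
    have : g * h ∈ (l : Multiset G) := by rw [hl]; simp
    simpa using this
  obtain ⟨l₁, l₂, rfl⟩ := List.append_of_mem hm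
  refine ⟨l₁ ++ g :: h :: l₂, ?_, ?_⟩
  · have h1 : ((l₁ ++ (g * h) :: l₂ : List G) : Multiset G)
        = (g * h) ::ₘ ((l₁ ++ l₂ : List G) : Multiset G) := by
      rw [Multiset.cons_coe, Multiset.coe_eq_coe]; exact List.perm_middle
    rw [h1, Multiset.cons_inj_right] at hl
    rw [← hl, Multiset.cons_coe, Multiset.cons_coe, Multiset.coe_eq_coe]
    exact List.perm_middle.trans (List.Perm.cons _ List.perm_middle)
  · rw [← hprod]; simp [mul_assoc]

variable {n : ℕ}

/-- rotations and reflections -/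
def sqn (A B : Multiset (ZMod n)) : Multiset (DihedralGroup n) := A.map r + B.map sr

lemma sqn_add (A A' B B' : Multiset (ZMod n)) : sqn (A + A') (B + B') = sqn A B + sqn A' B' := by
  simp only [sqn, Multiset.map_add]; abel

lemma sqn_card (A B : Multiset (ZMod n)) : (sqn A B).card = A.card + B.card := by simp [sqn]

/-- projections -/
def rot (S : Multiset (DihedralGroup n)) : Multiset (ZMod n) :=
  S.filterMap (fun g => match g with | r i => some i | sr _ => none)
def ref (S : Multiset (DihedralGroup n)) : Multiset (ZMod n) :=
  S.filterMap (fun g => match g with | r _ => none | sr i => some i)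

lemma filterMap_add' {α β : Type*} (f : α → Option β) (s t : Multiset α) :
    (s + t).filterMap f = s.filterMap f + t.filterMap f := by
  induction s using Multiset.induction_on with
  | empty => simp
  | cons a s ih =>
    rw [Multiset.cons_add]
    cases h : f a with
    | none => rw [Multiset.filterMap_cons_none _ _ h, Multiset.filterMap_cons_none _ _ h, ih]
    | some b =>
      rw [Multiset.filterMap_cons_some _ _ _ h, Multiset.filterMap_cons_some _ _ _ h, ih,
        Multiset.cons_add]

lemma rot_sqn (A B : Multiset (ZMod n)) : rot (sqn A B) = A := by
  unfold rot sqn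
  rw [filterMap_add', Multiset.filterMap_map, Multiset.filterMap_map]
  have h1 : Multiset.filterMap ((fun g : DihedralGroup n =>
      match g with | r i => some i | sr _ => none) ∘ r) A = A := Multiset.filterMap_some A
  have h2 : Multiset.filterMap ((fun g : DihedralGroup n =>
      match g with | r i => some i | sr _ => none) ∘ sr) B = 0 := by
    induction B using Multiset.induction_on with
    | empty => rfl
    | cons a s ih => rw [Multiset.filterMap_cons_none _ _ rfl, ih]
  rw [h1, h2, add_zero]

lemma ref_sqn (A B : Multiset (ZMod n)) : ref (sqn A B) = B := by
  unfold ref sqn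
  rw [filterMap_add', Multiset.filterMap_map, Multiset.filterMap_map]
  have h1 : Multiset.filterMap ((fun g : DihedralGroup n =>
      match g with | r _ => none | sr i => some i) ∘ sr) B = B := Multiset.filterMap_some B
  have h2 : Multiset.filterMap ((fun g : DihedralGroup n =>
      match g with | r _ => none | sr i => some i) ∘ r) A = 0 := by
    induction A using Multiset.induction_on with
    | empty => rfl
    | cons a s ih => rw [Multiset.filterMap_cons_none _ _ rfl, ih]
  rw [h1, h2, zero_add]

lemma sqn_inj {A A' B B' : Multiset (ZMod n)} (h : sqn A B = sqn A' B') : A = A' ∧ B = B' := by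
  constructor
  · have := congrArg rot h; simpa [rot_sqn] using this
  · have := congrArg ref h; simpa [ref_sqn] using this

lemma prod_map_r (l : List (ZMod n)) : (l.map r).prod = r l.sum := by
  induction l with
  | nil => rfl
  | cons a l ih => simp [ih]

lemma po_rot {A : Multiset (ZMod n)} (h : A.sum = 0) : IsProductOne (sqn A 0) := by
  induction A using Quotient.inductionOn with
  | h l =>
    refine ⟨l.map r, by simp [sqn], ?_⟩
    rw [prod_map_r]
    have : l.sum = 0 := by simpa using h
    rw [this]; rfl

lemma po_suff : ∀ (B₁ B₂ A₁ A₂ : Multiset (ZMod n)), B₁.card = B₂.card → B₁ ≠ 0 →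
    A₁.sum + B₁.sum = A₂.sum + B₂.sum → IsProductOne (sqn (A₁ + A₂) (B₁ + B₂)) := by
  intro B₁
  induction B₁ using Multiset.induction_on with
  | empty => intro _ _ _ _ h; exact absurd rfl h
  | cons b B₁ ih =>
    intro B₂ A₁ A₂ hc _ hs
    have hB2 : B₂ ≠ 0 := by rintro rfl; simp at hc
    obtain ⟨b', hb'⟩ := Multiset.exists_mem_of_ne_zero hB2
    obtain ⟨B₂, rfl⟩ := Multiset.exists_cons_of_mem hb'
    by_cases h0 : B₁ = 0
    · subst h0
      have : B₂ = 0 := by simpa using hc.symm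
      subst this
      induction A₁ using Quotient.inductionOn with
      | h l₁ =>
      induction A₂ using Quotient.inductionOn with
      | h l₂ =>
        refine ⟨sr b' :: l₂.map r ++ sr b :: l₁.map r, ?_, ?_⟩
        · simp only [sqn, Multiset.quot_mk_to_coe, Multiset.map_add, Multiset.map_coe,
            ← Multiset.coe_add, ← Multiset.cons_coe, Multiset.map_singleton, Multiset.map_zero,
            ← Multiset.singleton_add]
          abel
        · rw [List.prod_append, List.prod_cons, List.prod_cons, prod_map_r, prod_map_r]
          have : l₁.sum + b = l₂.sum + b' := by simpa using hs
          simp only [sr_mul_r, sr_mul_sr]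
          rw [add_comm b, this, add_comm b', sub_self]; rfl
    · have := ih B₂ ((b - b') ::ₘ A₁) A₂ (by simpa using hc) h0 (by
        simp only [Multiset.sum_cons] at hs ⊢
        have : A₂.sum + B₂.sum = A₁.sum + (b + B₁.sum) - b' := by rw [hs]; ring
        rw [this]; ring)
      have e : sqn ((b - b') ::ₘ A₁ + A₂) (B₁ + B₂)
          = (sr b' * sr b : DihedralGroup n) ::ₘ sqn (A₁ + A₂) (B₁ + B₂) := by
        simp [sqn]
      rw [e] at this
      have h2 := unmerge this
      convert h2 using 1
      simp only [sqn, Multiset.map_add, Multiset.map_singleton, ← Multiset.singleton_add]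
      abel

lemma po_nec_aux (l : List (DihedralGroup n)) : ∃ A₁ A₂ B₁ B₂ : Multiset (ZMod n),
    (l : Multiset (DihedralGroup n)) = sqn (A₁ + A₂) (B₁ + B₂) ∧ (B₁ = 0 → A₂ = 0) ∧
    ((B₁.card = B₂.card ∧ l.prod = r (A₁.sum + B₁.sum - (A₂.sum + B₂.sum))) ∨
     (B₁.card = B₂.card + 1 ∧ l.prod = sr (A₁.sum + B₁.sum - (A₂.sum + B₂.sum)))) := by
  induction l with
  | nil => exact ⟨0, 0, 0, 0, by simp [sqn], by simp, Or.inl ⟨rfl, by simp⟩⟩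
  | cons g l ih =>
    obtain ⟨A₁, A₂, B₁, B₂, hl, h0, h⟩ := ih
    rw [← Multiset.cons_coe, hl, List.prod_cons]
    cases g with
    | r i =>
      rcases h with ⟨hc, hp⟩ | ⟨hc, hp⟩
      · refine ⟨i ::ₘ A₁, A₂, B₁, B₂, by simp [sqn], h0, Or.inl ⟨hc, ?_⟩⟩
        rw [hp, r_mul_r, Multiset.sum_cons]; congr 1; ring
      · refine ⟨A₁, i ::ₘ A₂, B₁, B₂, by simp [sqn], ?_, Or.inr ⟨hc, ?_⟩⟩
        · rintro rfl; simp at hc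
        · rw [hp, r_mul_sr, Multiset.sum_cons]; congr 1; ring
    | sr i =>
      rcases h with ⟨hc, hp⟩ | ⟨hc, hp⟩
      · refine ⟨A₁, A₂, i ::ₘ B₁, B₂, by simp [sqn], by simp, Or.inr ⟨by simp [hc], ?_⟩⟩
        rw [hp, sr_mul_r, Multiset.sum_cons]; congr 1; ring
      · refine ⟨A₁, A₂, B₁, i ::ₘ B₂, by simp [sqn], h0, Or.inl ⟨by simp [hc], ?_⟩⟩
        rw [hp, sr_mul_sr, Multiset.sum_cons]; congr 1; ring

lemma po_nec {S : Multiset (DihedralGroup n)} (h : IsProductOne S) :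
    ∃ A₁ A₂ B₁ B₂ : Multiset (ZMod n), S = sqn (A₁ + A₂) (B₁ + B₂) ∧ (B₁ = 0 → A₂ = 0) ∧
      B₁.card = B₂.card ∧ A₁.sum + B₁.sum = A₂.sum + B₂.sum := by
  obtain ⟨l, rfl, hp⟩ := h
  obtain ⟨A₁, A₂, B₁, B₂, hl, h0, h⟩ := po_nec_aux l
  refine ⟨A₁, A₂, B₁, B₂, hl, h0, ?_⟩
  rw [hp, one_def] at h
  rcases h with ⟨hc, h⟩ | ⟨_, h⟩
  · refine ⟨hc, ?_⟩
    have := (r.inj h).symm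
    exact sub_eq_zero.1 this
  · cases h

/-- entries of pairs -/
def pb (D : Multiset (ZMod n × ZMod n)) : Multiset (ZMod n) := D.map Prod.fst + D.map Prod.snd

lemma pb_add (D E : Multiset (ZMod n × ZMod n)) : pb (D + E) = pb D + pb E := by
  simp only [pb, Multiset.map_add]; abel

lemma pb_cons (p : ZMod n × ZMod n) (D : Multiset (ZMod n × ZMod n)) :
    pb (p ::ₘ D) = p.1 ::ₘ p.2 ::ₘ pb D := by
  simp [pb, Multiset.cons_swap]

lemma dlt_sum (D : Multiset (ZMod n × ZMod n)) :
    (dlt D).sum = (D.map Prod.fst).sum - (D.map Prod.snd).sum := by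
  simp [dlt, Multiset.sum_map_sub]

lemma po_of_good {A : Multiset (ZMod n)} {D : Multiset (ZMod n × ZMod n)} (hD : D ≠ 0)
    (h : Good (A + dlt D)) : IsProductOne (sqn A (pb D)) := by
  classical
  obtain ⟨U, hU, hs⟩ := h
  obtain ⟨A₁, hA, U₂, hU2, rfl⟩ := le_add_split hU
  obtain ⟨D₁, hD1, hDU⟩ := exists_le_of_le_map hU2
  change dlt D₁ = U₂ at hDU
  subst hDU
  obtain ⟨A₂, rfl⟩ := Multiset.le_iff_exists_add.1 hA
  obtain ⟨D₂, rfl⟩ := Multiset.le_iff_exists_add.1 hD1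
  have e : pb (D₁ + D₂) = (D₁.map Prod.fst + D₂.map Prod.snd)
      + (D₁.map Prod.snd + D₂.map Prod.fst) := by
    simp only [pb, Multiset.map_add]; abel
  rw [e]
  apply po_suff
  · simp
  · intro h0
    apply hD
    have := congrArg Multiset.card h0
    simp only [Multiset.card_add, Multiset.card_map, Multiset.card_zero] at this
    apply Multiset.card_eq_zero.1
    simpa using this
  · simp only [Multiset.sum_add, dlt_add, dlt_sum] at hs ⊢
    linear_combination hs

lemma exists_pairs : ∀ (B₁ B₂ : Multiset (ZMod n)), B₁.card = B₂.card →
    ∃ D : Multiset (ZMod n × ZMod n), D.map Prod.fst = B₁ ∧ D.map Prod.snd = B₂ := by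
  intro B₁
  induction B₁ using Multiset.induction_on with
  | empty => intro B₂ h; exact ⟨0, rfl, by simpa using (Multiset.card_eq_zero.1 h.symm).symm⟩
  | cons b B ih =>
    intro B₂ hc
    have hB2 : B₂ ≠ 0 := by rintro rfl; simp at hc
    obtain ⟨b', hb'⟩ := Multiset.exists_mem_of_ne_zero hB2
    obtain ⟨B₂, rfl⟩ := Multiset.exists_cons_of_mem hb'
    obtain ⟨D, h1, h2⟩ := ih B₂ (by simpa using hc)
    exact ⟨(b, b') ::ₘ D, by simp [h1], by simp [h2]⟩

lemma exists_le_card {α : Type*} {B : Multiset α} {m : ℕ} (h : m ≤ B.card) :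
    ∃ C ≤ B, C.card = m := by
  induction B using Quotient.inductionOn with
  | h l =>
    refine ⟨(l.take m : List α), ?_, ?_⟩
    · exact (List.take_sublist m l).subperm
    · simpa using h

lemma exists_pairs_even (m : ℕ) : ∀ (B : Multiset (ZMod n)), B.card = 2 * m →
    ∃ D : Multiset (ZMod n × ZMod n), pb D = B ∧ D.card = m := by
  intro B hB
  obtain ⟨B₁, hle, hc⟩ := exists_le_card (show m ≤ B.card by omega)
  obtain ⟨B₂, rfl⟩ := Multiset.le_iff_exists_add.1 hle
  obtain ⟨D, h1, h2⟩ := exists_pairs B₁ B₂ (by rw [Multiset.card_add] at hB; omega)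
  refine ⟨D, by rw [pb, h1, h2], ?_⟩
  rw [← hc, ← h1, Multiset.card_map]

end dihedral

section forward
open DihedralGroup Pointwise
set_option linter.unusedSectionVars false
variable {n : ℕ} [NeZero n]

lemma zcard_odd (hodd : Odd n) : Odd (Fintype.card (ZMod n)) := by rwa [ZMod.card]

lemma two_cancel (hodd : Odd n) {a b : ZMod n} (h : a + a = b + b) : a = b := by
  obtain ⟨c, hc⟩ := hodd
  have hn : (n : ZMod n) = 0 := ZMod.natCast_self n
  have h2 : ((2 * c + 1 : ℕ) : ZMod n) = 0 := by rw [← hc]; exact hn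
  push_cast at h2
  have : (2 * (c : ZMod n) + 1) * (a - b) = a - b + c * ((a + a) - (b + b)) := by ring
  rw [h2, h, sub_self, mul_zero, zero_mul, add_zero] at this
  exact (sub_eq_zero.1 this.symm)

lemma unit_of_zsf {g : ZMod n} (h : ZSF (Multiset.replicate (n - 1) g)) : IsUnit g := by
  have hc := h.card_lt
  have hn : 0 < n := Nat.pos_of_neZero n
  have hu : SS (Multiset.replicate (n - 1) g) = Finset.univ := by
    rw [← Finset.card_eq_iff_eq_univ, ZMod.card]
    apply le_antisymm
    · have := Finset.card_le_univ (SS (Multiset.replicate (n - 1) g))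
      rwa [ZMod.card] at this
    · rw [Multiset.card_replicate] at hc; omega
  have h1 : (1 : ZMod n) ∈ SS (Multiset.replicate (n - 1) g) := by rw [hu]; simp
  obtain ⟨U, hU, hs⟩ := mem_SS.1 h1
  obtain ⟨k, -, rfl⟩ := Multiset.le_replicate_iff.1 hU
  rw [Multiset.sum_replicate, nsmul_eq_mul, mul_comm] at hs
  exact IsUnit.of_mul_eq_one _ hs

lemma exists_nat_mul {g : ZMod n} (hg : IsUnit g) (z : ZMod n) : ∃ k < n, z = k • g := by
  obtain ⟨u, rfl⟩ := hg
  refine ⟨(z * ↑u⁻¹ : ZMod n).val, ZMod.val_lt _, ?_⟩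
  rw [nsmul_eq_mul, ZMod.natCast_zmod_val, mul_assoc, Units.inv_mul, mul_one]

lemma univ_of_repl {g g' : ZMod n} (hg : IsUnit g) (hg' : g' ≠ 0) :
    SS (Multiset.replicate (n - 2) g + {g'}) = Finset.univ := by
  ext z
  simp only [Finset.mem_univ, iff_true]
  obtain ⟨k, hk, rfl⟩ := exists_nat_mul hg z
  obtain ⟨j, hj, rfl⟩ := exists_nat_mul hg g'
  have hj0 : j ≠ 0 := by rintro rfl; simp at hg'
  rw [mem_SS]
  by_cases h : k ≤ n - 2
  · refine ⟨Multiset.replicate k g, ?_, by simp⟩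
    exact (Multiset.replicate_mono g h).trans (Multiset.le_add_right _ _)
  · refine ⟨Multiset.replicate (k - j) g + {j • g}, ?_, ?_⟩
    · exact add_le_add (Multiset.replicate_mono g (by omega)) le_rfl
    · rw [Multiset.sum_add, Multiset.sum_replicate, Multiset.sum_singleton, ← add_nsmul]
      congr 1; omega

lemma sqn_ne_zero {A B : Multiset (ZMod n)} (h : A ≠ 0 ∨ B ≠ 0) : sqn A B ≠ 0 := by
  intro h0
  have := congrArg Multiset.card h0
  rw [sqn_card, Multiset.card_zero] at this
  rcases h with h | h
  · exact h (Multiset.card_eq_zero.1 (by omega))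
  · exact h (Multiset.card_eq_zero.1 (by omega))

lemma pb_ne_zero {D : Multiset (ZMod n × ZMod n)} (h : D ≠ 0) : pb D ≠ 0 := by
  obtain ⟨p, hp⟩ := Multiset.exists_mem_of_ne_zero h
  obtain ⟨D, rfl⟩ := Multiset.exists_cons_of_mem hp
  rw [pb_cons]; simp

lemma pb_card (D : Multiset (ZMod n × ZMod n)) : (pb D).card = 2 * D.card := by
  simp [pb]; ring

lemma po_pairs {D : Multiset (ZMod n × ZMod n)} (hD : D ≠ 0) (h : (dlt D).sum = 0) :
    IsProductOne (sqn 0 (pb D)) :=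
  po_of_good hD ⟨0, by simp, by simp [h]⟩

lemma minA {A : Multiset (ZMod n)} {D : Multiset (ZMod n × ZMod n)}
    (hm : IsMinimalProductOne (sqn A (pb D))) (hD : D ≠ 0) :
    ∀ A₀ ≤ A, A₀ ≠ 0 → A₀.sum = 0 → ¬ Good (A - A₀ + dlt D) := by
  intro A₀ hle h0 hs hg
  refine hm.2.2 (sqn A₀ 0) (sqn (A - A₀) (pb D)) (sqn_ne_zero (Or.inl h0))
    (sqn_ne_zero (Or.inr (pb_ne_zero hD))) (po_rot hs) (po_of_good hD hg) ?_
  rw [← sqn_add, add_tsub_cancel_of_le hle, zero_add]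

lemma minD {A : Multiset (ZMod n)} {D : Multiset (ZMod n × ZMod n)}
    (hm : IsMinimalProductOne (sqn A (pb D))) :
    ∀ D₀ ≤ D, D₀ ≠ 0 → D - D₀ ≠ 0 → (dlt D₀).sum = 0 → ¬ Good (A + dlt (D - D₀)) := by
  intro D₀ hle h0 h1 hs hg
  refine hm.2.2 (sqn 0 (pb D₀)) (sqn A (pb (D - D₀))) (sqn_ne_zero (Or.inr (pb_ne_zero h0)))
    (sqn_ne_zero (Or.inr (pb_ne_zero h1))) (po_pairs h0 hs) (po_of_good h1 hg) ?_
  rw [← sqn_add, ← pb_add, add_tsub_cancel_of_le hle, zero_add]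

lemma ns (hodd : Odd n) {A : Multiset (ZMod n)} {E D : Multiset (ZMod n × ZMod n)}
    (hm : IsMinimalProductOne (sqn A (pb (E + D)))) (hE : E ≠ 0)
    (hg : Good (A + dlt (E + D))) (hc : n ≤ A.card + D.card + 1) :
    SS (A + dlt D) = Finset.univ := by
  have hED : E + D ≠ 0 := fun h => hE (by simpa using (add_eq_zero.1 h).1)
  refine nonstuck (zcard_odd hodd) A E D hg (minA hm hED) ?_ (by rwa [ZMod.card])
  intro D₀ hle h0 hs
  have e : E + D - D₀ = E + (D - D₀) := add_tsub_assoc_of_le hle E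
  rw [← e]
  refine minD hm D₀ (hle.trans (Multiset.le_add_left _ _)) h0 ?_ hs
  rw [e]
  exact fun h => hE (by simpa using (add_eq_zero.1 h).1)

/-- no rotations -/
lemma case_zero (hn : 3 ≤ n) (hodd : Odd n) {B₁ B₂ : Multiset (ZMod n)}
    (h1 : B₁.card = n) (h2 : B₂.card = n) (hs : B₁.sum = B₂.sum)
    (hm : IsMinimalProductOne (sqn 0 (B₁ + B₂))) :
    ∃ x y, IsUnit (x - y) ∧ B₁ = Multiset.replicate n x ∧ B₂ = Multiset.replicate n y := by
  have key : ∀ (p : ZMod n × ZMod n) (D : Multiset (ZMod n × ZMod n)),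
      (p ::ₘ D).map Prod.fst = B₁ → (p ::ₘ D).map Prod.snd = B₂ → ZSF (dlt D) := by
    intro p D e1 e2 U hU hU0
    by_contra hne
    obtain ⟨D₀, hD₀, hDU⟩ := exists_le_of_le_map hU
    have hD00 : D₀ ≠ 0 := by rintro rfl; exact hne (by simpa using hDU.symm)
    change dlt D₀ = U at hDU
    subst hDU
    have e3 : B₁ + B₂ = pb (p ::ₘ D) := by rw [pb, e1, e2]
    rw [e3] at hm
    have hle : D₀ ≤ p ::ₘ D := hD₀.trans (Multiset.le_cons_self _ _)
    have e4 : (p ::ₘ D) - D₀ = p ::ₘ (D - D₀) := by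
      rw [← Multiset.singleton_add, ← Multiset.singleton_add, add_tsub_assoc_of_le hD₀]
    refine minD hm D₀ hle hD00 (by rw [e4]; simp) hU0 ⟨0, by simp, ?_⟩
    have e5 : (dlt (p ::ₘ D - D₀)).sum + (dlt D₀).sum = (dlt (p ::ₘ D)).sum := by
      rw [← Multiset.sum_add, ← dlt_add, tsub_add_cancel_of_le hle]
    rw [hU0, add_zero, dlt_sum (p ::ₘ D), e1, e2, hs, sub_self] at e5
    simp [e5]
  have key2 : ∀ (x y x' y' : ZMod n) (C₁ C₂ : Multiset (ZMod n)), B₁ = x ::ₘ x' ::ₘ C₁ →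
      B₂ = y ::ₘ y' ::ₘ C₂ → x - y = x' - y' := by
    intro x y x' y' C₁ C₂ e1 e2
    have c1 : C₁.card = n - 2 := by rw [e1] at h1; simp at h1; omega
    have c2 : C₂.card = n - 2 := by rw [e2] at h2; simp at h2; omega
    obtain ⟨D, d1, d2⟩ := exists_pairs C₁ C₂ (by omega)
    have hDc : D.card = n - 2 := by rw [← c1, ← d1, Multiset.card_map]
    have hD0 : D ≠ 0 := by rintro rfl; simp at hDc; omega
    obtain ⟨p, hp⟩ := Multiset.exists_mem_of_ne_zero hD0
    obtain ⟨D, rfl⟩ := Multiset.exists_cons_of_mem hp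
    have := key p ((x, y) ::ₘ (x', y') ::ₘ D) (by
        rw [e1, ← d1]; simp only [Multiset.map_cons]
        rw [Multiset.cons_swap p.1, Multiset.cons_swap p.1]) (by
        rw [e2, ← d2]; simp only [Multiset.map_cons]
        rw [Multiset.cons_swap p.2, Multiset.cons_swap p.2])
    have hz : ZSF ((x - y) ::ₘ (x' - y') ::ₘ dlt D) := by simpa [dlt] using this
    refine zsf_eq hz ?_
    rw [ZMod.card]
    simp [dlt] at hDc ⊢
    omega
  have key3 : ∀ (x y x' y' : ZMod n) (C₁ C₂ : Multiset (ZMod n)), B₁ = x ::ₘ x' ::ₘ C₁ →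
      B₂ = y ::ₘ y' ::ₘ C₂ → x = x' ∧ y = y' := by
    intro x y x' y' C₁ C₂ e1 e2
    have k1 := key2 x y x' y' C₁ C₂ e1 e2
    have k2 := key2 x y' x' y C₁ C₂ e1 (by rw [e2, Multiset.cons_swap])
    have hy : y = y' := two_cancel hodd (by linear_combination k2 - k1)
    refine ⟨?_, hy⟩
    rw [hy] at k1
    simpa using k1
  have hB1 : B₁ ≠ 0 := by rintro rfl; simp at h1; omega
  have hB2 : B₂ ≠ 0 := by rintro rfl; simp at h2; omega
  obtain ⟨x, hx⟩ := Multiset.exists_mem_of_ne_zero hB1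
  obtain ⟨y, hy⟩ := Multiset.exists_mem_of_ne_zero hB2
  obtain ⟨C₁, e1⟩ := Multiset.exists_cons_of_mem hx
  obtain ⟨C₂, e2⟩ := Multiset.exists_cons_of_mem hy
  have c1 : C₁.card = n - 1 := by rw [e1] at h1; simp at h1; omega
  have c2 : C₂.card = n - 1 := by rw [e2] at h2; simp at h2; omega
  have hC1 : C₁ ≠ 0 := by rintro rfl; simp at c1; omega
  have hC2 : C₂ ≠ 0 := by rintro rfl; simp at c2; omega
  have r1 : C₁ = Multiset.replicate (n - 1) x := by
    refine Multiset.eq_replicate.2 ⟨c1, fun x' hx' => ?_⟩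
    obtain ⟨F₁, f1⟩ := Multiset.exists_cons_of_mem hx'
    obtain ⟨y', hy'⟩ := Multiset.exists_mem_of_ne_zero hC2
    obtain ⟨F₂, f2⟩ := Multiset.exists_cons_of_mem hy'
    exact (key3 x y x' y' F₁ F₂ (by rw [e1, f1]) (by rw [e2, f2])).1.symm
  have r2 : C₂ = Multiset.replicate (n - 1) y := by
    refine Multiset.eq_replicate.2 ⟨c2, fun y' hy' => ?_⟩
    obtain ⟨x', hx'⟩ := Multiset.exists_mem_of_ne_zero hC1
    obtain ⟨F₁, f1⟩ := Multiset.exists_cons_of_mem hx'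
    obtain ⟨F₂, f2⟩ := Multiset.exists_cons_of_mem hy'
    exact (key3 x y x' y' F₁ F₂ (by rw [e1, f1]) (by rw [e2, f2])).2.symm
  have hn1 : n - 1 + 1 = n := by omega
  refine ⟨x, y, ?_, ?_, ?_⟩
  · apply unit_of_zsf
    have := key (x, y) (Multiset.replicate (n - 1) (x, y)) (by simp [e1, r1])
      (by simp [e2, r2])
    simpa [dlt] using this
  · rw [e1, r1, ← Multiset.replicate_succ, hn1]
  · rw [e2, r2, ← Multiset.replicate_succ, hn1]

/-- one pair of reflections -/
lemma case_one (hn : 3 ≤ n) (hodd : Odd n) {A : Multiset (ZMod n)} {b b' : ZMod n}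
    (hA : A.card = 2 * n - 2) (hm : IsMinimalProductOne (sqn A (pb {(b, b')})))
    (hg : Good (A + dlt {(b, b')})) :
    ∃ g, IsUnit g ∧ A = Multiset.replicate (2 * n - 2) g ∧ b = b' := by
  have hD : ({(b, b')} : Multiset (ZMod n × ZMod n)) ≠ 0 := by simp
  have hAmin := minA hm hD
  have hu : SS A = Finset.univ := by
    have := ns (E := {(b, b')}) (D := 0) hodd (by simpa using hm) hD (by simpa using hg)
      (by simp [hA]; omega)
    simpa [dlt] using this
  have key : ∀ A' ≤ A, SS A' = Finset.univ → ZSF (A - A') := by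
    intro A' hle hA' U hU hs
    by_contra h0
    refine hAmin U (hU.trans tsub_le_self) h0 hs (good_of_univ (zcard_odd hodd) hA' ?_)
    have : A' + U ≤ A := by rw [add_comm]; exact (le_tsub_iff_right hle).1 hU
    exact (le_tsub_of_add_le_right this).trans (Multiset.le_add_right _ _)
  have key2 : ∀ A' ≤ A, SS A' = Finset.univ → A'.card ≤ n - 1 →
      ∃ g, A - A' = Multiset.replicate (n - 1) g ∧ IsUnit g := by
    intro A' hle hA' hc
    have z := key A' hle hA'
    have c1 := z.card_lt
    have c2 := Finset.card_le_univ (SS (A - A'))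
    rw [ZMod.card] at c2
    have c3 : (A - A').card = A.card - A'.card := Multiset.card_sub hle
    have c4 : (A - A').card = n - 1 := by omega
    obtain ⟨g, hg⟩ := zsf_replicate z (by intro h; rw [h] at c4; simp at c4; omega)
      (by rw [ZMod.card]; omega)
    rw [c4] at hg
    exact ⟨g, hg, unit_of_zsf (hg ▸ z)⟩
  obtain ⟨A', a1, a2, -, a4⟩ := greedy0 A
  have c2 := Finset.card_le_univ (SS A')
  rw [ZMod.card] at c2
  obtain ⟨g, hg1, hgu⟩ := key2 A' a1 (by rw [← a4, hu]) (by omega)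
  have hun : SS (Multiset.replicate (n - 1) g) = Finset.univ := by
    have := univ_of_repl hgu (g' := g) (by
      rintro rfl
      have : (1 : ZMod n) ≠ 0 := by
        haveI : Fact (1 < n) := ⟨by omega⟩
        exact one_ne_zero
      exact this (by simpa using (isUnit_zero_iff.1 hgu).symm))
    rw [← Multiset.replicate_one, ← Multiset.replicate_add] at this
    rwa [show n - 2 + 1 = n - 1 by omega] at this
  have hsum : Multiset.replicate (n - 1) g + A' = A := by
    rw [← hg1, tsub_add_cancel_of_le a1]
  obtain ⟨g', hg2, hgu'⟩ := key2 (Multiset.replicate (n - 1) g)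
    (by rw [← hsum]; exact Multiset.le_add_right _ _) hun (by simp)
  have hAz : A' = Multiset.replicate (n - 1) g' := by
    rw [← hg2, ← hsum, add_tsub_cancel_left]
  have hgz : g' ≠ 0 := by
      rintro rfl
      have : (1 : ZMod n) ≠ 0 := by
        haveI : Fact (1 < n) := ⟨by omega⟩
        exact one_ne_zero
      exact this (by simpa using (isUnit_zero_iff.1 hgu').symm)
  have hAe : A = (Multiset.replicate (n - 2) g + {g'}) + (g ::ₘ Multiset.replicate (n - 2) g') := by
    rw [← hsum, hAz, show n - 1 = n - 2 + 1 by omega, Multiset.replicate_succ,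
      Multiset.replicate_succ, ← Multiset.singleton_add, ← Multiset.singleton_add,
      ← Multiset.singleton_add]
    abel
  obtain ⟨g'', hg3, -⟩ := key2 (Multiset.replicate (n - 2) g + {g'})
    (by rw [hAe]; exact Multiset.le_add_right _ _) (univ_of_repl hgu hgz) (by simp; omega)
  rw [hAe, add_tsub_cancel_left] at hg3
  have hgg : g = g' := by
    have m1 : g ∈ Multiset.replicate (n - 1) g'' := by rw [← hg3]; simp
    have m2 : g' ∈ Multiset.replicate (n - 1) g'' := by
      rw [← hg3]
      refine Multiset.mem_cons_of_mem (Multiset.mem_replicate.2 ⟨by omega, rfl⟩)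
    rw [Multiset.eq_of_mem_replicate m1, Multiset.eq_of_mem_replicate m2]
  subst hgg
  have hAr : A = Multiset.replicate (2 * n - 2) g := by
    rw [← hsum, hAz, ← Multiset.replicate_add]; congr 1; omega
  refine ⟨g, hgu, hAr, ?_⟩
  by_contra hbb
  -- remove n copies of g
  have hle : Multiset.replicate n g ≤ A := by
    rw [hAr]; exact Multiset.replicate_mono g (by omega)
  refine hAmin (Multiset.replicate n g) hle ?_ ?_ ?_
  · intro h
    have := congrArg Multiset.card h
    simp at this; omega
  · simp
  · have e : A - Multiset.replicate n g = Multiset.replicate (n - 2) g := by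
      apply tsub_eq_of_eq_add
      rw [hAr, ← Multiset.replicate_add]; congr 1; omega
    rw [e]
    obtain ⟨k, -, hk⟩ := exists_half (zcard_odd hodd) ⊤ (l := b - b') trivial
    obtain ⟨j, hj, rfl⟩ := exists_nat_mul hgu k
    have hj0 : j ≠ 0 := by
      rintro rfl
      simp at hk
      exact hbb (sub_eq_zero.1 hk.symm)
    refine ⟨Multiset.replicate (j - 1) g, ?_, ?_⟩
    · exact (Multiset.replicate_mono g (by omega)).trans (Multiset.le_add_right _ _)
    · simp only [Multiset.sum_replicate, Multiset.sum_add, dlt, Multiset.map_singleton,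
        Multiset.sum_singleton]
      rw [← hk]
      obtain ⟨i, rfl⟩ := Nat.exists_eq_succ_of_ne_zero hj0
      obtain ⟨c, rfl⟩ := Nat.exists_eq_add_of_le (show 2 ≤ n by omega)
      have hz : ((2 + c : ℕ) : ZMod (2 + c)) = 0 := ZMod.natCast_self _
      push_cast at hz
      simp only [nsmul_eq_mul, Nat.succ_sub_one, Nat.add_sub_cancel_left]
      push_cast
      linear_combination (-g) * hz

end forward

section mixed
open DihedralGroup Pointwise
set_option linter.unusedSectionVars false
variable {n : ℕ} [NeZero n]

lemma pb_split {b : ZMod n} {D : Multiset (ZMod n × ZMod n)} (h : b ∈ pb D) :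
    ∃ p D₁ c, D = p ::ₘ D₁ ∧ pb D = b ::ₘ c ::ₘ pb D₁ := by
  rw [pb, Multiset.mem_add, Multiset.mem_map, Multiset.mem_map] at h
  rcases h with ⟨p, hp, rfl⟩ | ⟨p, hp, rfl⟩
  · obtain ⟨D₁, rfl⟩ := Multiset.exists_cons_of_mem hp
    exact ⟨p, D₁, p.2, rfl, pb_cons _ _⟩
  · obtain ⟨D₁, rfl⟩ := Multiset.exists_cons_of_mem hp
    exact ⟨p, D₁, p.1, rfl, by rw [pb_cons, Multiset.cons_swap]⟩

lemma central_bound : ∀ m : ℕ, 2 ≤ m → 2 * m + 2 ≤ Nat.centralBinom m := by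
  intro m hm
  induction m, hm using Nat.le_induction with
  | base => decide
  | succ k hk ih =>
    have := Nat.succ_mul_centralBinom_succ k
    nlinarith

lemma mixed_nodup (hodd : Odd n) {A : Multiset (ZMod n)} {D : Multiset (ZMod n × ZMod n)}
    {m : ℕ} (h2 : 2 ≤ m) (hmn : m + 1 ≤ n) (hD : D.card = m) (hA : A.card + 2 * m = 2 * n)
    (hm : IsMinimalProductOne (sqn A (pb D))) (hg : Good (A + dlt D)) : (pb D).Nodup := by
  have fin : ∀ (p q : ZMod n × ZMod n) (D₂ : Multiset (ZMod n × ZMod n)) (b : ZMod n)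
      (q' : ZMod n × ZMod n), D = p ::ₘ q ::ₘ D₂ → pb D = b ::ₘ b ::ₘ pb (q' ::ₘ D₂) → False := by
    intro p q D₂ b q' e1 e2
    have eD : D = (p ::ₘ {q}) + D₂ := by rw [e1]; simp
    have hu : SS (A + dlt D₂) = Finset.univ := by
      apply ns (E := p ::ₘ {q}) hodd
      · rwa [← eD]
      · simp
      · rwa [← eD]
      · rw [e1] at hD
        simp at hD
        omega
    have hg2 : Good (A + dlt (q' ::ₘ D₂)) := by
      refine good_of_univ (zcard_odd hodd) hu (add_le_add le_rfl ?_)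
      simp [dlt, Multiset.le_cons_self]
    refine hm.2.2 (sqn 0 (pb {(b, b)})) (sqn A (pb (q' ::ₘ D₂)))
      (sqn_ne_zero (Or.inr (pb_ne_zero (by simp)))) (sqn_ne_zero (Or.inr (pb_ne_zero (by simp))))
      (po_pairs (by simp) (by simp [dlt])) (po_of_good (by simp) hg2) ?_
    rw [← sqn_add, e2, zero_add]
    have e3 : pb ({(b, b)} : Multiset (ZMod n × ZMod n)) = {b} + {b} := by simp [pb]
    rw [e3, add_assoc, Multiset.singleton_add, Multiset.singleton_add]
  rw [Multiset.nodup_iff_ne_cons_cons]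
  intro b R hR
  obtain ⟨p, D₁, c, e1, e2⟩ := pb_split (b := b) (D := D) (by rw [hR]; simp)
  have e3 : c ::ₘ pb D₁ = b ::ₘ R := by
    rw [hR] at e2
    exact ((Multiset.cons_inj_right b).1 e2).symm
  by_cases hcb : c = b
  · subst hcb
    have hD1 : D₁ ≠ 0 := by
      rintro rfl
      rw [e1] at hD; simp at hD; omega
    obtain ⟨q, hq⟩ := Multiset.exists_mem_of_ne_zero hD1
    obtain ⟨D₂, rfl⟩ := Multiset.exists_cons_of_mem hq
    exact fin p q D₂ c q e1 e2
  · have hb : b ∈ pb D₁ := by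
      have : b ∈ c ::ₘ pb D₁ := by rw [e3]; simp
      rcases Multiset.mem_cons.1 this with h | h
      · exact absurd h.symm hcb
      · exact h
    obtain ⟨q, D₂, c', f1, f2⟩ := pb_split hb
    subst f1
    refine fin p q D₂ b (c, c') e1 ?_
    rw [e2, f2, pb_cons, Multiset.cons_swap c b]

lemma case_mixed (hodd : Odd n) {A : Multiset (ZMod n)}
    {D : Multiset (ZMod n × ZMod n)}
    {m : ℕ} (h2 : 2 ≤ m) (hmn : m + 1 ≤ n) (hD : D.card = m) (hA : A.card + 2 * m = 2 * n)
    (hm : IsMinimalProductOne (sqn A (pb D))) (hg : Good (A + dlt D)) : False := by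
  classical
  have hnd := mixed_nodup hodd h2 hmn hD hA hm hg
  have hD0 : D ≠ 0 := by rintro rfl; simp at hD; omega
  obtain ⟨Bf, hBf⟩ : ∃ Bf : Finset (ZMod n), Bf.val = pb D := ⟨⟨pb D, hnd⟩, rfl⟩
  have hBc : Bf.card = 2 * m := by rw [← hD, ← pb_card D, ← hBf]; rfl
  have hBn : 2 * m ≤ n := by
    have := Finset.card_le_univ Bf
    rw [ZMod.card] at this; omega
  have hSA : SS A = Finset.univ := by
    have := ns (E := D) (D := 0) hodd (by simpa using hm) hD0 (by simpa using hg)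
      (by simp; omega)
    simpa [dlt] using this
  rw [← hBf] at hm
  -- no balanced proper pairs of subsets
  have bal : ∀ U V : Finset (ZMod n), U ⊆ Bf → V ⊆ Bf → Disjoint U V → U.card = V.card →
      1 ≤ U.card → U.card < m → ∑ x ∈ U, x = ∑ x ∈ V, x → False := by
    intro U V hU hV hd hc h1 hlt hs
    have hUV : U ∪ V ⊆ Bf := Finset.union_subset hU hV
    have hcu : (U ∪ V).card = U.card + V.card := Finset.card_union_of_disjoint hd
    have hcr : (Bf \ (U ∪ V)).card = 2 * (m - U.card) := by
      rw [Finset.card_sdiff_of_subset hUV]; omega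
    obtain ⟨D', d1, d2⟩ := exists_pairs_even (m - U.card) (Bf \ (U ∪ V)).val hcr
    have hDz : D' ≠ 0 := by rintro rfl; simp at d2; omega
    have huv : U.val + V.val = (U ∪ V).val := by
      rw [← Finset.disjUnion_eq_union U V hd]; rfl
    have p1 : IsProductOne (sqn (0 + 0) (U.val + V.val)) := by
      apply po_suff
      · exact hc
      · intro h0
        have : U.card = 0 := by rw [Finset.card_def, h0]; rfl
        omega
      · rw [Finset.sum, Finset.sum, Multiset.map_id', Multiset.map_id'] at hs; rw [hs]
    have p2 : IsProductOne (sqn A (pb D')) :=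
      po_of_good hDz (good_of_univ (zcard_odd hodd) hSA (Multiset.le_add_right _ _))
    refine hm.2.2 _ _ (sqn_ne_zero (Or.inr ?_)) (sqn_ne_zero (Or.inr (pb_ne_zero hDz))) p1 p2 ?_
    · intro h0
      rw [huv] at h0
      have : (U ∪ V).card = 0 := by rw [Finset.card_def, h0]; rfl
      omega
    · rw [← sqn_add, d1, huv, add_zero, zero_add, Finset.sdiff_val,
        add_tsub_cancel_of_le (Finset.val_le_iff.2 hUV)]
  set F := Finset.powersetCard m Bf with hF
  have memF : ∀ {U}, U ∈ F ↔ U ⊆ Bf ∧ U.card = m := by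
    intro U; rw [hF, Finset.mem_powersetCard]
  have core : ∀ U ∈ F, ∀ V ∈ F, ∑ x ∈ U, x = ∑ x ∈ V, x → V = U ∨ V = Bf \ U := by
    intro U hU V hV hs
    obtain ⟨hU, cU⟩ := memF.1 hU
    obtain ⟨hV, cV⟩ := memF.1 hV
    have k1 := Finset.card_sdiff_add_card_inter U V
    have k2 := Finset.card_sdiff_add_card_inter V U
    rw [Finset.inter_comm V U] at k2
    have s1 : ∑ x ∈ U \ V, x + ∑ x ∈ U ∩ V, x = ∑ x ∈ U, x := by
      rw [← Finset.sum_union (Finset.disjoint_sdiff_inter U V), Finset.sdiff_union_inter]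
    have s2 : ∑ x ∈ V \ U, x + ∑ x ∈ U ∩ V, x = ∑ x ∈ V, x := by
      rw [Finset.inter_comm U V,
        ← Finset.sum_union (Finset.disjoint_sdiff_inter V U), Finset.sdiff_union_inter]
    by_cases h0 : (U \ V).card = 0
    · left
      have := Finset.sdiff_eq_empty_iff_subset.1 (Finset.card_eq_zero.1 h0)
      exact (Finset.eq_of_subset_of_card_le this (by omega)).symm
    · by_cases h1 : (U ∩ V).card = 0
      · right
        have hd : Disjoint U V := Finset.disjoint_iff_inter_eq_empty.2 (Finset.card_eq_zero.1 h1)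
        refine Finset.eq_of_subset_of_card_le ?_ ?_
        · exact Finset.subset_sdiff.2 ⟨hV, hd.symm⟩
        · rw [Finset.card_sdiff_of_subset hU]; omega
      · exfalso
        refine bal (U \ V) (V \ U) (Finset.sdiff_subset.trans hU) (Finset.sdiff_subset.trans hV)
          disjoint_sdiff_sdiff (by omega) (by omega) (by omega) ?_
        rw [← hs, ← s1] at s2
        exact (add_right_cancel s2).symm
  set X := F.image (fun U => ∑ x ∈ U, x) with hX
  have hFc : 2 * m + 2 ≤ F.card := by
    rw [hF, Finset.card_powersetCard, hBc]
    exact central_bound m h2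
  have hXc : 2 * m ≤ X.card := by
    set P : Finset (ZMod n) → Prop := fun U => ∑ x ∈ U, x + ∑ x ∈ U, x = ∑ x ∈ Bf, x with hP
    have c1 : (F.filter P).card ≤ 2 := by
      by_cases he : F.filter P = ∅
      · rw [he]; simp
      · obtain ⟨U, hU⟩ := Finset.nonempty_iff_ne_empty.2 he
        have hsub : F.filter P ⊆ {U, Bf \ U} := by
          intro V hV
          rw [Finset.mem_filter] at hU hV
          have := core U hU.1 V hV.1 (two_cancel hodd (hU.2.trans hV.2.symm))
          simpa using this
        exact (Finset.card_le_card hsub).trans Finset.card_le_two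
    have c2 := Finset.card_filter_add_card_filter_not (s := F) P
    have c3 : (F.filter (fun U => ¬ P U)).card ≤ X.card := by
      refine Finset.card_le_card_of_injOn (fun U => ∑ x ∈ U, x) ?_ ?_
      · intro U hU
        rw [Finset.mem_coe, Finset.mem_filter] at hU
        exact Finset.mem_coe.2 (Finset.mem_image_of_mem _ hU.1)
      · intro U hU V hV hs
        rw [Finset.mem_coe, Finset.mem_filter] at hU hV
        rcases core U hU.1 V hV.1 hs with h | h
        · exact h.symm
        · exfalso
          apply hU.2
          have e := Finset.sum_sdiff (memF.1 hU.1).1 (f := fun x => x)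
          rw [← h] at e
          change ∑ x ∈ U, x = ∑ x ∈ V, x at hs
          change ∑ x ∈ U, x + ∑ x ∈ U, x = ∑ x ∈ Bf, x
          rw [← e, ← hs]
    omega
  obtain ⟨A', a1, a2, a3⟩ := greedy (⊥ : AddSubgroup (ZMod n)) A X bot_le
  have a4 := absorb a1 a3
  rw [AddSubgroup.card_bot, mul_one] at a2
  have a5 : X + SS A' = Finset.univ := by
    rw [← a4, hSA]
    have : X.Nonempty := Finset.card_pos.1 (by omega)
    obtain ⟨x, hx⟩ := this
    ext z
    simp only [Finset.mem_univ, iff_true]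
    exact Finset.mem_add.2 ⟨x, hx, z - x, Finset.mem_univ _, by ring⟩
  rw [a5, Finset.card_univ, ZMod.card] at a2
  have a6 : (A - A').card = A.card - A'.card := Multiset.card_sub a1
  have a7 : ¬ ZSF (A - A') := by
    intro z
    have c1 := z.card_lt
    have c2 := Finset.card_le_univ (SS (A - A'))
    rw [ZMod.card] at c2
    omega
  unfold ZSF at a7
  push Not at a7
  obtain ⟨A₀, z1, z2, z3⟩ := a7
  have z4 : A₀ ≤ A := z1.trans tsub_le_self
  have z5 : A' ≤ A - A₀ := by
    have : A' + A₀ ≤ A := by rw [add_comm]; exact (le_tsub_iff_right a1).1 z1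
    exact le_tsub_of_add_le_right this
  obtain ⟨k, -, hk⟩ := exists_half (zcard_odd hodd) ⊤
    (l := (A - A₀).sum + ∑ x ∈ Bf, x) trivial
  have hkm : k ∈ X + SS A' := by rw [a5]; simp
  obtain ⟨v, hv, u, hu, hvu⟩ := Finset.mem_add.1 hkm
  obtain ⟨V, hV, rfl⟩ := Finset.mem_image.1 hv
  obtain ⟨U, hU, rfl⟩ := mem_SS.1 hu
  obtain ⟨hVB, hVc⟩ := memF.1 hV
  obtain ⟨W, hW⟩ := Multiset.le_iff_exists_add.1 (hU.trans z5)
  have hBs : V.val + (Bf \ V).val = Bf.val := by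
    rw [Finset.sdiff_val, add_tsub_cancel_of_le (Finset.val_le_iff.2 hVB)]
  have p2 : IsProductOne (sqn (U + W) (V.val + (Bf \ V).val)) := by
    apply po_suff
    · change V.card = (Bf \ V).card
      rw [Finset.card_sdiff_of_subset hVB]; omega
    · intro h0
      have : V.card = 0 := by rw [Finset.card_def, h0]; rfl
      omega
    · have e := Finset.sum_sdiff hVB (f := fun x => x)
      have e1 : V.val.sum = ∑ x ∈ V, x := by rw [Finset.sum, Multiset.map_id']
      have e2 : (Bf \ V).val.sum = ∑ x ∈ Bf \ V, x := by rw [Finset.sum, Multiset.map_id']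
      rw [e1, e2]
      rw [hW, Multiset.sum_add, ← e, ← hvu] at hk
      linear_combination hk
  rw [hBs, ← hW] at p2
  refine hm.2.2 _ _ (sqn_ne_zero (Or.inl z3)) (sqn_ne_zero (Or.inr ?_)) (po_rot z2) p2 ?_
  · rw [hBf]; exact pb_ne_zero hD0
  · rw [← sqn_add, add_tsub_cancel_of_le z4, zero_add]

end mixed

section both
open DihedralGroup Pointwise
set_option linter.unusedSectionVars false
variable {n : ℕ} [NeZero n]

lemma forward_dihedral (hn : 3 ≤ n) (hodd : Odd n) {S : Multiset (DihedralGroup n)}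
    (hc : S.card = 2 * n) (hm : IsMinimalProductOne S) :
    (∃ g b, IsUnit g ∧ S = sqn (Multiset.replicate (2 * n - 2) g) (Multiset.replicate 2 b)) ∨
    (∃ x y, IsUnit (x - y) ∧ S = sqn 0 (Multiset.replicate n x + Multiset.replicate n y)) := by
  classical
  obtain ⟨A₁, A₂, B₁, B₂, rfl, h0, hB, hs⟩ := po_nec hm.2.1
  rw [sqn_card, Multiset.card_add B₁] at hc
  by_cases hB0 : B₁ = 0
  · exfalso
    have hA2 := h0 hB0
    have hB2 : B₂ = 0 := by
      rw [hB0] at hB; exact Multiset.card_eq_zero.1 hB.symm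
    subst hB0 hA2 hB2
    simp only [add_zero, Multiset.sum_zero, Multiset.card_zero] at hc hs hm
    have hA : A₁ ≠ 0 := by rintro rfl; simp at hc; omega
    obtain ⟨a, ha⟩ := Multiset.exists_mem_of_ne_zero hA
    obtain ⟨R, rfl⟩ := Multiset.exists_cons_of_mem ha
    have hz : ¬ ZSF R := by
      intro z
      have c1 := z.card_lt
      have c2 := Finset.card_le_univ (SS R)
      rw [ZMod.card] at c2
      rw [Multiset.card_cons] at hc
      omega
    unfold ZSF at hz
    push Not at hz
    obtain ⟨U, hU, hU0, hUn⟩ := hz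
    have e : U + (a ::ₘ (R - U)) = a ::ₘ R := by
      rw [Multiset.add_cons, add_tsub_cancel_of_le hU]
    refine hm.2.2 (sqn U 0) (sqn (a ::ₘ (R - U)) 0) (sqn_ne_zero (Or.inl hUn))
      (sqn_ne_zero (Or.inl (by simp))) (po_rot hU0) (po_rot ?_) ?_
    · rw [← e, Multiset.sum_add, hU0, zero_add] at hs; exact hs
    · rw [← sqn_add, e, add_zero]
  · obtain ⟨D, d1, d2⟩ := exists_pairs B₁ B₂ hB
    have hpb : pb D = B₁ + B₂ := by rw [pb, d1, d2]
    have hDc : D.card = B₁.card := by rw [← d1, Multiset.card_map]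
    have hg : Good (A₁ + A₂ + dlt D) := by
      refine ⟨A₁ + dlt D, ?_, ?_⟩
      · rw [add_right_comm]; exact Multiset.le_add_right _ _
      · simp only [Multiset.sum_add, dlt_sum, d1, d2]
        linear_combination hs
    have hBpos : 0 < B₁.card := Multiset.card_pos.2 hB0
    by_cases hA0 : A₁ + A₂ = 0
    · right
      have e1 : A₁ = 0 := (add_eq_zero.1 hA0).1
      have e2 : A₂ = 0 := (add_eq_zero.1 hA0).2
      subst e1 e2
      simp only [add_zero, Multiset.sum_zero, zero_add, Multiset.card_zero] at hc hs hm
      obtain ⟨x, y, hu, rfl, rfl⟩ := case_zero hn hodd (by omega) (by omega) hs hm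
      exact ⟨x, y, hu, by rw [add_zero]⟩
    · have hApos : 0 < (A₁ + A₂).card := Multiset.card_pos.2 hA0
      by_cases h1 : D.card = 1
      · left
        obtain ⟨⟨b, b'⟩, rfl⟩ := Multiset.card_eq_one.1 h1
        rw [← hpb] at hm ⊢
        obtain ⟨g, hu, e, rfl⟩ := case_one hn hodd (by omega) hm hg
        refine ⟨g, b, hu, ?_⟩
        rw [e]
        congr 1
      · exfalso
        rw [← hpb] at hm
        exact case_mixed (m := D.card) hodd (by omega) (by omega) rfl (by omega) hm hg

lemma modeq_of_smul {u : ZMod n} (hu : IsUnit u) {s t : ℕ} (h : s • u = t • u) :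
    s ≡ t [MOD n] := by
  rw [nsmul_eq_mul, nsmul_eq_mul] at h
  exact (ZMod.natCast_eq_natCast_iff s t n).1 (hu.mul_right_cancel h)

lemma eq_repl {g : ZMod n} {k : ℕ} {A : Multiset (ZMod n)} (h : A ≤ Multiset.replicate k g) :
    A = Multiset.replicate A.card g :=
  Multiset.eq_replicate_card.2 fun _ hx => Multiset.eq_of_mem_replicate (Multiset.mem_of_le h hx)

lemma back_a (hn : 3 ≤ n) (hodd : Odd n) {g b : ZMod n} (hg : IsUnit g) :
    IsMinimalProductOne
      (sqn (Multiset.replicate (2 * n - 2) g) (Multiset.replicate 2 b)) := by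
  refine ⟨sqn_ne_zero (Or.inr (by simp)), ?_, ?_⟩
  · have := po_suff {b} {b} (Multiset.replicate (n - 1) g) (Multiset.replicate (n - 1) g) rfl
      (by simp) rfl
    rwa [← Multiset.replicate_add, ← Multiset.replicate_one, ← Multiset.replicate_add,
      show n - 1 + (n - 1) = 2 * n - 2 by omega] at this
  · -- one part is made of rotations
    have key : ∀ A₁ A₂ A₃ B₂ B₃ : Multiset (ZMod n), A₁ ≠ 0 → A₁.sum = 0 →
        B₂.card = B₃.card → A₂.sum + B₂.sum = A₃.sum + B₃.sum →
        A₁ + (A₂ + A₃) = Multiset.replicate (2 * n - 2) g →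
        B₂ + B₃ = Multiset.replicate 2 b → False := by
      intro A₁ A₂ A₃ B₂ B₃ hA1 hs1 hc hs hA hB
      have a1 := eq_repl (A := A₁) (g := g) (k := 2 * n - 2)
        (by rw [← hA]; exact Multiset.le_add_right _ _)
      have a2 := eq_repl (A := A₂) (g := g) (k := 2 * n - 2)
        (by rw [← hA]; exact (Multiset.le_add_right _ _).trans (Multiset.le_add_left _ _))
      have a3 := eq_repl (A := A₃) (g := g) (k := 2 * n - 2)
        (by rw [← hA]; exact (Multiset.le_add_left _ _).trans (Multiset.le_add_left _ _))
      have b2 := eq_repl (A := B₂) (g := b) (k := 2)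
        (by rw [← hB]; exact Multiset.le_add_right _ _)
      have b3 := eq_repl (A := B₃) (g := b) (k := 2)
        (by rw [← hB]; exact Multiset.le_add_left _ _)
      have cA := congrArg Multiset.card hA
      rw [Multiset.card_add, Multiset.card_add, Multiset.card_replicate] at cA
      have hpos : 0 < A₁.card := Multiset.card_pos.2 hA1
      rw [a1, Multiset.sum_replicate] at hs1
      have d1 : A₁.card ≡ 0 [MOD n] := modeq_of_smul hg (by rw [hs1, zero_nsmul])
      have d2 : n ∣ A₁.card := (Nat.modEq_zero_iff_dvd).1 d1
      obtain ⟨c, hc1⟩ := d2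
      have c1 : c = 1 := by
        have : 0 < c := by
          rcases Nat.eq_zero_or_pos c with h | h
          · subst h; omega
          · exact h
        have : c < 2 := by
          by_contra hlt
          have : n * 2 ≤ n * c := Nat.mul_le_mul_left n (by omega)
          omega
        omega
      subst c1
      have hbs : B₂.sum = B₃.sum := by rw [b2, b3, hc]
      rw [hbs] at hs
      have hs2 := add_right_cancel hs
      rw [a2, a3, Multiset.sum_replicate, Multiset.sum_replicate] at hs2
      have d3 := (modeq_of_smul hg hs2).eq_of_lt_of_lt (by omega) (by omega)
      obtain ⟨w, hw⟩ := hodd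
      omega
    intro T₁ T₂ h1 h2 p1 p2 hT
    obtain ⟨A₁, A₂, B₁, B₂, rfl, z1, c1, s1⟩ := po_nec p1
    obtain ⟨A₃, A₄, B₃, B₄, rfl, z2, c2, s2⟩ := po_nec p2
    rw [← sqn_add] at hT
    obtain ⟨hA, hB⟩ := sqn_inj hT
    have cB := congrArg Multiset.card hB
    simp only [Multiset.card_add, Multiset.card_replicate] at cB
    by_cases hz : B₁.card = 0
    · have e1 : B₁ = 0 := Multiset.card_eq_zero.1 hz
      have e2 : B₂ = 0 := Multiset.card_eq_zero.1 (by omega)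
      have e3 := z1 e1
      subst e1 e2 e3
      simp only [add_zero, zero_add, Multiset.sum_zero] at *
      exact key A₁ A₃ A₄ B₃ B₄ (by rintro rfl; exact h1 rfl) s1 c2 s2 hA.symm hB.symm
    · have e1 : B₃ = 0 := Multiset.card_eq_zero.1 (by omega)
      have e2 : B₄ = 0 := Multiset.card_eq_zero.1 (by omega)
      have e3 := z2 e1
      subst e1 e2 e3
      simp only [add_zero, zero_add, Multiset.sum_zero] at *
      exact key A₃ A₁ A₂ B₁ B₂ (by rintro rfl; exact h2 rfl) s2 c1 s1
        (by rw [hA, add_comm]) hB.symm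

lemma sum_two {x y : ZMod n} (hxy : x ≠ y) : ∀ B : Multiset (ZMod n), (∀ z ∈ B, z = x ∨ z = y) →
    B.sum = B.count x • (x - y) + B.card • y := by
  intro B
  induction B using Multiset.induction_on with
  | empty => simp
  | cons a B ih =>
    intro h
    have := ih (fun z hz => h z (Multiset.mem_cons_of_mem hz))
    rw [Multiset.sum_cons, this, Multiset.card_cons]
    rcases h a (by simp) with rfl | rfl
    · rw [Multiset.count_cons_self]; simp only [nsmul_eq_mul]; push_cast; ring
    · rw [Multiset.count_cons_of_ne hxy]; simp only [nsmul_eq_mul]; push_cast; ring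

lemma back_b (hn : 3 ≤ n) (hodd : Odd n) {x y : ZMod n} (hu : IsUnit (x - y)) :
    IsMinimalProductOne
      (sqn 0 (Multiset.replicate n x + Multiset.replicate n y)) := by
  have hxy : x ≠ y := by
    rintro rfl
    have : Fact (1 < n) := ⟨by omega⟩
    simp at hu
  refine ⟨sqn_ne_zero (Or.inr ?_), ?_, ?_⟩
  · intro h
    have := congrArg Multiset.card h
    simp at this
    omega
  · have := po_suff (Multiset.replicate n x) (Multiset.replicate n y) 0 0 (by simp)
      (by intro h; have := congrArg Multiset.card h; simp at this; omega) (by simp)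
    simpa using this
  · intro T₁ T₂ h1 h2 p1 p2 hT
    obtain ⟨A₁, A₂, B₁, B₂, rfl, z1, c1, s1⟩ := po_nec p1
    obtain ⟨A₃, A₄, B₃, B₄, rfl, z2, c2, s2⟩ := po_nec p2
    rw [← sqn_add] at hT
    obtain ⟨hA, hB⟩ := sqn_inj hT
    have cA := congrArg Multiset.card hA
    simp only [Multiset.card_add, Multiset.card_zero] at cA
    have e1 : A₁ = 0 := Multiset.card_eq_zero.1 (by omega)
    have e2 : A₂ = 0 := Multiset.card_eq_zero.1 (by omega)
    have e3 : A₃ = 0 := Multiset.card_eq_zero.1 (by omega)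
    have e4 : A₄ = 0 := Multiset.card_eq_zero.1 (by omega)
    subst e1 e2 e3 e4
    have cB := congrArg Multiset.card hB
    simp only [Multiset.card_add, Multiset.card_replicate] at cB
    have kB := congrArg (Multiset.count x) hB
    simp only [Multiset.count_add, Multiset.count_replicate_self] at kB
    rw [Multiset.count_eq_zero_of_notMem (s := Multiset.replicate n y)
      (fun h => hxy (Multiset.eq_of_mem_replicate h)), add_zero] at kB
    have hmem : ∀ z ∈ B₁ + B₂ + (B₃ + B₄), z = x ∨ z = y := by
      intro z hz
      rw [← hB, Multiset.mem_add] at hz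
      rcases hz with h | h
      · exact Or.inl (Multiset.eq_of_mem_replicate h)
      · exact Or.inr (Multiset.eq_of_mem_replicate h)
    have p1 : B₁.card ≠ 0 := by
      intro h
      have f1 := Multiset.card_eq_zero.1 h
      have f2 : B₂ = 0 := Multiset.card_eq_zero.1 (by omega)
      subst f1 f2
      exact h1 rfl
    have p3 : B₃.card ≠ 0 := by
      intro h
      have f1 := Multiset.card_eq_zero.1 h
      have f2 : B₄ = 0 := Multiset.card_eq_zero.1 (by omega)
      subst f1 f2
      exact h2 rfl
    have l1 := Multiset.count_le_card x B₁
    have l2 := Multiset.count_le_card x B₂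
    have l3 := Multiset.count_le_card x B₃
    have l4 := Multiset.count_le_card x B₄
    simp only [Multiset.sum_zero, zero_add] at s1 s2
    rw [sum_two hxy B₁ (fun z hz => hmem z (by simp [hz])),
      sum_two hxy B₂ (fun z hz => hmem z (by simp [hz])), c1] at s1
    rw [sum_two hxy B₃ (fun z hz => hmem z (by simp [hz])),
      sum_two hxy B₄ (fun z hz => hmem z (by simp [hz])), c2] at s2
    have m1 := (modeq_of_smul hu (add_right_cancel s1)).eq_of_lt_of_lt (by omega) (by omega)
    have m2 := (modeq_of_smul hu (add_right_cancel s2)).eq_of_lt_of_lt (by omega) (by omega)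
    obtain ⟨w, hw⟩ := hodd
    omega

end both

section transport
open DihedralGroup
set_option linter.unusedSectionVars false

lemma po_map {G H : Type*} [Group G] [Group H] (e : G ≃* H) {S : Multiset G}
    (h : IsProductOne S) : IsProductOne (S.map e) := by
  obtain ⟨l, rfl, hp⟩ := h
  refine ⟨l.map e, by simp, ?_⟩
  rw [← map_list_prod, hp, map_one]

lemma map_symm_map {G H : Type*} [Group G] [Group H] (e : G ≃* H) (S : Multiset G) :
    (S.map e).map e.symm = S := by simp

lemma min_map {G H : Type*} [Group G] [Group H] (e : G ≃* H) {S : Multiset G}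
    (h : IsMinimalProductOne S) : IsMinimalProductOne (S.map e) := by
  refine ⟨by simpa using h.1, po_map e h.2.1, ?_⟩
  intro T₁ T₂ h1 h2 p1 p2 hT
  refine h.2.2 (T₁.map e.symm) (T₂.map e.symm) (by simpa using h1) (by simpa using h2)
    (po_map _ p1) (po_map _ p2) ?_
  rw [← map_symm_map e S, hT, Multiset.map_add]

lemma closure_map {G H : Type*} [Group G] [Group H] (e : G ≃* H) {a t : G}
    (h : Subgroup.closure {a, t} = ⊤) : Subgroup.closure {e a, e t} = ⊤ := by
  have := MonoidHom.map_closure (e : G →* H) {a, t}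
  rw [h, Subgroup.map_top_of_surjective _ e.surjective, Set.image_pair] at this
  exact this.symm

variable {n : ℕ} [NeZero n]

lemma closure_top {g b : ZMod n} (hg : IsUnit g) :
    Subgroup.closure {r g, sr b} = (⊤ : Subgroup (DihedralGroup n)) := by
  rw [eq_top_iff]
  have h1 : r g ∈ Subgroup.closure {r g, sr b} := Subgroup.subset_closure (by simp)
  have h2 : sr b ∈ Subgroup.closure {r g, sr b} := Subgroup.subset_closure (by simp)
  have h3 : ∀ i, r i ∈ Subgroup.closure {r g, sr b} := by
    intro i
    obtain ⟨k, -, rfl⟩ := exists_nat_mul hg i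
    have := Subgroup.pow_mem _ h1 k
    rw [r_pow] at this
    rwa [nsmul_eq_mul, mul_comm]
  intro x _
  cases x with
  | r i => exact h3 i
  | sr i =>
    have := Subgroup.mul_mem _ h2 (h3 (i - b))
    rwa [sr_mul_r, add_sub_cancel] at this

lemma shape_of (hn : 3 ≤ n) (hodd : Odd n) {α τ : DihedralGroup n}
    (h : Subgroup.closure {α, τ} = ⊤) (hα : α ^ n = 1) :
    ∃ g b, IsUnit g ∧ α = r g ∧ τ = sr b := by
  have : Fact (1 < n) := ⟨by omega⟩
  -- α is a rotation
  obtain ⟨g, rfl⟩ : ∃ g, α = r g := by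
    cases α with
    | r i => exact ⟨i, rfl⟩
    | sr i =>
      obtain ⟨c, hc⟩ := hodd
      exfalso
      have e : (sr i : DihedralGroup n) ^ 2 = 1 := by rw [pow_two, sr_mul_self]
      have e2 : (sr i : DihedralGroup n) ^ n = (sr i) ^ (2 * c + 1) := congrArg _ hc
      rw [e2, pow_succ, pow_mul, e, one_pow, one_mul, one_def] at hα
      cases hα
  obtain ⟨b, rfl⟩ : ∃ b, τ = sr b := by
    cases τ with
    | sr i => exact ⟨i, rfl⟩
    | r i =>
      exfalso
      have hc : ∀ x ∈ Subgroup.closure {r g, r i}, ∃ j : ZMod n, x = r j := by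
        intro x hx
        induction hx using Subgroup.closure_induction with
        | mem x hx =>
          rcases hx with rfl | hx
          · exact ⟨_, rfl⟩
          · rw [Set.mem_singleton_iff] at hx; exact ⟨_, hx⟩
        | one => exact ⟨0, rfl⟩
        | mul x y _ _ hx hy =>
          obtain ⟨j, rfl⟩ := hx
          obtain ⟨k, rfl⟩ := hy
          exact ⟨_, r_mul_r _ _⟩
        | inv x _ hx =>
          obtain ⟨j, rfl⟩ := hx
          exact ⟨-j, by simp⟩
      obtain ⟨j, hj⟩ := hc (sr 0) (by rw [h]; trivial)
      cases hj
  refine ⟨g, b, ?_, rfl, rfl⟩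
  have hc : ∀ x ∈ Subgroup.closure {r g, sr b}, ∃ k : ZMod n, x = r (k * g) ∨ x = sr (b + k * g) := by
    intro x hx
    induction hx using Subgroup.closure_induction with
    | mem x hx =>
      rcases hx with rfl | hx
      · exact ⟨1, Or.inl (by rw [one_mul])⟩
      · rw [Set.mem_singleton_iff] at hx; exact ⟨0, Or.inr (by rw [hx, zero_mul, add_zero])⟩
    | one => exact ⟨0, Or.inl (by rw [zero_mul]; rfl)⟩
    | mul x y _ _ hx hy =>
      obtain ⟨j, rfl | rfl⟩ := hx
      · obtain ⟨k, rfl | rfl⟩ := hy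
        · exact ⟨j + k, Or.inl (by rw [r_mul_r]; congr 1; ring)⟩
        · exact ⟨k - j, Or.inr (by rw [r_mul_sr]; congr 1; ring)⟩
      · obtain ⟨k, rfl | rfl⟩ := hy
        · exact ⟨j + k, Or.inr (by rw [sr_mul_r]; congr 1; ring)⟩
        · exact ⟨k - j, Or.inl (by rw [sr_mul_sr]; congr 1; ring)⟩
    | inv x _ hx =>
      obtain ⟨j, rfl | rfl⟩ := hx
      · exact ⟨-j, Or.inl (by rw [inv_r]; congr 1; ring)⟩
      · exact ⟨j, Or.inr (by rw [inv_sr])⟩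
  obtain ⟨k, hk | hk⟩ := hc (r 1) (by rw [h]; trivial)
  · have := (r.inj hk).symm
    rw [mul_comm] at this
    exact IsUnit.of_mul_eq_one _ this
  · cases hk

lemma zpow_mul_sr (g b : ZMod n) (i : ℤ) :
    (r g : DihedralGroup n) ^ i * sr b = sr (b - (i : ZMod n) * g) := by
  rw [r_zpow, r_mul_sr, mul_comm]

lemma unit_of_gcd {k : ℤ} (h : Int.gcd k (n : ℤ) = 1) : IsUnit (k : ZMod n) := by
  have hc : IsCoprime k (n : ℤ) := Int.isCoprime_iff_gcd_eq_one.2 h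
  obtain ⟨u, v, huv⟩ := hc
  have := congrArg (fun z : ℤ => (z : ZMod n)) huv
  push_cast at this
  rw [ZMod.natCast_self, mul_zero, add_zero, mul_comm] at this
  exact IsUnit.of_mul_eq_one _ this

lemma gcd_of_unit {k : ℤ} (h : IsUnit (k : ZMod n)) : Int.gcd k (n : ℤ) = 1 := by
  obtain ⟨w, hw⟩ := isUnit_iff_exists_inv.1 h
  have hz : ((k * (w.val : ℤ) - 1 : ℤ) : ZMod n) = 0 := by
    push_cast
    rw [ZMod.natCast_zmod_val, hw, sub_self]
  obtain ⟨c, hc⟩ := (ZMod.intCast_zmod_eq_zero_iff_dvd _ n).1 hz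
  rw [← Int.isCoprime_iff_gcd_eq_one]
  exact ⟨w.val, -c, by linear_combination hc⟩

lemma rel_gb (g b : ZMod n) : (r g : DihedralGroup n) ^ n = 1 ∧ (sr b : DihedralGroup n) ^ 2 = 1 ∧
    (sr b * r g : DihedralGroup n) = (r g)⁻¹ * sr b := by
  refine ⟨?_, ?_, ?_⟩
  · rw [r_pow, ZMod.natCast_self, mul_zero]; rfl
  · rw [pow_two, sr_mul_self]
  · rw [sr_mul_r, inv_r, r_mul_sr]; congr 1; ring

end transport

theorem minimal_product_one_of_maximal_length_dihedral_odd
    (n : ℕ) (hn : 3 ≤ n) (hodd : Odd n)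
    (G : Type*) [Group G] (hG : Nonempty (G ≃* DihedralGroup n))
    (S : Multiset G) (hcard : Multiset.card S = 2 * n) :
    IsMinimalProductOne S ↔
      ((∃ α τ : G, Subgroup.closure {α, τ} = ⊤ ∧ α ^ n = 1 ∧ τ ^ 2 = 1 ∧
          τ * α = α⁻¹ * τ ∧
          S = Multiset.replicate (2 * n - 2) α + Multiset.replicate 2 τ) ∨
        (∃ α τ : G, ∃ i j : ℤ, Subgroup.closure {α, τ} = ⊤ ∧ α ^ n = 1 ∧ τ ^ 2 = 1 ∧
          τ * α = α⁻¹ * τ ∧ i ∈ Set.Icc (0 : ℤ) ((n : ℤ) - 1) ∧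
          j ∈ Set.Icc (0 : ℤ) ((n : ℤ) - 1) ∧ Int.gcd (i - j) (n : ℤ) = 1 ∧
          S = Multiset.replicate n (α ^ i * τ) + Multiset.replicate n (α ^ j * τ))) := by
  have : NeZero n := ⟨by omega⟩
  obtain ⟨e⟩ := hG
  constructor
  · intro hm
    have tr : ∀ {a t : DihedralGroup n}, Subgroup.closure {a, t} = ⊤ → (a ^ n = 1 ∧ t ^ 2 = 1 ∧
        t * a = a⁻¹ * t) → Subgroup.closure {e.symm a, e.symm t} = ⊤ ∧ (e.symm a) ^ n = 1 ∧
        (e.symm t) ^ 2 = 1 ∧ e.symm t * e.symm a = (e.symm a)⁻¹ * e.symm t := by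
      rintro a t h ⟨h1, h2, h3⟩
      refine ⟨closure_map e.symm h, ?_, ?_, ?_⟩
      · rw [← map_pow, h1, map_one]
      · rw [← map_pow, h2, map_one]
      · rw [← map_mul, h3, map_mul, map_inv]
    rcases forward_dihedral hn hodd (S := S.map e) (by simpa using hcard) (min_map e hm) with
      ⟨g, b, hu, hS⟩ | ⟨x, y, hu, hS⟩
    · left
      obtain ⟨t1, t2, t3, t4⟩ := tr (closure_top (b := b) hu) (rel_gb g b)
      refine ⟨_, _, t1, t2, t3, t4, ?_⟩
      rw [← map_symm_map e S, hS]
      simp [sqn]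
    · right
      have hone : IsUnit (1 : ZMod n) := isUnit_one
      obtain ⟨t1, t2, t3, t4⟩ := tr (closure_top (b := 0) hone) (rel_gb 1 0)
      have hx : ((-x).val : ℤ) < n := by exact_mod_cast ZMod.val_lt (-x)
      have hy : ((-y).val : ℤ) < n := by exact_mod_cast ZMod.val_lt (-y)
      refine ⟨_, _, ((-x).val : ℤ), ((-y).val : ℤ), t1, t2, t3, t4, ⟨by positivity, by omega⟩,
        ⟨by positivity, by omega⟩, ?_, ?_⟩
      · apply gcd_of_unit
        push_cast
        rw [ZMod.natCast_zmod_val, ZMod.natCast_zmod_val]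
        have e1 : -x - -y = -(x - y) := by ring
        rw [e1]; exact hu.neg
      · rw [← map_symm_map e S, hS, ← map_zpow, ← map_zpow, ← map_mul, ← map_mul,
          zpow_mul_sr, zpow_mul_sr]
        simp [sqn, ZMod.natCast_zmod_val]
  · intro h
    rw [← map_symm_map e S]
    apply min_map e.symm
    rcases h with ⟨α, τ, h1, h2, -, -, rfl⟩ | ⟨α, τ, i, j, h1, h2, -, -, -, -, hij, rfl⟩
    · obtain ⟨g, b, hu, ha, ht⟩ := shape_of hn hodd (closure_map e h1)
        (by rw [← map_pow, h2, map_one])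
      have := back_a hn hodd (b := b) hu
      simpa [sqn, ha, ht] using this
    · obtain ⟨g, b, hu, ha, ht⟩ := shape_of hn hodd (closure_map e h1)
        (by rw [← map_pow, h2, map_one])
      have hu2 : IsUnit ((b - i * g) - (b - j * g)) := by
        have e1 : (b - i * g) - (b - j * g) = -(((i - j : ℤ) : ZMod n) * g) := by push_cast; ring
        rw [e1]
        exact ((unit_of_gcd hij).mul hu).neg
      have := back_b hn hodd hu2
      rw [Multiset.map_add, Multiset.map_replicate, Multiset.map_replicate, map_mul, map_mul,
        map_zpow, map_zpow, ha, ht, zpow_mul_sr, zpow_mul_sr]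
      simpa [sqn] using this
end

section
/- Let n ≥ 4 be an even integer and let G be a dihedral group of order 2n (so that D(G) = 3n/2). A sequence S over G of length 3n/2 is a minimal product-one sequence if and only if there exist α, τ ∈ G generating G with α^n = τ^2 = 1_G and τα = α^{-1}τ such that S = α^{[n + n/2 - 2]} · τ · (α^{n/2} τ). -/
namespace DihMin

set_option linter.unusedSectionVars false

/-- Zero-sum free multisets. -/
def ZSF {G : Type*} [AddCommGroup G] (C : Multiset G) : Prop :=
  ∀ P ≤ C, P ≠ 0 → P.sum ≠ 0

/-- The set of all subset sums (including the empty one). -/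
def SS {G : Type*} [AddCommGroup G] [DecidableEq G] (C : Multiset G) : Finset G :=
  (C.powerset.map Multiset.sum).toFinset

section gen
variable {G : Type*} [AddCommGroup G] [DecidableEq G]

theorem mem_SS {C : Multiset G} {x : G} : x ∈ SS C ↔ ∃ P ≤ C, P.sum = x := by
  simp [SS]

theorem ZSF.mono {C D : Multiset G} (h : ZSF D) (hCD : C ≤ D) : ZSF C :=
  fun P hP => h P (hP.trans hCD)

theorem SS_add {C T : Multiset G} (h : ZSF (C + T)) :
    (SS C).card + (SS T).card ≤ (SS (C + T)).card + 1 := by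
  have h0 : (0 : G) ∈ SS T := mem_SS.2 ⟨0, Multiset.zero_le _, by simp⟩
  have h1 : ((SS T).erase 0).card + 1 = (SS T).card := Finset.card_erase_add_one h0
  have hdisj : Disjoint (SS C) (((SS T).erase 0).image (fun t => C.sum + t)) := by
    rw [Finset.disjoint_left]
    intro x hx hx'
    obtain ⟨Q, hQ, rfl⟩ := mem_SS.1 hx
    obtain ⟨t, ht, hxt⟩ := Finset.mem_image.1 hx'
    obtain ⟨ht0, ht⟩ := Finset.mem_erase.1 ht
    obtain ⟨P, hP, rfl⟩ := mem_SS.1 ht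
    obtain ⟨R, rfl⟩ := Multiset.le_iff_exists_add.1 hQ
    have : (R + P).sum = 0 := by
      simp only [Multiset.sum_add] at hxt ⊢
      have : Q.sum + (R.sum + P.sum) = Q.sum + 0 := by rw [← add_assoc, hxt, add_zero]
      exact add_left_cancel this
    refine h (R + P) ?_ ?_ this
    · exact add_le_add (Multiset.le_add_left _ _) hP
    · intro h'
      have hc := congrArg Multiset.card h'
      simp only [Multiset.card_add, Multiset.card_zero] at hc
      have : P = 0 := Multiset.card_eq_zero.1 (by omega)
      subst this
      simp at ht0
  have hsub : SS C ∪ ((SS T).erase 0).image (fun t => C.sum + t) ⊆ SS (C + T) := by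
    intro x hx
    rcases Finset.mem_union.1 hx with hx | hx
    · obtain ⟨Q, hQ, rfl⟩ := mem_SS.1 hx
      exact mem_SS.2 ⟨Q, hQ.trans (Multiset.le_add_right _ _), rfl⟩
    · obtain ⟨t, ht, rfl⟩ := Finset.mem_image.1 hx
      obtain ⟨P, hP, rfl⟩ := mem_SS.1 (Finset.mem_erase.1 ht).2
      exact mem_SS.2 ⟨C + P, add_le_add le_rfl hP, by simp⟩
  have h2 := Finset.card_le_card hsub
  rw [Finset.card_union_of_disjoint hdisj,
    Finset.card_image_of_injective _ (add_right_injective C.sum)] at h2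
  omega

theorem SS_single {a : G} (ha : a ≠ 0) : 2 ≤ (SS ({a} : Multiset G)).card := by
  have : ({0, a} : Finset G) ⊆ SS ({a} : Multiset G) := by
    intro x hx
    simp only [Finset.mem_insert, Finset.mem_singleton] at hx
    rcases hx with rfl | rfl
    · exact mem_SS.2 ⟨0, Multiset.zero_le _, by simp⟩
    · exact mem_SS.2 ⟨{x}, le_rfl, by simp⟩
  have h := Finset.card_le_card this
  rwa [Finset.card_pair ha.symm] at h

theorem SS_pair {a b : G} (h : ZSF ({a, b} : Multiset G)) (hab : a ≠ b) :
    4 ≤ (SS ({a, b} : Multiset G)).card := by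
  have ha : a ≠ 0 := by simpa using h {a} (by simp) (by simp)
  have hb : b ≠ 0 := by
    simpa using h {b} (by rw [Multiset.singleton_le]; simp) (by simp)
  have hs : a + b ≠ 0 := by simpa using h {a, b} le_rfl (by simp)
  have : ({0, a, b, a + b} : Finset G) ⊆ SS ({a, b} : Multiset G) := by
    intro x hx
    simp only [Finset.mem_insert, Finset.mem_singleton] at hx
    rcases hx with rfl | rfl | rfl | rfl
    · exact mem_SS.2 ⟨0, Multiset.zero_le _, by simp⟩
    · exact mem_SS.2 ⟨{x}, by simp, by simp⟩
    · exact mem_SS.2 ⟨{x}, by simp, by simp⟩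
    · exact mem_SS.2 ⟨{a, b}, le_rfl, by simp⟩
  have h4 : ({0, a, b, a + b} : Finset G).card = 4 := by
    rw [Finset.card_insert_of_notMem, Finset.card_insert_of_notMem,
      Finset.card_insert_of_notMem, Finset.card_singleton]
    · simpa using ha
    · simp [hab, hb]
    · simp [ha.symm, hb.symm, hs.symm]
  rw [← h4]
  exact Finset.card_le_card this

theorem SS_base (C : Multiset G) (h : ZSF C) : C.card + 1 ≤ (SS C).card := by
  induction C using Multiset.induction with
  | empty => 
    have : (0 : G) ∈ SS (0 : Multiset G) := mem_SS.2 ⟨0, le_rfl, by simp⟩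
    simpa using Finset.card_pos.2 ⟨_, this⟩
  | cons a C ih =>
    have e : a ::ₘ C = C + {a} := by rw [add_comm]; rfl
    have h1 := ih (h.mono (Multiset.le_cons_self _ _))
    rw [e] at h ⊢
    have h2 := SS_add h
    have h3 : a ≠ 0 := by
      simpa using h {a} (Multiset.le_add_left _ _) (by simp)
    have := SS_single h3
    simp only [Multiset.card_add, Multiset.card_singleton]
    omega

theorem SS_pairs (p : ℕ) : ∀ (C : Multiset G), ZSF C → 2 * p ≤ C.card →
    (∀ x, C.count x + p ≤ C.card) → C.card + p + 1 ≤ (SS C).card := by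
  induction p with
  | zero => intro C h _ _; exact SS_base C h
  | succ p ih =>
    intro C h hc hx
    have hne : C.toFinset.Nonempty := by
      rw [Multiset.toFinset_nonempty]; rintro rfl; simp at hc
    obtain ⟨a, haC, hamax⟩ := Finset.exists_max_image C.toFinset (fun x => C.count x) hne
    have hne2 : (C.toFinset.erase a).Nonempty := by
      by_contra hcon
      rw [Finset.not_nonempty_iff_eq_empty] at hcon
      have : ∀ b ∈ C, b = a := by
        intro b hb
        by_contra hba
        have : b ∈ C.toFinset.erase a := by simp [hb, hba]
        rw [hcon] at this; simp at this
      have h1 := Multiset.eq_replicate_card.2 this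
      have h2 : C.count a = C.card := by
        conv_lhs => rw [h1]
        simp
      have := hx a
      omega
    obtain ⟨b, hbC, hbmax⟩ := Finset.exists_max_image (C.toFinset.erase a) (fun x => C.count x) hne2
    have hba : b ≠ a := (Finset.mem_erase.1 hbC).1
    have hb : b ∈ C := Multiset.mem_toFinset.1 (Finset.mem_erase.1 hbC).2
    have ha : a ∈ C := Multiset.mem_toFinset.1 haC
    obtain ⟨C1, rfl⟩ := Multiset.exists_cons_of_mem ha
    have hb1 : b ∈ C1 := by
      rcases Multiset.mem_cons.1 hb with h | h
      · exact absurd h hba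
      · exact h
    obtain ⟨C2, rfl⟩ := Multiset.exists_cons_of_mem hb1
    have e : a ::ₘ b ::ₘ C2 = C2 + {a, b} := by
      rw [add_comm]; simp [Multiset.insert_eq_cons, Multiset.cons_add]
    have hcnt : ∀ x, C2.count x + p ≤ C2.card := by
      intro x
      by_contra hcon
      push Not at hcon
      have hxa := hx x
      by_cases h1 : x = a
      · subst h1
        simp [hba.symm] at hxa
        omega
      by_cases h2 : x = b
      · subst h2
        simp [hba] at hxa
        omega
      simp only [Multiset.card_cons] at hc hxa
      have hxC2 : x ∈ C2 := by
        by_contra hn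
        rw [Multiset.count_eq_zero_of_notMem hn] at hcon
        omega
      have m1 := hamax x (by simp [hxC2])
      have m2 := hbmax x (by simp [hxC2, h1])
      simp [h1, h2, hba, hba.symm] at m1 m2
      have tot : C2.count a + C2.count b + C2.count x ≤ C2.card := by
        have : Multiset.replicate (C2.count a) a + Multiset.replicate (C2.count b) b
            + Multiset.replicate (C2.count x) x ≤ C2 := by
          rw [Multiset.le_iff_count]
          intro y
          simp only [Multiset.count_add, Multiset.count_replicate]
          by_cases y1 : a = y
          · subst y1; simp [h1, hba]
          by_cases y2 : b = y
          · subst y2; simp [h2, hba.symm]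
          by_cases y3 : x = y
          · subst y3; simp [Ne.symm h1, Ne.symm h2]
          · simp [y1, y2, y3]
        have := Multiset.card_le_card this
        simpa using this
      omega
    have h1 := ih C2 (h.mono (by rw [e]; exact Multiset.le_add_right _ _))
      (by simp at hc; omega) hcnt
    rw [e] at h ⊢
    have h2 := SS_add h
    have h3 := SS_pair (h.mono (Multiset.le_add_left _ _)) hba.symm
    simp only [Multiset.card_add, Multiset.insert_eq_cons, Multiset.card_cons,
      Multiset.card_singleton] at h2 h3 ⊢
    omega

theorem ZSF.card_lt [Fintype G] {C : Multiset G} (h : ZSF C) : C.card < Fintype.card G := by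
  have h1 := SS_base C h
  have h2 := Finset.card_le_univ (SS C)
  omega

theorem exists_map_eq_of_le {α β : Type*} (f : α → β) (P : Multiset β) (D : Multiset α)
    (h : P ≤ D.map f) : ∃ D' ≤ D, D'.map f = P := by
  induction P using Quotient.inductionOn with
  | h p =>
  induction D using Quotient.inductionOn with
  | h d =>
  simp only [Multiset.quot_mk_to_coe, Multiset.map_coe, Multiset.coe_le] at h
  obtain ⟨q, hq, hq'⟩ := h
  obtain ⟨r, hr, rfl⟩ := List.sublist_map_iff.1 hq'
  exact ⟨r, by simpa using hr.subperm, by simpa using hq⟩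

/-- Among `N` elements of `ZMod (2 * N)` some nonempty part has doubled sum zero. -/
theorem exists_half (N : ℕ) [NeZero N] (V : Multiset (ZMod (2 * N))) (hV : N ≤ V.card) :
    ∃ P ≤ V, P ≠ 0 ∧ P.sum + P.sum = 0 := by
  have hd : N ∣ 2 * N := ⟨2, by ring⟩
  set f := ZMod.castHom hd (ZMod N)
  have : ¬ ZSF (V.map f) := by
    intro h
    have := h.card_lt
    rw [ZMod.card, Multiset.card_map] at this
    omega
  unfold ZSF at this
  push Not at this
  obtain ⟨P, hP, hP0, hs⟩ := this
  obtain ⟨Q, hQ, rfl⟩ := exists_map_eq_of_le _ _ _ hP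
  refine ⟨Q, hQ, by rintro rfl; simp at hP0, ?_⟩
  rw [← map_multiset_sum] at hs
  have hN : NeZero (2 * N) := ⟨by have := NeZero.ne N; omega⟩
  generalize Q.sum = x at hs
  have h1 : ((x.val : ℕ) : ZMod N) = 0 := by
    rw [← hs]
    conv_rhs => rw [← ZMod.natCast_zmod_val x]
    rw [map_natCast]
  obtain ⟨c, hc⟩ := (ZMod.natCast_eq_zero_iff _ _).1 h1
  have h2 : ((x.val + x.val : ℕ) : ZMod (2 * N)) = 0 := by
    rw [ZMod.natCast_eq_zero_iff]; exact ⟨c, by rw [hc]; ring⟩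
  simpa using h2

end gen
end DihMin
namespace DihMin

set_option linter.unusedSectionVars false

section rho
variable {N : ℕ} [NeZero N]

instance instNZ : NeZero (2 * N) := ⟨by have := NeZero.ne N; omega⟩

/-- The representative of `c / g` in `[0, 2 * N)`. -/
def rho (g : (ZMod (2 * N))ˣ) (c : ZMod (2 * N)) : ℕ := (c * (g⁻¹ : (ZMod (2 * N))ˣ)).val

/-- Sum of the representatives. -/
def Rs (g : (ZMod (2 * N))ˣ) (P : Multiset (ZMod (2 * N))) : ℕ := (P.map (rho g)).sum

variable (g : (ZMod (2 * N))ˣ)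

theorem rho_mul (c : ZMod (2 * N)) : (rho g c : ZMod (2 * N)) * g = c := by
  simp [rho]

theorem rho_lt (c : ZMod (2 * N)) : rho g c < 2 * N := ZMod.val_lt _

theorem rho_self : rho g (g : ZMod (2 * N)) = 1 := by
  have h : 1 < 2 * N := by have := NeZero.pos N; omega
  have : Fact (1 < 2 * N) := ⟨h⟩
  simp [rho, ZMod.val_one]

theorem rho_eq_one {c : ZMod (2 * N)} (h : rho g c = 1) : c = g := by
  have := rho_mul g c
  rw [h] at this; simpa using this.symm

theorem rho_eq_zero {c : ZMod (2 * N)} (h : rho g c = 0) : c = 0 := by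
  have := rho_mul g c
  rw [h] at this; simpa using this.symm

@[simp] theorem Rs_zero : Rs g 0 = 0 := by simp [Rs]
@[simp] theorem Rs_cons (a : ZMod (2 * N)) (P) : Rs g (a ::ₘ P) = rho g a + Rs g P := by simp [Rs]
@[simp] theorem Rs_add (P Q : Multiset (ZMod (2 * N))) : Rs g (P + Q) = Rs g P + Rs g Q := by
  simp [Rs]
@[simp] theorem Rs_replicate (h : ℕ) : Rs g (Multiset.replicate h (g : ZMod (2 * N))) = h := by
  simp [Rs, rho_self]

theorem sum_eq (P : Multiset (ZMod (2 * N))) : P.sum = (Rs g P : ZMod (2 * N)) * g := by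
  induction P using Multiset.induction with
  | empty => simp
  | cons a P ih =>
    rw [Multiset.sum_cons, ih, Rs_cons]
    push_cast
    rw [add_mul, rho_mul]

theorem le_Rs (P : Multiset (ZMod (2 * N))) (k : ℕ) (h : ∀ a ∈ P, k ≤ rho g a) :
    k * P.card ≤ Rs g P := by
  induction P using Multiset.induction with
  | empty => simp
  | cons a P ih =>
    have h1 := ih (fun b hb => h b (Multiset.mem_cons_of_mem hb))
    have h2 := h a (Multiset.mem_cons_self _ _)
    rw [Rs_cons, Multiset.card_cons, mul_add]
    omega

/-- All sums in the integer interval are attained. -/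
def Complete (C : Multiset (ZMod (2 * N))) : Prop := ∀ j ≤ Rs g C, ∃ P ≤ C, Rs g P = j

/-- All residues modulo `N` are subset sums. -/
def Cov (C : Multiset (ZMod (2 * N))) : Prop := ∀ c, ∃ P ≤ C, P.sum + P.sum = c + c

omit [NeZero N] in
theorem Cov.mono {C D : Multiset (ZMod (2 * N))} (h : Cov C) (hCD : C ≤ D) : Cov D := by
  intro c
  obtain ⟨P, hP, h'⟩ := h c
  exact ⟨P, hP.trans hCD, h'⟩

theorem complete_replicate (h : ℕ) :
    Complete g (Multiset.replicate h (g : ZMod (2 * N))) := by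
  intro j hj
  rw [Rs_replicate] at hj
  exact ⟨Multiset.replicate j (g : ZMod (2 * N)), Multiset.replicate_mono _ hj, by simp⟩

theorem complete_cons {a : ZMod (2 * N)} {C : Multiset (ZMod (2 * N))} (hC : Complete g C)
    (ha : rho g a ≤ Rs g C + 1) : Complete g (a ::ₘ C) := by
  intro j hj
  rw [Rs_cons] at hj
  by_cases h : j ≤ Rs g C
  · obtain ⟨P, hP, h'⟩ := hC j h
    exact ⟨P, hP.trans (Multiset.le_cons_self _ _), h'⟩
  · obtain ⟨P, hP, h'⟩ := hC (j - rho g a) (by omega)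
    exact ⟨a ::ₘ P, (Multiset.cons_le_cons_iff _).2 hP, by rw [Rs_cons]; omega⟩

theorem complete_add (h : ℕ) (M : Multiset (ZMod (2 * N))) (hM : ∀ a ∈ M, rho g a ≤ h + 1) :
    Complete g (Multiset.replicate h (g : ZMod (2 * N)) + M) := by
  induction M using Multiset.induction with
  | empty => simpa using complete_replicate g h
  | cons a M ih =>
    rw [Multiset.add_cons]
    refine complete_cons g (ih fun b hb => hM b (Multiset.mem_cons_of_mem hb)) ?_
    have := hM a (Multiset.mem_cons_self _ _)
    rw [Rs_add, Rs_replicate]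
    omega

theorem complete_of_count (h : ℕ) (C : Multiset (ZMod (2 * N)))
    (hh : h ≤ C.count (g : ZMod (2 * N))) (hM : ∀ a ∈ C, rho g a ≤ h + 1) : Complete g C := by
  have h1 := Multiset.le_count_iff_replicate_le.1 hh
  obtain ⟨M, rfl⟩ := Multiset.le_iff_exists_add.1 h1
  exact complete_add g h M fun a ha => hM a (Multiset.mem_add.2 (Or.inr ha))

theorem two_N : ((N : ZMod (2 * N)) + N) = 0 := by
  have : ((2 * N : ℕ) : ZMod (2 * N)) = 0 := ZMod.natCast_self _
  push_cast at this
  rw [← this]; ring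

theorem cov_of_complete {C : Multiset (ZMod (2 * N))} (hC : Complete g C)
    (h : N ≤ Rs g C + 1) : Cov C := by
  intro c
  have hc := rho_mul g c
  have hlt := rho_lt g c
  by_cases h1 : rho g c < N
  · obtain ⟨P, hP, h'⟩ := hC (rho g c) (by omega)
    refine ⟨P, hP, ?_⟩
    rw [sum_eq g P, h', hc]
  · obtain ⟨P, hP, h'⟩ := hC (rho g c - N) (by omega)
    refine ⟨P, hP, ?_⟩
    rw [sum_eq g P, h']
    conv_rhs => rw [← hc]
    rw [Nat.cast_sub (by omega)]
    have := two_N (N := N)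
    linear_combination (-(g : ZMod (2 * N))) * this

theorem Rs_lt_aux (h : ℕ) (hh : N ≤ h + 1) (M : Multiset (ZMod (2 * N)))
    (hz : ZSF (Multiset.replicate h (g : ZMod (2 * N)) + M)) :
    Rs g (Multiset.replicate h (g : ZMod (2 * N)) + M) < 2 * N ∧
      Complete g (Multiset.replicate h (g : ZMod (2 * N)) + M) := by
  induction M using Multiset.induction with
  | empty =>
    refine ⟨?_, by simpa using complete_replicate g h⟩
    have := hz.card_lt
    simpa using this
  | cons a M ih =>
    rw [Multiset.add_cons] at hz ⊢
    obtain ⟨h1, h2⟩ := ih (hz.mono (Multiset.le_cons_self _ _))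
    have hlt := rho_lt g a
    have key : Rs g (a ::ₘ (Multiset.replicate h (g : ZMod (2 * N)) + M)) < 2 * N := by
      by_contra hcon
      rw [Rs_cons] at hcon
      obtain ⟨P, hP, h'⟩ := h2 (2 * N - rho g a) (by omega)
      refine hz (a ::ₘ P) ((Multiset.cons_le_cons_iff _).2 hP) (by simp) ?_
      rw [sum_eq g, Rs_cons, h', Nat.add_sub_cancel' hlt.le, ZMod.natCast_self, zero_mul]
    refine ⟨key, complete_cons g h2 ?_⟩
    rw [Rs_cons] at key
    rw [Rs_add, Rs_replicate] at key ⊢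
    omega

theorem Rs_lt {C : Multiset (ZMod (2 * N))} (hz : ZSF C)
    (hh : N ≤ C.count (g : ZMod (2 * N)) + 1) : Rs g C < 2 * N := by
  obtain ⟨M, hM⟩ := Multiset.le_iff_exists_add.1 (Multiset.le_count_iff_replicate_le.1
    (le_refl (C.count (g : ZMod (2 * N)))))
  rw [hM] at hz ⊢
  exact (Rs_lt_aux g _ hh M hz).1

theorem isUnit_of_order {g : ZMod (2 * N)} (h : addOrderOf g = 2 * N) : IsUnit g := by
  have h1 : AddSubgroup.zmultiples g = ⊤ := by
    apply AddSubgroup.eq_top_of_card_eq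
    rw [Nat.card_zmultiples, h, Nat.card_zmod]
  have h2 : (1 : ZMod (2 * N)) ∈ AddSubgroup.zmultiples g := by rw [h1]; trivial
  obtain ⟨k, hk⟩ := AddSubgroup.mem_zmultiples_iff.1 h2
  exact IsUnit.of_mul_eq_one (k : ZMod (2 * N)) (by
    have h3 : (k : ZMod (2 * N)) * g = 1 := by rw [← zsmul_eq_mul, hk]
    linear_combination h3)

theorem isUnit_of_count {C : Multiset (ZMod (2 * N))} {g : ZMod (2 * N)} (hz : ZSF C)
    (hN : 3 ≤ N) (hh : N ≤ C.count g + 1) (hc : N + 1 ≤ C.card) : IsUnit g := by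
  obtain ⟨M, hM⟩ := Multiset.le_iff_exists_add.1 (Multiset.le_count_iff_replicate_le.1
    (le_refl (C.count g)))
  set h := C.count g with hdef
  have hmul : ∀ j, 0 < j → j ≤ h → j • g ≠ 0 := by
    intro j hj hjh h0
    refine hz (Multiset.replicate j g) ?_ ?_ (by simpa using h0)
    · exact Multiset.le_count_iff_replicate_le.1 hjh
    · intro h'
      have := congrArg Multiset.card h'
      simp at this; omega
  have ho : h < addOrderOf g := by
    by_contra hcon
    exact hmul _ (addOrderOf_pos g) (by omega) (addOrderOf_nsmul_eq_zero g)
  have hd : addOrderOf g ∣ 2 * N := by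
    have := addOrderOf_dvd_card (x := g)
    rwa [ZMod.card] at this
  obtain ⟨t, ht⟩ := hd
  have ht0 : t ≠ 0 := by rintro rfl; omega
  by_cases ht1 : t = 1
  · subst ht1; exact isUnit_of_order (by omega)
  have ht2 : t = 2 := by
    by_contra hne
    have h3 : 3 ≤ t := by omega
    have : addOrderOf g * 3 ≤ addOrderOf g * t := Nat.mul_le_mul_left _ h3
    omega
  subst ht2
  exfalso
  have ho' : addOrderOf g = N := by omega
  have hidx : (AddSubgroup.zmultiples g).index = 2 := by
    have h1 := (AddSubgroup.zmultiples g).card_mul_index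
    rw [Nat.card_zmultiples, ho', Nat.card_zmod] at h1
    have := NeZero.pos N
    nlinarith
  have hM2 : 2 ≤ M.card := by
    have := congrArg Multiset.card hM
    simp at this; omega
  -- nothing nonempty from `M` has its sum in the subgroup
  have key : ∀ P ≤ M, P ≠ 0 → P.sum ∉ AddSubgroup.zmultiples g := by
    intro P hP hP0 hmem
    have hmem' : -P.sum ∈ AddSubgroup.zmultiples g := neg_mem hmem
    rw [mem_zmultiples_iff_mem_range_addOrderOf] at hmem'
    obtain ⟨j, hj, hj'⟩ := Finset.mem_image.1 hmem'
    rw [Finset.mem_range, ho'] at hj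
    refine hz (Multiset.replicate j g + P) ?_ ?_ ?_
    · rw [hM]; exact add_le_add (Multiset.replicate_mono _ (by omega)) hP
    · intro h'
      have hc := congrArg Multiset.card h'
      simp only [Multiset.card_add, Multiset.card_zero] at hc
      exact hP0 (Multiset.card_eq_zero.1 (by omega))
    · rw [Multiset.sum_add, Multiset.sum_replicate, hj', neg_add_cancel]
  obtain ⟨a, ha⟩ := Multiset.card_pos_iff_exists_mem.1 (show 0 < M.card by omega)
  obtain ⟨M1, rfl⟩ := Multiset.exists_cons_of_mem ha
  rw [Multiset.card_cons] at hM2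
  obtain ⟨b, hb⟩ := Multiset.card_pos_iff_exists_mem.1 (show 0 < M1.card by omega)
  obtain ⟨M2, rfl⟩ := Multiset.exists_cons_of_mem hb
  have k1 := key {a} (by simp) (by simp)
  have k2 := key {b} (by simp) (by simp)
  have k3 := key (a ::ₘ b ::ₘ 0) (by
    rw [Multiset.cons_le_cons_iff, Multiset.cons_le_cons_iff]; exact Multiset.zero_le _) (by simp)
  simp at k1 k2 k3
  exact k3 ((AddSubgroup.add_mem_iff_of_index_two hidx).2 (by tauto))

theorem triple8 : ∀ a b c : ZMod 8, a ≠ b → a ≠ c → b ≠ c → a ≠ 0 → b ≠ 0 → c ≠ 0 → a + b ≠ 0 →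
    a + c ≠ 0 → b + c ≠ 0 → a + b + c ≠ 0 →
    6 ≤ ({0, a, b, c, a + b, a + c, b + c, a + b + c} : Finset (ZMod 8)).card := by
  decide

theorem SS_triple8 (a b c : ZMod 8) (hab : a ≠ b) (hac : a ≠ c) (hbc : b ≠ c)
    (hz : ZSF ({a, b, c} : Multiset (ZMod 8))) :
    6 ≤ (SS ({a, b, c} : Multiset (ZMod 8))).card := by
  have hab' : ({a, b} : Multiset (ZMod 8)) ≤ {a, b, c} := by
    have : ({a, b, c} : Multiset (ZMod 8)) = {a, b} + {c} := rfl
    rw [this]; exact Multiset.le_add_right _ _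
  have hac' : ({a, c} : Multiset (ZMod 8)) ≤ {a, b, c} := by
    have : ({a, b, c} : Multiset (ZMod 8)) = {a, c} + {b} := by
      rw [show ({a, b, c} : Multiset (ZMod 8)) = {a} + ({b} + {c}) from rfl,
        show ({a, c} : Multiset (ZMod 8)) = {a} + {c} from rfl]
      abel
    rw [this]; exact Multiset.le_add_right _ _
  have hbc' : ({b, c} : Multiset (ZMod 8)) ≤ {a, b, c} := Multiset.le_cons_self _ _
  have ha' : ({a} : Multiset (ZMod 8)) ≤ {a, b, c} := by simp
  have hb' : ({b} : Multiset (ZMod 8)) ≤ {a, b, c} := by simp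
  have hc' : ({c} : Multiset (ZMod 8)) ≤ {a, b, c} := by simp
  have k1 := hz _ ha' (by simp)
  have k2 := hz _ hb' (by simp)
  have k3 := hz _ hc' (by simp)
  have k4 := hz _ hab' (by simp)
  have k5 := hz _ hac' (by simp)
  have k6 := hz _ hbc' (by simp)
  have k7 := hz _ le_rfl (by simp)
  have := triple8 a b c hab hac hbc (by simpa using k1) (by simpa using k2) (by simpa using k3)
    (by simpa using k4) (by simpa using k5) (by simpa using k6) (by simpa [add_assoc] using k7)
  refine this.trans (Finset.card_le_card ?_)
  intro x hx
  simp only [Finset.mem_insert, Finset.mem_singleton] at hx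
  rcases hx with rfl | rfl | rfl | rfl | rfl | rfl | rfl | rfl
  · exact mem_SS.2 ⟨0, Multiset.zero_le _, by simp⟩
  · exact mem_SS.2 ⟨_, ha', by simp⟩
  · exact mem_SS.2 ⟨_, hb', by simp⟩
  · exact mem_SS.2 ⟨_, hc', by simp⟩
  · exact mem_SS.2 ⟨_, hab', by simp⟩
  · exact mem_SS.2 ⟨_, hac', by simp⟩
  · exact mem_SS.2 ⟨_, hbc', by simp⟩
  · exact mem_SS.2 ⟨_, le_rfl, by simp [add_assoc]⟩

theorem count4 (C : Multiset (ZMod 8)) (hz : ZSF C) (hc : C.card = 5) :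
    ∃ g, 3 ≤ C.count g := by
  by_contra hcon
  push Not at hcon
  obtain ⟨l, hl, hs⟩ : ∃ l : List ℕ, C = ((l.map (fun x : ℕ => (x : ZMod 8)) : List (ZMod 8)) :
      Multiset (ZMod 8)) ∧ l.Pairwise (· ≤ ·) ∧ ∀ x ∈ l, x < 8 := by
    refine ⟨(C.map ZMod.val).sort (· ≤ ·), ?_, Multiset.pairwise_sort _ _, ?_⟩
    · rw [← Multiset.map_coe, Multiset.sort_eq, Multiset.map_map]
      simp
    · intro x hx
      rw [Multiset.mem_sort, Multiset.mem_map] at hx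
      obtain ⟨y, -, rfl⟩ := hx
      exact ZMod.val_lt y
  subst hl
  obtain ⟨hs, hlt⟩ := hs
  simp only [Multiset.coe_card, List.length_map] at hc
  match l, hc with
  | [a, b, c, d, e], _ =>
  simp only [List.pairwise_cons, List.mem_cons, List.not_mem_nil, or_false, forall_eq_or_imp,
    forall_eq] at hs hlt
  have inj : ∀ {x y : ℕ}, x < 8 → y < 8 → (x : ZMod 8) = y → x = y := by
    intro x y hx hy h
    have := (ZMod.natCast_eq_natCast_iff' _ _ _).1 h
    omega
  have hac : (a : ZMod 8) ≠ c := by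
    intro h
    have h1 := inj (by omega) (by omega) h
    have h2 : b = c := by omega
    have := hcon (a : ZMod 8)
    subst h2; subst h1
    simp [List.count_cons] at this
    omega
  have hbd : (b : ZMod 8) ≠ d := by
    intro h
    have h1 := inj (by omega) (by omega) h
    have h2 : c = d := by omega
    have := hcon (b : ZMod 8)
    subst h2; subst h1
    simp [List.count_cons] at this
    omega
  have hce : (c : ZMod 8) ≠ e := by
    intro h
    have h1 := inj (by omega) (by omega) h
    have h2 : d = e := by omega
    have := hcon (c : ZMod 8)
    subst h2; subst h1
    simp [List.count_cons] at this
    omega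
  have hae : (a : ZMod 8) ≠ e := by
    intro h
    have h1 := inj (by omega) (by omega) h
    exact hac (by rw [show a = c by omega])
  simp only [List.map_cons, List.map_nil] at hz
  generalize (a : ZMod 8) = a at *
  generalize (b : ZMod 8) = b at *
  generalize (c : ZMod 8) = c at *
  generalize (d : ZMod 8) = d at *
  generalize (e : ZMod 8) = e at *
  have e1 : (([a, b, c, d, e] : List (ZMod 8)) : Multiset (ZMod 8)) = {b, d} + {a, c, e} := by
    rw [show (([a, b, c, d, e] : List (ZMod 8)) : Multiset (ZMod 8))
      = {a} + ({b} + ({c} + ({d} + {e}))) from rfl,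
      show ({b, d} : Multiset (ZMod 8)) = {b} + {d} from rfl,
      show ({a, c, e} : Multiset (ZMod 8)) = {a} + ({c} + {e}) from rfl]
    abel
  rw [e1] at hz
  have h1 := SS_add hz
  have h2 := SS_pair (hz.mono (Multiset.le_add_right _ _)) hbd
  have h3 := SS_triple8 a c e hac hae hce (hz.mono (Multiset.le_add_left _ _))
  have h4 := Finset.card_le_univ (SS (({b, d} : Multiset (ZMod 8)) + {a, c, e}))
  rw [ZMod.card] at h4
  omega

theorem high_count {C : Multiset (ZMod (2 * N))} (hz : ZSF C) (hN : 3 ≤ N)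
    (hc : 3 * N ≤ 2 * C.card + 2) : ∃ g, N ≤ C.count g + 1 := by
  have hlt := hz.card_lt
  rw [ZMod.card] at hlt
  by_cases h4 : N = 4 ∧ C.card = 5
  · obtain ⟨rfl, h5⟩ := h4
    obtain ⟨g, hg⟩ := count4 C hz h5
    exact ⟨g, by simpa using hg⟩
  by_contra hcon
  push Not at hcon
  have h1 := SS_pairs (2 * N - C.card) C hz (by omega) (fun x => by have := hcon x; omega)
  have h2 := Finset.card_le_univ (SS C)
  rw [ZMod.card] at h2
  omega

end rho
end DihMin
namespace DihMin

/-- The multiset can be signed so that the sum vanishes. -/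
def Bal {n : ℕ} (F : Multiset (ZMod n)) : Prop := ∃ P Q, F = P + Q ∧ P.sum = Q.sum

/-- Product-one in terms of differences of pairs of reflections `E` and rotations `W`. -/
def PO {n : ℕ} (E W : Multiset (ZMod n)) : Prop :=
  (E = 0 ∧ W.sum = 0) ∨ (E ≠ 0 ∧ Bal (E + W))

/-- No splitting into two product-one parts. -/
def Irr {n : ℕ} (E W : Multiset (ZMod n)) : Prop :=
  ∀ E1 E2 W1 W2 : Multiset (ZMod n), E = E1 + E2 → W = W1 + W2 → E1 + W1 ≠ 0 → E2 + W2 ≠ 0 →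
    PO E1 W1 → PO E2 W2 → False

theorem PO_even {n : ℕ} {E W : Multiset (ZMod n)} (h : PO E W) : ∃ c, E.sum + W.sum = c + c := by
  rcases h with ⟨rfl, h⟩ | ⟨-, P, Q, h, h'⟩
  · exact ⟨0, by simp [h]⟩
  · have := congrArg Multiset.sum h
    rw [Multiset.sum_add, Multiset.sum_add] at this
    exact ⟨P.sum, by rw [this, h']⟩

theorem bal_of_cov {N : ℕ} {F : Multiset (ZMod (2 * N))} (h : Cov F) (he : ∃ c, F.sum = c + c) :
    Bal F := by
  obtain ⟨c, hc⟩ := he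
  obtain ⟨P, hP, h'⟩ := h c
  obtain ⟨Q, rfl⟩ := Multiset.le_iff_exists_add.1 hP
  refine ⟨P, Q, rfl, ?_⟩
  rw [Multiset.sum_add, ← h'] at hc
  exact (add_left_cancel hc).symm

theorem add_ne_zero_left' {α : Type*} {P Q : Multiset α} (h : P ≠ 0) : P + Q ≠ 0 := by
  intro h'
  have hc := congrArg Multiset.card h'
  simp only [Multiset.card_add, Multiset.card_zero] at hc
  exact h (Multiset.card_eq_zero.1 (by omega))

theorem Irr.kill {N : ℕ} {E W E1 E2 W1 W2 : Multiset (ZMod (2 * N))} (hI : Irr E W)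
    (hev : ∃ c, E.sum + W.sum = c + c) (hE : E = E1 + E2) (hW : W = W1 + W2)
    (h1 : E1 + W1 ≠ 0) (hp : PO E1 W1) (h2 : E2 ≠ 0) (hC : Cov (E2 + W2)) : False := by
  refine hI E1 E2 W1 W2 hE hW h1 (add_ne_zero_left' h2) hp (Or.inr ⟨h2, bal_of_cov hC ?_⟩)
  obtain ⟨c, hc⟩ := hev
  obtain ⟨d, hd⟩ := PO_even hp
  refine ⟨c - d, ?_⟩
  subst hE; subst hW
  simp only [Multiset.sum_add] at hc ⊢
  linear_combination hc - hd

theorem le_add_split {α : Type*} [DecidableEq α] {P A B : Multiset α} (h : P ≤ A + B) :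
    ∃ P1 P2, P1 ≤ A ∧ P2 ≤ B ∧ P = P1 + P2 := by
  refine ⟨P ∩ A, P - A, Multiset.inter_le_right, ?_, ?_⟩
  · rw [tsub_le_iff_left]; exact h
  · rw [add_comm, Multiset.sub_add_inter]

theorem zsf_of {n : ℕ} {e : ZMod n} {E U V : Multiset (ZMod n)} (hI : Irr (e ::ₘ E) (U + V))
    (hs : (e ::ₘ E).sum + U.sum = V.sum) : ZSF (E + U) := by
  intro P hP hP0 hsum
  obtain ⟨P1, P2, h1, h2, rfl⟩ := le_add_split hP
  obtain ⟨Q1, rfl⟩ := Multiset.le_iff_exists_add.1 h1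
  obtain ⟨Q2, rfl⟩ := Multiset.le_iff_exists_add.1 h2
  refine hI P1 (e ::ₘ Q1) P2 (Q2 + V) (by rw [Multiset.add_cons]) (by rw [add_assoc]) hP0
    (add_ne_zero_left' (by simp)) ?_ (Or.inr ⟨by simp, e ::ₘ Q1 + Q2, V, by rw [add_assoc], ?_⟩)
  · by_cases h : P1 = 0
    · subst h; exact Or.inl ⟨rfl, by simpa using hsum⟩
    · exact Or.inr ⟨h, P1 + P2, 0, by simp, by simpa using hsum⟩
  · simp only [Multiset.sum_add, Multiset.sum_cons] at hs hsum ⊢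
    linear_combination hs - hsum

section core
variable {N : ℕ} [NeZero N]

theorem ev_of {E U V : Multiset (ZMod (2 * N))} (hs : E.sum + U.sum = V.sum) :
    ∃ c, E.sum + (U + V).sum = c + c := ⟨V.sum, by rw [Multiset.sum_add, ← add_assoc, hs]⟩

theorem ZSF.pos {C : Multiset (ZMod (2 * N))} (hz : ZSF C) (g : (ZMod (2 * N))ˣ)
    {a : ZMod (2 * N)} (ha : a ∈ C) : 1 ≤ rho g a := by
  by_contra h
  have h0 := rho_eq_zero g (c := a) (by omega)
  exact hz {a} (by simpa using ha) (by simp) (by simpa using h0)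

theorem ZSF.two {C : Multiset (ZMod (2 * N))} (hz : ZSF C) (g : (ZMod (2 * N))ˣ)
    {a : ZMod (2 * N)} (ha : a ∈ C) (hne : a ≠ g) : 2 ≤ rho g a := by
  have h1 := hz.pos g ha
  by_contra h
  exact hne (rho_eq_one g (by omega))

/-- Lower bound of the sum of representatives. -/
theorem le_Rs_count {M : Multiset (ZMod (2 * N))} (hz : ZSF M) (g : (ZMod (2 * N))ˣ) :
    2 * M.card ≤ Rs g M + M.count (g : ZMod (2 * N)) := by
  induction M using Multiset.induction with
  | empty => simp
  | cons a M ih =>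
    have h1 := ih (hz.mono (Multiset.le_cons_self _ _))
    have h3 := hz.pos g (Multiset.mem_cons_self a M)
    rw [Rs_cons, Multiset.card_cons, Multiset.count_cons]
    split_ifs with h
    · omega
    · have h2 := hz.two g (Multiset.mem_cons_self a M) (Ne.symm h)
      omega

theorem rho_le_count {C : Multiset (ZMod (2 * N))} (hz : ZSF C) (g : (ZMod (2 * N))ˣ)
    (hN : 3 ≤ N) (hh : N ≤ C.count (g : ZMod (2 * N)) + 1) (hc : N + 1 ≤ C.card)
    {a : ZMod (2 * N)} (ha : a ∈ C) : rho g a + 1 ≤ C.count (g : ZMod (2 * N)) := by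
  have hlt := Rs_lt g hz hh
  by_cases hag : a = g
  · subst hag; rw [rho_self]; omega
  · obtain ⟨M, rfl⟩ := Multiset.exists_cons_of_mem ha
    have h1 := le_Rs_count (hz.mono (Multiset.le_cons_self _ _)) g
    rw [Rs_cons] at hlt
    rw [Multiset.card_cons] at hc
    rw [Multiset.count_cons_of_ne (Ne.symm hag)] at hh ⊢
    omega

theorem core (hN : 3 ≤ N) (E U V : Multiset (ZMod (2 * N))) (hk : 2 ≤ E.card)
    (hcard : 2 * E.card + (U.card + V.card) = 3 * N) (hV : V.card + 1 ≤ N)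
    (hVU : V.card ≤ U.card) (hs : E.sum + U.sum = V.sum) (hI : Irr E (U + V)) : False := by
  have hev := ev_of hs
  obtain ⟨e, he⟩ := Multiset.card_pos_iff_exists_mem.1 (show 0 < E.card by omega)
  obtain ⟨E', hE'⟩ := Multiset.exists_cons_of_mem he
  have hcE : E.card = E'.card + 1 := by rw [hE', Multiset.card_cons]
  have hz : ZSF (E' + U) := zsf_of (by rw [← hE']; exact hI) (by rw [← hE']; exact hs)
  have hcC : (E' + U).card = E'.card + U.card := Multiset.card_add _ _
  obtain ⟨g0, hg0⟩ := high_count hz hN (by omega)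
  obtain ⟨g, rfl⟩ := isUnit_of_count hz hN hg0 (by omega)
  have hlt := Rs_lt g hz hg0
  have hrho : ∀ a ∈ E' + U, rho g a + 1 ≤ (E' + U).count (g : ZMod (2 * N)) :=
    fun a ha => rho_le_count hz g hN hg0 (by omega) ha
  set h := (E' + U).count (g : ZMod (2 * N)) with hh
  -- coverage after deleting at most two copies of `g`
  have cov2 : ∀ M : Multiset (ZMod (2 * N)), E' + U = (g : ZMod (2 * N)) ::ₘ g ::ₘ M → Cov M := by
    intro M hM
    apply cov_of_complete g
    · apply complete_of_count g (h - 2)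
      · rw [hh, hM]; simp
      · intro a ha
        have := hrho a (by rw [hM]; simp [ha])
        omega
    · have hzM : ZSF M := hz.mono (by
        rw [hM]; exact (Multiset.le_cons_self _ _).trans (Multiset.le_cons_self _ _))
      have h1 := le_Rs g M 1 (fun a ha => hzM.pos g ha)
      have h2 := congrArg Multiset.card hM
      simp only [Multiset.card_cons] at h2
      omega
  by_cases hgE : (g : ZMod (2 * N)) ∈ E'
  · obtain ⟨E'', hE''⟩ := Multiset.exists_cons_of_mem hgE
    by_cases hgE2 : (g : ZMod (2 * N)) ∈ E''
    · obtain ⟨F, hF⟩ := Multiset.exists_cons_of_mem hgE2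
      refine hI.kill hev (E1 := {(g : ZMod (2 * N)), (g : ZMod (2 * N))}) (E2 := e ::ₘ F) (W1 := 0)
        (W2 := U + V) ?_ (by simp) (by simp) ?_ (by simp) ?_
      · rw [hE', hE'', hF]
        simp only [Multiset.insert_eq_cons, ← Multiset.singleton_add]; abel
      · refine Or.inr ⟨by simp, {(g : ZMod (2 * N))}, {(g : ZMod (2 * N))}, ?_, rfl⟩
        rw [add_zero]; rfl
      · refine (cov2 (F + U) ?_).mono ?_
        · rw [hE'', hF]; simp
        · rw [Multiset.cons_add, ← add_assoc]
          exact (Multiset.le_add_right _ _).trans (Multiset.le_cons_self _ _)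
    · have hgU : (g : ZMod (2 * N)) ∈ U := by
        by_contra hn
        rw [hE'', Multiset.count_add, Multiset.count_eq_zero_of_notMem hn, Multiset.count_cons_self,
          Multiset.count_eq_zero_of_notMem hgE2] at hh
        omega
      obtain ⟨U', hU'⟩ := Multiset.exists_cons_of_mem hgU
      refine hI.kill hev (E1 := {(g : ZMod (2 * N))}) (E2 := e ::ₘ E'')
        (W1 := {(g : ZMod (2 * N))}) (W2 := U' + V) ?_ ?_ (by simp) ?_ (by simp) ?_
      · rw [hE', hE'']
        simp only [← Multiset.singleton_add]; abel
      · rw [hU']; simp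
      · exact Or.inr ⟨by simp, {(g : ZMod (2 * N))}, {(g : ZMod (2 * N))}, rfl, rfl⟩
      · refine (cov2 (E'' + U') ?_).mono ?_
        · rw [hE'', hU']; simp
        · rw [Multiset.cons_add, ← add_assoc]
          exact (Multiset.le_add_right _ _).trans (Multiset.le_cons_self _ _)
  have hhU : h = U.count (g : ZMod (2 * N)) := by
    rw [hh, Multiset.count_add, Multiset.count_eq_zero_of_notMem hgE, zero_add]
  have hgU : Multiset.replicate 2 (g : ZMod (2 * N)) ≤ U :=
    Multiset.le_count_iff_replicate_le.1 (by omega)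
  obtain ⟨U', hU'⟩ := Multiset.le_iff_exists_add.1 hgU
  have hU'' : U = (g : ZMod (2 * N)) ::ₘ g ::ₘ U' := by rw [hU']; simp [Multiset.replicate_succ]
  have hE'ne : E' ≠ 0 := by
    intro h0; rw [h0] at hcE; simp at hcE; omega
  by_cases heg : e = g
  · refine hI.kill hev (E1 := {e}) (E2 := E')
        (W1 := {(g : ZMod (2 * N))}) (W2 := ((g : ZMod (2 * N)) ::ₘ U') + V) ?_ ?_ (by simp) ?_
        hE'ne ?_
    · rw [hE']; simp
    · rw [hU'']; simp
    · exact Or.inr ⟨by simp, {e}, {(g : ZMod (2 * N))}, rfl, by rw [heg]⟩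
    · refine (cov2 (E' + U') ?_).mono ?_
      · rw [hU'']; simp
      · refine add_le_add le_rfl ?_
        exact (Multiset.le_cons_self _ _).trans (Multiset.le_add_right _ _)
  have hgEE : (g : ZMod (2 * N)) ∉ E := by
    rw [hE', Multiset.mem_cons]; push Not; exact ⟨Ne.symm heg, hgE⟩
  -- every element of `E` has representative two
  have htwo : ∀ x ∈ E, rho g x = 2 := by
    intro x hx
    obtain ⟨F, hF⟩ := Multiset.exists_cons_of_mem hx
    have hcF : F.card + 1 = E.card := by rw [hF, Multiset.card_cons]
    obtain ⟨y, hy⟩ := Multiset.card_pos_iff_exists_mem.1 (show 0 < F.card by omega)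
    obtain ⟨F', hF'⟩ := Multiset.exists_cons_of_mem hy
    have hcF' : F'.card + 1 = F.card := by rw [hF', Multiset.card_cons]
    have hEy : E = y ::ₘ x ::ₘ F' := by rw [hF, hF', Multiset.cons_swap]
    have hzy : ZSF (x ::ₘ F' + U) := zsf_of (by rw [← hEy]; exact hI) (by rw [← hEy]; exact hs)
    have hcnt : N ≤ (x ::ₘ F' + U).count (g : ZMod (2 * N)) + 1 := by
      rw [Multiset.count_add]; omega
    have h1 := Rs_lt g hzy hcnt
    have hxg : x ≠ g := by rintro rfl; exact hgEE hx
    have h2 := hzy.two g (a := x) (by simp) hxg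
    have h3 := le_Rs g F' 2 (fun a ha => hzy.two g (a := a) (by simp [ha]) (by
      rintro rfl; exact hgEE (by rw [hEy]; simp [ha])))
    have h4 := le_Rs g U 1 (fun a ha => hzy.pos g (a := a) (by simp [ha]))
    rw [Rs_add, Rs_cons] at h1
    omega
  have hE'2 := le_Rs g E' 2 (fun a ha => (htwo a (by rw [hE']; simp [ha])).ge)
  have hUc := le_Rs_count (hz.mono (Multiset.le_add_left U E')) g
  rw [← hhU] at hUc
  have hUle : h ≤ U.card := by rw [hhU]; exact Multiset.count_le_card _ _
  rw [Rs_add] at hlt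
  obtain ⟨d, hd⟩ := Multiset.card_pos_iff_exists_mem.1 (show 0 < E'.card by omega)
  obtain ⟨F, hF⟩ := Multiset.exists_cons_of_mem hd
  have hdg : d = (g : ZMod (2 * N)) + g := by
    have h1 := rho_mul g d
    rw [htwo d (by rw [hE', hF]; simp)] at h1
    rw [← h1]; push_cast; ring
  refine hI.kill hev (E1 := {d}) (E2 := e ::ₘ F)
        (W1 := {(g : ZMod (2 * N)), (g : ZMod (2 * N))}) (W2 := U' + V) ?_ ?_ (by simp) ?_
        (by simp) ?_
  · rw [hE', hF]; simp only [← Multiset.singleton_add]; abel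
  · rw [hU'']; simp
  · exact Or.inr ⟨by simp, {d}, {(g : ZMod (2 * N)), (g : ZMod (2 * N))}, rfl, by simp [hdg]⟩
  · have hc1 : Cov (e ::ₘ F + U') := by
      apply cov_of_complete g
      · apply complete_of_count g (h - 2)
        · rw [Multiset.count_add]
          rw [hU''] at hhU
          simp at hhU
          omega
        · intro a ha
          rcases Multiset.mem_add.1 ha with ha | ha
          · rw [htwo a (by
              rw [hE', hF]
              rcases Multiset.mem_cons.1 ha with h | h <;> simp [h])]
            omega
          · have hh2 : ∀ b ∈ U, b = g := by
              have : U.count (g : ZMod (2 * N)) = U.card := by omega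
              intro b hb
              exact (Multiset.count_eq_card.1 this b hb).symm
            rw [hh2 a (by rw [hU'']; simp [ha]), rho_self]
            omega
      · have hr : Rs g U = 2 + Rs g U' := by
          rw [hU'', Rs_cons, Rs_cons, rho_self]; omega
        have hr2 : Rs g E' = 2 + Rs g F := by
          rw [hF, Rs_cons, htwo d (by rw [hE', hF]; simp)]
        rw [Rs_add, Rs_cons, htwo e he]
        omega
    refine hc1.mono ?_
    exact add_le_add le_rfl (Multiset.le_add_right _ _)

end core
end DihMin
namespace DihMin

section small
variable {N : ℕ} [NeZero N]

theorem exists_flip (s : ZMod (2 * N)) (m : ℕ) : ∀ (U V : Multiset (ZMod (2 * N))), V.card = m →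
    s + U.sum = V.sum →
    ∃ U' V', U' + V' = U + V ∧ s + U'.sum = V'.sum ∧ V'.card < N := by
  induction m using Nat.strong_induction_on with
  | _ m ih =>
    intro U V hm hs
    by_cases h : V.card < N
    · exact ⟨U, V, rfl, hs, h⟩
    obtain ⟨P, hP, hP0, hPs⟩ := exists_half N V (by omega)
    obtain ⟨V1, rfl⟩ := Multiset.le_iff_exists_add.1 hP
    have hPc : 0 < P.card := Multiset.card_pos.2 hP0
    rw [Multiset.card_add] at hm
    obtain ⟨U', V', h1, h2, h3⟩ := ih V1.card (by omega) (U + P) V1 rfl (by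
      rw [Multiset.sum_add] at hs ⊢
      linear_combination hs + hPs)
    exact ⟨U', V', by rw [h1, add_assoc], h2, h3⟩

theorem case_zero {W : Multiset (ZMod (2 * N))} (hc : 2 * N < W.card) (hs : W.sum = 0)
    (hI : Irr 0 W) : False := by
  obtain ⟨w, hw⟩ := Multiset.card_pos_iff_exists_mem.1 (show 0 < W.card by omega)
  obtain ⟨W', rfl⟩ := Multiset.exists_cons_of_mem hw
  have hn : ¬ ZSF W' := by
    intro hz
    have := hz.card_lt
    rw [ZMod.card] at this
    rw [Multiset.card_cons] at hc
    omega
  unfold ZSF at hn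
  push Not at hn
  obtain ⟨P, hP, hP0, hPs⟩ := hn
  obtain ⟨Q, rfl⟩ := Multiset.le_iff_exists_add.1 hP
  refine hI 0 0 P (w ::ₘ Q) (by simp) (by rw [Multiset.add_cons]) (by simpa using hP0) (by simp)
    (Or.inl ⟨rfl, hPs⟩) (Or.inl ⟨rfl, ?_⟩)
  rw [← Multiset.add_cons, Multiset.sum_add, hPs, zero_add] at hs
  exact hs

theorem greedy (g : (ZMod (2 * N))ˣ) (V : Multiset (ZMod (2 * N)))
    (hV : ∀ v ∈ V, rho g v < N) (h : N ≤ Rs g V) :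
    ∃ P ≤ V, N ≤ Rs g P ∧ Rs g P < 2 * N := by
  induction V using Multiset.induction with
  | empty => have := NeZero.pos N; simp at h; omega
  | cons a V ih =>
    by_cases h1 : N ≤ Rs g V
    · obtain ⟨P, hP, h'⟩ := ih (fun v hv => hV v (Multiset.mem_cons_of_mem hv)) h1
      exact ⟨P, hP.trans (Multiset.le_cons_self _ _), h'⟩
    · refine ⟨a ::ₘ V, le_rfl, h, ?_⟩
      have := hV a (Multiset.mem_cons_self _ _)
      rw [Rs_cons]; omega

theorem case_one (hN : 2 ≤ N) (e : ZMod (2 * N)) (U V : Multiset (ZMod (2 * N)))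
    (hcard : U.card + V.card + 2 = 3 * N) (hV : V.card < N)
    (hs : e + U.sum = V.sum) (hI : Irr {e} (U + V)) :
    ∃ g : (ZMod (2 * N))ˣ, U + V = Multiset.replicate (2 * N + N - 2) (g : ZMod (2 * N)) ∧
      e + N * g = 0 := by
  have hs' : ({e} : Multiset (ZMod (2 * N))).sum + U.sum = V.sum := by simpa using hs
  have hev := ev_of hs'
  have hz : ZSF U := by
    have := zsf_of (e := e) (E := 0) (U := U) (V := V) hI hs'
    simpa using this
  have hlt := hz.card_lt
  rw [ZMod.card] at hlt
  have hUc : U.card = 2 * N - 1 := by omega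
  have hVc : V.card = N - 1 := by omega
  obtain ⟨g0, hg0⟩ := Multiset.card_pos_iff_exists_mem.1 (show 0 < U.card by omega)
  have hall : ∀ b ∈ U, b = g0 := by
    by_contra hcon
    push Not at hcon
    obtain ⟨b, hb, hbg⟩ := hcon
    have h1 := SS_pairs 1 U hz (by omega) (fun x => by
      have hle := Multiset.count_le_card x U
      by_contra hc
      have hc' : U.count x = U.card := by omega
      have e1 := Multiset.count_eq_card.1 hc' b hb
      have e2 := Multiset.count_eq_card.1 hc' g0 hg0
      exact hbg (by rw [← e1, ← e2]))
    have h2 := Finset.card_le_univ (SS U)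
    rw [ZMod.card] at h2
    omega
  have hUrep : U = Multiset.replicate (2 * N - 1) g0 := by
    rw [← hUc]; exact Multiset.eq_replicate_card.2 hall
  have hunit : IsUnit g0 := by
    apply isUnit_of_order
    have hd : addOrderOf g0 ∣ 2 * N := by
      have := addOrderOf_dvd_card (x := g0)
      rwa [ZMod.card] at this
    refine le_antisymm (Nat.le_of_dvd (by omega) hd) ?_
    by_contra hcon
    refine hz (Multiset.replicate (addOrderOf g0) g0) ?_ ?_ ?_
    · rw [hUrep]; exact Multiset.replicate_mono _ (by omega)
    · intro h
      have h1 := congrArg Multiset.card h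
      have h2 := addOrderOf_pos g0
      rw [Multiset.card_replicate, Multiset.card_zero] at h1
      omega
    · rw [Multiset.sum_replicate, addOrderOf_nsmul_eq_zero]
  obtain ⟨g, rfl⟩ := hunit
  -- no part of `V` has large representative sum
  have key : ∀ P ≤ V, N ≤ Rs g P → Rs g P < 2 * N → False := by
    intro P hP h1 h2
    obtain ⟨Q, hQ⟩ := Multiset.le_iff_exists_add.1 hP
    refine hI.kill hev (E1 := 0) (E2 := {e})
      (W1 := P + Multiset.replicate (2 * N - Rs g P) (g : ZMod (2 * N)))
      (W2 := Multiset.replicate (Rs g P - 1) (g : ZMod (2 * N)) + Q) (by simp) ?_ ?_ ?_ (by simp) ?_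
    · have h3 : U = Multiset.replicate (2 * N - Rs g P) (g : ZMod (2 * N)) +
          Multiset.replicate (Rs g P - 1) (g : ZMod (2 * N)) := by
        rw [← Multiset.replicate_add, hUrep]; congr 1; omega
      rw [h3, hQ]; abel
    · rw [zero_add]
      apply add_ne_zero_left'
      rintro rfl
      simp at h1
      omega
    · refine Or.inl ⟨rfl, ?_⟩
      rw [sum_eq g, Rs_add, Rs_replicate, Nat.add_sub_cancel' h2.le, ZMod.natCast_self, zero_mul]
    · refine (cov_of_complete g (complete_replicate g (Rs g P - 1)) ?_).mono ?_
      · rw [Rs_replicate]; omega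
      · exact (Multiset.le_add_right _ _).trans (Multiset.le_add_left _ _)
  have hpos : ∀ v ∈ V, 1 ≤ rho g v := by
    intro v hv
    by_contra hcon
    have h0 := rho_eq_zero g (c := v) (by omega)
    obtain ⟨Q, hQ⟩ := Multiset.exists_cons_of_mem hv
    refine hI.kill hev (E1 := 0) (E2 := {e}) (W1 := {v}) (W2 := U + Q) (by simp) ?_ (by simp)
      (Or.inl ⟨rfl, by simpa using h0⟩) (by simp) ?_
    · rw [hQ]; simp
    · refine (cov_of_complete g (complete_replicate g (2 * N - 1)) ?_).mono ?_
      · rw [Rs_replicate]; omega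
      · rw [← hUrep]
        exact (Multiset.le_add_right _ _).trans (Multiset.le_add_left _ _)
  have hsmall : ∀ v ∈ V, rho g v < N := by
    intro v hv
    by_contra hcon
    refine key {v} (by simpa using hv) ?_ ?_
    · simp [Rs]; omega
    · simpa [Rs] using rho_lt g v
  have hRs : Rs g V < N := by
    by_contra hcon
    obtain ⟨P, hP, h1, h2⟩ := greedy g V hsmall (by omega)
    exact key P hP h1 h2
  have hVall : ∀ v ∈ V, v = g := by
    intro v hv
    obtain ⟨Q, hQ⟩ := Multiset.exists_cons_of_mem hv
    have h1 := le_Rs g Q 1 (fun a ha => hpos a (by rw [hQ]; simp [ha]))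
    have h2 := hpos v hv
    rw [hQ, Multiset.card_cons] at hVc
    rw [hQ, Rs_cons] at hRs
    exact rho_eq_one g (by omega)
  have hVrep : V = Multiset.replicate (N - 1) (g : ZMod (2 * N)) := by
    rw [← hVc]; exact Multiset.eq_replicate_card.2 hVall
  refine ⟨g, ?_, ?_⟩
  · rw [hUrep, hVrep, ← Multiset.replicate_add]; congr 1; omega
  · rw [hUrep, hVrep, Multiset.sum_replicate, Multiset.sum_replicate,
      show 2 * N - 1 = (N - 1) + N by omega, add_nsmul] at hs
    rw [nsmul_eq_mul N] at hs
    linear_combination hs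

end small
end DihMin
namespace DihMin

section dihedral
open DihedralGroup
variable {n : ℕ}

/-- The sequence with reflections indexed by `A` and rotations indexed by `B`. -/
def seq (A B : Multiset (ZMod n)) : Multiset (DihedralGroup n) := A.map sr + B.map r

theorem seq_add (A A' B B' : Multiset (ZMod n)) :
    seq (A + A') (B + B') = seq A B + seq A' B' := by
  simp only [seq, Multiset.map_add]; abel

theorem card_seq (A B : Multiset (ZMod n)) : (seq A B).card = A.card + B.card := by
  simp [seq]

theorem seq_ne_zero {A B : Multiset (ZMod n)} (h : A + B ≠ 0) : seq A B ≠ 0 := by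
  intro h1
  apply h
  rw [← Multiset.card_eq_zero] at h1 ⊢
  rw [card_seq] at h1
  rw [Multiset.card_add, h1]

theorem exists_seq (S : Multiset (DihedralGroup n)) : ∃ A B, S = seq A B := by
  induction S using Multiset.induction with
  | empty => exact ⟨0, 0, by simp [seq]⟩
  | cons a S ih =>
    obtain ⟨A, B, rfl⟩ := ih
    cases a with
    | r i => exact ⟨A, i ::ₘ B, by simp [seq]⟩
    | sr i => exact ⟨i ::ₘ A, B, by simp [seq]⟩

/-- Index of a reflection. -/
def getS : DihedralGroup n → Option (ZMod n)
  | r _ => none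
  | sr i => some i

/-- Index of a rotation. -/
def getR : DihedralGroup n → Option (ZMod n)
  | r i => some i
  | sr _ => none

theorem filterMap_seq_S (A B : Multiset (ZMod n)) : (seq A B).filterMap getS = A := by
  induction A using Multiset.induction with
  | empty =>
    induction B using Multiset.induction with
    | empty => simp [seq]
    | cons b B ih =>
      have : seq 0 (b ::ₘ B) = r b ::ₘ seq 0 B := by simp [seq]
      rw [this, Multiset.filterMap_cons_none _ _ rfl, ih]
  | cons a A ih =>
    have : seq (a ::ₘ A) B = sr a ::ₘ seq A B := by simp [seq]
    rw [this, Multiset.filterMap_cons_some getS _ _ (b := a) rfl, ih]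

theorem filterMap_seq_R (A B : Multiset (ZMod n)) : (seq A B).filterMap getR = B := by
  induction A using Multiset.induction with
  | empty =>
    induction B using Multiset.induction with
    | empty => simp [seq]
    | cons b B ih =>
      have : seq 0 (b ::ₘ B) = r b ::ₘ seq 0 B := by simp [seq]
      rw [this, Multiset.filterMap_cons_some getR _ _ (b := b) rfl, ih]
  | cons a A ih =>
    have : seq (a ::ₘ A) B = sr a ::ₘ seq A B := by simp [seq]
    rw [this, Multiset.filterMap_cons_none _ _ rfl, ih]

theorem seq_inj {A B A' B' : Multiset (ZMod n)} (h : seq A B = seq A' B') : A = A' ∧ B = B' := by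
  constructor
  · rw [← filterMap_seq_S A B, h, filterMap_seq_S]
  · rw [← filterMap_seq_R A B, h, filterMap_seq_R]

/-- The balancing condition for reflections `A` and rotations `B`. -/
def Good (A B : Multiset (ZMod n)) : Prop :=
  ∃ X Y U V : Multiset (ZMod n), A = X + Y ∧ X.card = Y.card ∧ B = U + V ∧
    Y.sum + U.sum = X.sum + V.sum

theorem state (l : List (DihedralGroup n)) : ∃ X Y U V : Multiset (ZMod n),
    (l : Multiset (DihedralGroup n)) = seq (X + Y) (U + V) ∧ (X + Y = 0 → V = 0) ∧
    ((X.card = Y.card ∧ l.prod = r (U.sum - V.sum + Y.sum - X.sum)) ∨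
      (X.card = Y.card + 1 ∧ l.prod = sr (X.sum - Y.sum + V.sum - U.sum))) := by
  induction l with
  | nil => exact ⟨0, 0, 0, 0, by simp [seq], by simp, by left; simp⟩
  | cons a l ih =>
    obtain ⟨X, Y, U, V, hl, h0, h⟩ := ih
    cases a with
    | r i =>
      refine ⟨X, Y, i ::ₘ U, V, ?_, h0, ?_⟩
      · rw [← Multiset.cons_coe, hl]; simp [seq]
      · rcases h with ⟨h1, h2⟩ | ⟨h1, h2⟩
        · left
          refine ⟨h1, ?_⟩
          rw [List.prod_cons, h2, r_mul_r, Multiset.sum_cons]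
          congr 1; ring
        · right
          refine ⟨h1, ?_⟩
          rw [List.prod_cons, h2, r_mul_sr, Multiset.sum_cons]
          congr 1; ring
    | sr i =>
      refine ⟨i ::ₘ Y, X, V, U, ?_, ?_, ?_⟩
      · rw [← Multiset.cons_coe, hl, add_comm V U, Multiset.cons_add, add_comm Y X]; simp [seq]
      · intro h; rw [Multiset.cons_add] at h; exact absurd h (Multiset.cons_ne_zero)
      · rcases h with ⟨h1, h2⟩ | ⟨h1, h2⟩
        · right
          refine ⟨by rw [Multiset.card_cons, h1], ?_⟩
          rw [List.prod_cons, h2, sr_mul_r, Multiset.sum_cons]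
          congr 1; ring
        · left
          refine ⟨by rw [Multiset.card_cons, h1], ?_⟩
          rw [List.prod_cons, h2, sr_mul_sr, Multiset.sum_cons]
          congr 1; ring

theorem good_of_productOne {A B : Multiset (ZMod n)} (h : IsProductOne (seq A B)) :
    Good A B ∧ (A = 0 → B.sum = 0) := by
  obtain ⟨l, hl, hp⟩ := h
  obtain ⟨X, Y, U, V, h1, h0, h2⟩ := state l
  rw [hl] at h1
  obtain ⟨rfl, rfl⟩ := seq_inj h1
  rcases h2 with ⟨h3, h4⟩ | ⟨h3, h4⟩
  · rw [hp, one_def] at h4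
    injection h4 with h4
    refine ⟨⟨X, Y, U, V, rfl, h3, rfl, by linear_combination -h4⟩, ?_⟩
    intro h
    have hV := h0 h
    have hX : X = 0 := (add_eq_zero.1 h).1
    have hY : Y = 0 := (add_eq_zero.1 h).2
    subst hV hX hY
    simpa using h4.symm
  · rw [hp, one_def] at h4
    cases h4

theorem rot_list (U : Multiset (ZMod n)) : ∃ l : List (DihedralGroup n),
    (l : Multiset (DihedralGroup n)) = U.map r ∧ l.prod = r U.sum := by
  induction U using Multiset.induction with
  | empty => exact ⟨[], by simp, by simp⟩
  | cons a U ih =>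
    obtain ⟨l, h1, h2⟩ := ih
    exact ⟨r a :: l, by rw [← Multiset.cons_coe, h1, Multiset.map_cons],
      by rw [List.prod_cons, h2, r_mul_r, Multiset.sum_cons]⟩

theorem refl_list (X : Multiset (ZMod n)) : ∀ Y : Multiset (ZMod n), X.card = Y.card →
    ∃ l : List (DihedralGroup n),
    (l : Multiset (DihedralGroup n)) = (X + Y).map sr ∧ l.prod = r (Y.sum - X.sum) := by
  induction X using Multiset.induction with
  | empty =>
    intro Y hY
    rw [Multiset.card_zero] at hY
    have := Multiset.card_eq_zero.1 hY.symm
    subst this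
    exact ⟨[], by simp, by simp⟩
  | cons a X ih =>
    intro Y hY
    obtain ⟨b, hb⟩ := Multiset.card_pos_iff_exists_mem.1 (show 0 < Y.card by
      rw [← hY, Multiset.card_cons]; omega)
    obtain ⟨Y, rfl⟩ := Multiset.exists_cons_of_mem hb
    obtain ⟨l, h1, h2⟩ := ih Y (by simpa using hY)
    refine ⟨sr a :: sr b :: l, ?_, ?_⟩
    · rw [← Multiset.cons_coe, ← Multiset.cons_coe, h1, Multiset.cons_add, Multiset.add_cons,
        Multiset.map_cons, Multiset.map_cons]
    · rw [List.prod_cons, List.prod_cons, h2, ← mul_assoc, sr_mul_sr, r_mul_r, Multiset.sum_cons,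
        Multiset.sum_cons]
      congr 1; ring

theorem productOne_of_good {A B : Multiset (ZMod n)} (hA : A ≠ 0) (h : Good A B) :
    IsProductOne (seq A B) := by
  obtain ⟨X, Y, U, V, rfl, hc, rfl, hs⟩ := h
  have hX : 0 < X.card := by
    rcases Nat.eq_zero_or_pos X.card with h | h
    · rw [h] at hc
      exact absurd (by rw [Multiset.card_eq_zero.1 h, Multiset.card_eq_zero.1 hc.symm, add_zero]) hA
    · exact h
  obtain ⟨x, hx⟩ := Multiset.card_pos_iff_exists_mem.1 hX
  obtain ⟨y, hy⟩ := Multiset.card_pos_iff_exists_mem.1 (hc ▸ hX)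
  obtain ⟨X, rfl⟩ := Multiset.exists_cons_of_mem hx
  obtain ⟨Y, rfl⟩ := Multiset.exists_cons_of_mem hy
  obtain ⟨l, h1, h2⟩ := refl_list X Y (by simpa using hc)
  obtain ⟨lU, u1, u2⟩ := rot_list U
  obtain ⟨lV, v1, v2⟩ := rot_list V
  refine ⟨lU ++ (sr x :: (lV ++ (sr y :: l))), ?_, ?_⟩
  · rw [← Multiset.coe_add, ← Multiset.cons_coe, ← Multiset.coe_add, ← Multiset.cons_coe, h1, u1, v1]
    simp only [seq, Multiset.map_add, ← Multiset.singleton_add, Multiset.map_singleton]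
    abel
  · rw [List.prod_append, List.prod_cons, List.prod_append, List.prod_cons, h2, u2, v2,
      sr_mul_r, r_mul_sr, sr_mul_sr, r_mul_r, one_def]
    rw [Multiset.sum_cons, Multiset.sum_cons] at hs
    congr 1
    linear_combination hs

theorem productOne_rot {B : Multiset (ZMod n)} (h : B.sum = 0) : IsProductOne (seq 0 B) := by
  obtain ⟨l, h1, h2⟩ := rot_list B
  exact ⟨l, by simp [seq, h1], by rw [h2, h, one_def]⟩

/-- The difference of a pair. -/
def dl (p : ZMod n × ZMod n) : ZMod n := p.1 - p.2

/-- All entries of a multiset of pairs. -/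
def Afull (D : Multiset (ZMod n × ZMod n)) : Multiset (ZMod n) :=
  D.map Prod.fst + D.map Prod.snd

theorem Afull_add (D D' : Multiset (ZMod n × ZMod n)) : Afull (D + D') = Afull D + Afull D' := by
  simp only [Afull, Multiset.map_add]; abel

theorem card_Afull (D : Multiset (ZMod n × ZMod n)) : (Afull D).card = 2 * D.card := by
  simp [Afull]; omega

theorem sum_dl (D : Multiset (ZMod n × ZMod n)) :
    (D.map dl).sum = (D.map Prod.fst).sum - (D.map Prod.snd).sum := by
  rw [← Multiset.sum_map_sub]; rfl

theorem good_of_bal {D : Multiset (ZMod n × ZMod n)} {W : Multiset (ZMod n)}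
    (h : Bal (D.map dl + W)) : Good (Afull D) W := by
  obtain ⟨P, Q, hPQ, hs⟩ := h
  obtain ⟨P1, P2, h1, h2, rfl⟩ := le_add_split (show P ≤ D.map dl + W by
    rw [hPQ]; exact Multiset.le_add_right _ _)
  obtain ⟨Q2, rfl⟩ := Multiset.le_iff_exists_add.1 h2
  obtain ⟨D1, hD1, rfl⟩ := exists_map_eq_of_le dl P1 D h1
  obtain ⟨D2, rfl⟩ := Multiset.le_iff_exists_add.1 hD1
  have hQ : Q = D2.map dl + Q2 := by
    rw [Multiset.map_add] at hPQ
    have : (D1.map dl + P2) + Q = (D1.map dl + P2) + (D2.map dl + Q2) := by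
      rw [← hPQ]; abel
    exact add_left_cancel this
  subst hQ
  refine ⟨D1.map Prod.snd + D2.map Prod.fst, D1.map Prod.fst + D2.map Prod.snd, P2, Q2, ?_, ?_,
    rfl, ?_⟩
  · simp only [Afull, Multiset.map_add]; abel
  · simp
  · simp only [Multiset.sum_add, sum_dl] at hs ⊢
    linear_combination hs

theorem productOne_of_PO {D : Multiset (ZMod n × ZMod n)} {W : Multiset (ZMod n)}
    (h : PO (D.map dl) W) : IsProductOne (seq (Afull D) W) := by
  rcases h with ⟨h1, h2⟩ | ⟨h1, h2⟩
  · have : D = 0 := by simpa using h1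
    subst this
    exact productOne_rot h2
  · refine productOne_of_good ?_ (good_of_bal h2)
    intro h
    apply h1
    rw [← Multiset.card_eq_zero, card_Afull] at h
    rw [← Multiset.card_eq_zero, Multiset.card_map]
    omega

theorem irr_of {D : Multiset (ZMod n × ZMod n)} {W : Multiset (ZMod n)}
    (h : IsMinimalProductOne (seq (Afull D) W)) : Irr (D.map dl) W := by
  intro E1 E2 W1 W2 hE hW h1 h2 hp1 hp2
  obtain ⟨D1, hD1, rfl⟩ := exists_map_eq_of_le dl E1 D (by
    rw [hE]; exact Multiset.le_add_right _ _)
  obtain ⟨D2, rfl⟩ := Multiset.le_iff_exists_add.1 hD1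
  rw [Multiset.map_add] at hE
  obtain rfl := (add_left_cancel hE).symm
  subst hW
  have key : ∀ (D' : Multiset (ZMod n × ZMod n)) (W' : Multiset (ZMod n)),
      D'.map dl + W' ≠ 0 → seq (Afull D') W' ≠ 0 := by
    intro D' W' h
    apply seq_ne_zero
    intro h'
    apply h
    rw [← Multiset.card_eq_zero, Multiset.card_add] at h' ⊢
    rw [card_Afull] at h'
    rw [Multiset.card_map]
    omega
  refine h.2.2 _ _ (key _ _ h1) (key _ _ h2) (productOne_of_PO hp1) (productOne_of_PO hp2) ?_
  rw [Afull_add, seq_add]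

theorem exists_pairs (X : Multiset (ZMod n)) : ∀ Y : Multiset (ZMod n), X.card = Y.card →
    ∃ D : Multiset (ZMod n × ZMod n), D.map Prod.fst = Y ∧ D.map Prod.snd = X := by
  induction X using Multiset.induction with
  | empty =>
    intro Y hY
    rw [Multiset.card_zero] at hY
    have := Multiset.card_eq_zero.1 hY.symm
    subst this
    exact ⟨0, by simp, by simp⟩
  | cons a X ih =>
    intro Y hY
    obtain ⟨b, hb⟩ := Multiset.card_pos_iff_exists_mem.1 (show 0 < Y.card by
      rw [← hY, Multiset.card_cons]; omega)
    obtain ⟨Y, rfl⟩ := Multiset.exists_cons_of_mem hb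
    obtain ⟨D, rfl, rfl⟩ := ih Y (by simpa using hY)
    exact ⟨(b, a) ::ₘ D, by simp, by simp⟩

end dihedral
end DihMin
namespace DihMin

section four
open DihedralGroup

theorem no_split {n : ℕ} {A A1 A2 B B1 B2 : Multiset (ZMod n)}
    (h : IsMinimalProductOne (seq A B)) (hA : A = A1 + A2) (hB : B = B1 + B2)
    (h1 : A1 + B1 ≠ 0) (h2 : A2 + B2 ≠ 0) (p1 : IsProductOne (seq A1 B1))
    (p2 : IsProductOne (seq A2 B2)) : False := by
  refine h.2.2 _ _ (seq_ne_zero h1) (seq_ne_zero h2) p1 p2 ?_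
  rw [hA, hB, seq_add]

theorem sing_ne {α : Type*} (a : α) (A : Multiset α) : {a} + A ≠ 0 := by
  rw [Multiset.singleton_add]; exact Multiset.cons_ne_zero

set_option synthInstance.maxHeartbeats 400000 in
set_option synthInstance.maxSize 10000 in
theorem k3_dec : ∀ a0 a1 a2 a3 a4 a5 : ZMod 4, a0 + a1 + a2 = a3 + a4 + a5 →
    (a0 = a3 ∧ a1 + a2 = a4 + a5) ∨ (a0 = a4 ∧ a1 + a2 = a3 + a5) ∨
    (a0 = a5 ∧ a1 + a2 = a3 + a4) ∨ (a1 = a3 ∧ a0 + a2 = a4 + a5) ∨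
    (a2 = a4 ∧ a0 + a1 = a3 + a5) ∨ (a1 = a5 ∧ a0 + a2 = a3 + a4) ∨
    (a2 = a3 ∧ a0 + a1 = a4 + a5) ∨ (a1 = a4 ∧ a0 + a2 = a3 + a5) ∨
    (a2 = a5 ∧ a0 + a1 = a3 + a4) ∨ (a0 = a1 ∧ a2 + a3 = a4 + a5) ∨
    (a0 = a1 ∧ a2 + a4 = a3 + a5) ∨ (a0 = a1 ∧ a2 + a5 = a3 + a4) ∨
    (a3 = a4 ∧ a0 + a1 = a2 + a5) ∨ (a3 = a4 ∧ a0 + a2 = a1 + a5) ∨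
    (a3 = a4 ∧ a0 + a5 = a1 + a2) := by
  decide +kernel

set_option synthInstance.maxHeartbeats 400000 in
set_option synthInstance.maxSize 10000 in
theorem k2_dec : ∀ a0 a1 a2 a3 u v : ZMod 4,
    (a2 + a3 + u + v = a0 + a1 ∨ a2 + a3 + u = a0 + a1 + v ∨ a2 + a3 = a0 + a1 + u + v) →
    ((u = 0 ∧ (a0 + a1 + v = a2 + a3 ∨ a0 + a1 = a2 + a3 + v)) ∨
     (v = 0 ∧ (a0 + a1 + u = a2 + a3 ∨ a0 + a1 = a2 + a3 + u))) ∨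
    (u + v = 0 ∧ a0 + a1 = a2 + a3) ∨ (u + v = 0 ∧ a0 + a3 = a1 + a2) ∨
    (((a0 - a2 = u ∨ a0 - a2 = -u) ∧ (a1 - a3 = v ∨ a1 - a3 = -v)) ∨
     ((a1 - a3 = u ∨ a1 - a3 = -u) ∧ (a0 - a2 = v ∨ a0 - a2 = -v)) ∨
     ((a0 - a3 = u ∨ a0 - a3 = -u) ∧ (a1 - a2 = v ∨ a1 - a2 = -v)) ∨
     ((a1 - a2 = u ∨ a1 - a2 = -u) ∧ (a0 - a3 = v ∨ a0 - a3 = -v))) ∨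
    ((a2 = a3 ∧ (a0 - a1 = u + v ∨ a0 - a1 = u - v ∨ a0 - a1 = v - u ∨ a0 - a1 = -u - v)) ∨
     (a0 = a1 ∧ (a2 - a3 = u + v ∨ a2 - a3 = u - v ∨ a2 - a3 = v - u ∨ a2 - a3 = -u - v)) ∨
     (a0 = a2 ∧ (a1 - a3 = u + v ∨ a1 - a3 = u - v ∨ a1 - a3 = v - u ∨ a1 - a3 = -u - v)) ∨
     (a0 = a3 ∧ (a1 - a2 = u + v ∨ a1 - a2 = u - v ∨ a1 - a2 = v - u ∨ a1 - a2 = -u - v))) := by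
  decide +kernel

variable {n : ℕ}

theorem po_pair0 {a b : ZMod n} (h : a = b) : IsProductOne (seq ({a} + {b}) 0) :=
  productOne_of_good (sing_ne _ _) ⟨{a}, {b}, 0, 0, rfl, by simp, by simp, by simp [h]⟩

theorem po_pair1 {a b u : ZMod n} (h : a - b = u ∨ a - b = -u) :
    IsProductOne (seq ({a} + {b}) {u}) := by
  refine productOne_of_good (sing_ne _ _) ?_
  rcases h with h | h
  · refine ⟨{a}, {b}, {u}, 0, rfl, by simp, by simp, ?_⟩
    simp only [Multiset.sum_singleton, Multiset.sum_zero]; linear_combination -h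
  · refine ⟨{a}, {b}, 0, {u}, rfl, by simp, by simp, ?_⟩
    simp only [Multiset.sum_singleton, Multiset.sum_zero]; linear_combination -h

theorem po_pair2 {a b u v : ZMod n}
    (h : a - b = u + v ∨ a - b = u - v ∨ a - b = v - u ∨ a - b = -u - v) :
    IsProductOne (seq ({a} + {b}) ({u} + {v})) := by
  refine productOne_of_good (sing_ne _ _) ?_
  rcases h with h | h | h | h
  · refine ⟨{a}, {b}, {u} + {v}, 0, rfl, by simp, by simp, ?_⟩
    simp only [Multiset.sum_singleton, Multiset.sum_zero, Multiset.sum_add]; linear_combination -h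
  · refine ⟨{a}, {b}, {u}, {v}, rfl, by simp, by simp, ?_⟩
    simp only [Multiset.sum_singleton]; linear_combination -h
  · refine ⟨{a}, {b}, {v}, {u}, rfl, by simp, by rw [add_comm], ?_⟩
    simp only [Multiset.sum_singleton]; linear_combination -h
  · refine ⟨{a}, {b}, 0, {u} + {v}, rfl, by simp, by simp, ?_⟩
    simp only [Multiset.sum_singleton, Multiset.sum_zero, Multiset.sum_add]; linear_combination -h

theorem po_quad {c d e f : ZMod n} (h : c + d = e + f) :
    IsProductOne (seq ({c} + ({d} + ({e} + {f}))) 0) := by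
  refine productOne_of_good (sing_ne _ _) ⟨{c} + {d}, {e} + {f}, 0, 0, by abel, by simp, by simp, ?_⟩
  simp only [Multiset.sum_singleton, Multiset.sum_add, h]

theorem po_quad1 {c d e f v : ZMod n} (h : c + d + v = e + f ∨ c + d = e + f + v) :
    IsProductOne (seq ({c} + ({d} + ({e} + {f}))) {v}) := by
  refine productOne_of_good (sing_ne _ _) ?_
  rcases h with h | h
  · refine ⟨{c} + {d}, {e} + {f}, 0, {v}, by abel, by simp, by simp, ?_⟩
    simp only [Multiset.sum_singleton, Multiset.sum_add, Multiset.sum_zero]; linear_combination -h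
  · refine ⟨{c} + {d}, {e} + {f}, {v}, 0, by abel, by simp, by simp, ?_⟩
    simp only [Multiset.sum_singleton, Multiset.sum_add, Multiset.sum_zero]; linear_combination -h

theorem hand3 {A : Multiset (ZMod n)} (hm : IsMinimalProductOne (seq A 0)) {a b c d e f : ZMod n}
    (h : a = b ∧ c + d = e + f) (hA : A = ({a} + {b}) + ({c} + ({d} + ({e} + {f})))) : False :=
  no_split hm hA (by simp : (0 : Multiset (ZMod n)) = 0 + 0) (by simp) (by simp)
    (po_pair0 h.1) (po_quad h.2)

theorem k3 {a0 a1 a2 a3 a4 a5 : ZMod 4}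
    (hm : IsMinimalProductOne (seq (({a0} + ({a1} + {a2})) + ({a3} + ({a4} + {a5}))) 0))
    (h : a0 + a1 + a2 = a3 + a4 + a5) : False := by
  rcases k3_dec _ _ _ _ _ _ h with h | h | h | h | h | h | h | h | h | h | h | h | h | h | h
  all_goals exact hand3 hm h (by abel)

theorem k2 {a0 a1 a2 a3 u v : ZMod 4}
    (hm : IsMinimalProductOne (seq (({a0} + {a1}) + ({a2} + {a3})) ({u} + {v})))
    (h : a2 + a3 + u + v = a0 + a1 ∨ a2 + a3 + u = a0 + a1 + v ∨ a2 + a3 = a0 + a1 + u + v) :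
    False := by
  rcases k2_dec _ _ _ _ _ _ h with (⟨h, h'⟩ | ⟨h, h'⟩) | ⟨h, h'⟩ | ⟨h, h'⟩ | h | h
  · exact no_split hm (A1 := 0) (by abel) rfl (by simp) (by simp)
      (productOne_rot (by simpa using h)) (po_quad1 h')
  · exact no_split hm (A1 := 0) (by abel) (add_comm _ _) (by simp) (by simp)
      (productOne_rot (by simpa using h)) (po_quad1 h')
  · exact no_split hm (A1 := 0) (by abel) (add_zero _).symm (by simp) (by simp)
      (productOne_rot (by simpa using h)) (po_quad h')
  · exact no_split hm (A1 := 0) (by abel) (add_zero _).symm (by simp) (by simp)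
      (productOne_rot (by simpa using h)) (po_quad h')
  · rcases h with ⟨h, h'⟩ | ⟨h, h'⟩ | ⟨h, h'⟩ | ⟨h, h'⟩
    all_goals exact no_split hm (by abel) rfl (by simp) (by simp) (po_pair1 h) (po_pair1 h')
  · rcases h with ⟨h, h'⟩ | ⟨h, h'⟩ | ⟨h, h'⟩ | ⟨h, h'⟩
    all_goals
      exact no_split hm (by abel) (zero_add _).symm (by simp) (by simp) (po_pair0 h) (po_pair2 h')

theorem four {X Y U V : Multiset (ZMod 4)} (hc : X.card = Y.card) (hk : 2 ≤ X.card)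
    (hcard : 2 * X.card + (U.card + V.card) = 6) (hs : Y.sum + U.sum = X.sum + V.sum)
    (hm : IsMinimalProductOne (seq (X + Y) (U + V))) : False := by
  have : X.card = 2 ∨ X.card = 3 := by omega
  rcases this with h | h
  · obtain ⟨a0, a1, rfl⟩ := Multiset.card_eq_two.1 h
    rw [h] at hc
    obtain ⟨a2, a3, rfl⟩ := Multiset.card_eq_two.1 hc.symm
    rw [h] at hcard
    have : (U.card = 2 ∧ V.card = 0) ∨ (U.card = 1 ∧ V.card = 1) ∨ (U.card = 0 ∧ V.card = 2) := by
      omega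
    rcases this with ⟨h1, h2⟩ | ⟨h1, h2⟩ | ⟨h1, h2⟩
    · obtain ⟨u, v, rfl⟩ := Multiset.card_eq_two.1 h1
      obtain rfl := Multiset.card_eq_zero.1 h2
      refine k2 (a0 := a0) (a1 := a1) (a2 := a2) (a3 := a3) (u := u) (v := v) (by simpa using hm)
        (Or.inl ?_)
      simp at hs
      linear_combination hs
    · obtain ⟨u, rfl⟩ := Multiset.card_eq_one.1 h1
      obtain ⟨v, rfl⟩ := Multiset.card_eq_one.1 h2
      refine k2 (a0 := a0) (a1 := a1) (a2 := a2) (a3 := a3) (u := u) (v := v) (by simpa using hm)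
        (Or.inr (Or.inl ?_))
      simp at hs
      linear_combination hs
    · obtain rfl := Multiset.card_eq_zero.1 h1
      obtain ⟨u, v, rfl⟩ := Multiset.card_eq_two.1 h2
      refine k2 (a0 := a0) (a1 := a1) (a2 := a2) (a3 := a3) (u := u) (v := v) (by simpa using hm)
        (Or.inr (Or.inr ?_))
      simp at hs
      linear_combination hs
  · obtain ⟨a0, a1, a2, rfl⟩ := Multiset.card_eq_three.1 h
    rw [h] at hc
    obtain ⟨a3, a4, a5, rfl⟩ := Multiset.card_eq_three.1 hc.symm
    rw [h] at hcard
    obtain rfl := Multiset.card_eq_zero.1 (show U.card = 0 by omega)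
    obtain rfl := Multiset.card_eq_zero.1 (show V.card = 0 by omega)
    refine k3 (a0 := a0) (a1 := a1) (a2 := a2) (a3 := a3) (a4 := a4) (a5 := a5) hm
        ?_
    simp at hs
    linear_combination -hs

end four

section forward
open DihedralGroup
variable {N : ℕ} [NeZero N]

theorem forward (hN : 2 ≤ N) {S : Multiset (DihedralGroup (2 * N))} (hS : S.card = 3 * N)
    (hm : IsMinimalProductOne S) : ∃ (g : (ZMod (2 * N))ˣ) (y : ZMod (2 * N)),
    S = Multiset.replicate (2 * N + N - 2) (r (g : ZMod (2 * N))) + {sr y, sr (y - (N : ZMod (2 * N)) * (g : ZMod (2 * N)))} := by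
  obtain ⟨A, B, rfl⟩ := exists_seq S
  obtain ⟨hG, hz⟩ := good_of_productOne hm.2.1
  obtain ⟨X, Y, U0, V0, rfl, hXY, rfl, hs0⟩ := hG
  rw [card_seq, Multiset.card_add, Multiset.card_add] at hS
  obtain ⟨D, rfl, rfl⟩ := exists_pairs X Y hXY
  have hA : D.map Prod.snd + D.map Prod.fst = Afull D := add_comm _ _
  simp only [Multiset.card_map] at hS
  obtain ⟨U, V, hUV, hs, hV⟩ := exists_flip (D.map dl).sum V0.card U0 V0 rfl (by
    rw [sum_dl]; linear_combination hs0)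
  have hUVc : U.card + V.card = U0.card + V0.card := by
    rw [← Multiset.card_add, hUV, Multiset.card_add]
  have hm' := hm
  rw [hA, ← hUV] at hm'
  have hI := irr_of hm'
  have h3 : D.card = 0 ∨ D.card = 1 ∨ 2 ≤ D.card := by omega
  rcases h3 with h | h | h
  · exfalso
    obtain rfl := Multiset.card_eq_zero.1 h
    refine case_zero (W := U + V) ?_ ?_ hI
    · rw [Multiset.card_add]; rw [Multiset.card_zero] at hS; omega
    · rw [hUV]; exact hz (by simp)
  · obtain ⟨p, rfl⟩ := Multiset.card_eq_one.1 h
    rw [Multiset.map_singleton] at hI hs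
    obtain ⟨g, h1, h2⟩ := case_one hN (dl p) U V (by omega) hV (by simpa using hs) hI
    refine ⟨g, p.2, ?_⟩
    rw [hA, ← hUV, h1]
    have : p.2 - (N : ZMod (2 * N)) * (g : ZMod (2 * N)) = p.1 := by
      rw [dl] at h2; linear_combination -h2
    rw [this]
    simp only [seq, Afull, Multiset.map_singleton, Multiset.map_add, Multiset.map_replicate]
    rw [add_comm, Multiset.insert_eq_cons, ← Multiset.singleton_add, add_comm {sr p.1}]
  · exfalso
    by_cases hN3 : 3 ≤ N
    · rcases le_total V.card U.card with hle | hle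
      · refine core hN3 (D.map dl) U V (by simpa using h) ?_ (by omega) hle hs hI
        rw [Multiset.card_map]; omega
      · have hA' : Afull (D.map Prod.swap) = Afull D := by
          simp [Afull, add_comm]
        rw [← hA', add_comm U V] at hm'
        have hI' := irr_of hm'
        refine core hN3 _ V U (by simpa using h) ?_ (by omega) hle ?_ hI'
        · rw [Multiset.card_map, Multiset.card_map]; omega
        · rw [sum_dl] at hs ⊢
          simp only [Multiset.map_map, Function.comp_def, Prod.fst_swap, Prod.snd_swap]
          linear_combination -hs
    · obtain rfl : N = 2 := by omega
      refine four hXY ?_ ?_ hs0 hm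
      · simpa using h
      · rw [Multiset.card_map]; omega

end forward
end DihMin
namespace DihMin

section transport
variable {G H : Type*} [Group G] [Group H]

theorem IsProductOne_map (f : G →* H) {S : Multiset G} (h : IsProductOne S) :
    IsProductOne (S.map f) := by
  obtain ⟨l, rfl, hp⟩ := h
  exact ⟨l.map f, by simp, by rw [← map_list_prod, hp, map_one]⟩

theorem IsMinimalProductOne_map (e : G ≃* H) {S : Multiset G} (h : IsMinimalProductOne S) :
    IsMinimalProductOne (S.map e) := by
  obtain ⟨h0, h1, h2⟩ := h
  refine ⟨by simpa using h0, IsProductOne_map e.toMonoidHom h1, ?_⟩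
  intro T1 T2 ht1 ht2 hp1 hp2 hS
  refine h2 (T1.map e.symm) (T2.map e.symm) (by simpa using ht1) (by simpa using ht2)
    (IsProductOne_map e.symm.toMonoidHom hp1) (IsProductOne_map e.symm.toMonoidHom hp2) ?_
  rw [← Multiset.map_add, ← hS, Multiset.map_map]
  simp

end transport

section reverse
open DihedralGroup

theorem lift_exists {n : ℕ} {G : Type*} [Group G] {α τ : G} (hα : α ^ n = 1) (hτ : τ ^ 2 = 1)
    (hc : τ * α = α⁻¹ * τ) : ∃ f : DihedralGroup n →* G,
      (∀ k : ℕ, f (r k) = α ^ k) ∧ f (sr 0) = τ := by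
  let φ : ZMod n →+ Additive G := ZMod.lift n ⟨zmultiplesHom (Additive G) (Additive.ofMul α), by
    simp [← ofMul_pow, hα]⟩
  let f : ZMod n → G := fun i => (φ i).toMul
  have fadd : ∀ i j, f (i + j) = f i * f j := by
    intro i j; simp [f]
  have f0 : f 0 = 1 := by simp [f]
  have fz : ∀ k : ℤ, f k = α ^ k := by
    intro k
    simp only [f, φ, ZMod.lift_coe]
    simp
  have hτ2 : τ * τ = 1 := by rw [← pow_two, hτ]
  have hτf : ∀ i, τ * f i = f (-i) * τ := by
    intro i
    obtain ⟨k, rfl⟩ := ZMod.intCast_surjective i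
    have hs : SemiconjBy τ α α⁻¹ := hc
    have := hs.zpow_right k
    rw [← Int.cast_neg, fz, fz, zpow_neg, ← inv_zpow]
    exact this
  have hτf' : ∀ i, f i * τ = τ * f (-i) := by
    intro i; rw [hτf, neg_neg]
  refine ⟨MonoidHom.mk' (fun x => match x with
    | r i => f i
    | sr i => τ * f i) ?_, ?_, ?_⟩
  · intro a b
    cases a with
    | r i =>
      cases b with
      | r j => exact fadd i j
      | sr j =>
        change τ * f (j - i) = f i * (τ * f j)
        rw [← mul_assoc, hτf', mul_assoc, ← fadd]
        congr 2; ring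
    | sr i =>
      cases b with
      | r j =>
        change τ * f (i + j) = τ * f i * f j
        rw [fadd, mul_assoc]
      | sr j =>
        change f (j - i) = τ * f i * (τ * f j)
        rw [← mul_assoc, mul_assoc τ, hτf', ← mul_assoc τ, hτ2, one_mul, ← fadd]
        congr 1; ring
  · intro k
    change f k = α ^ k
    have := fz k
    simpa using this
  · change τ * f 0 = τ
    rw [f0, mul_one]

variable {N : ℕ} [NeZero N]

theorem rep_le {j : ℕ} {B1 B2 : Multiset (ZMod (2 * N))}
    (h : Multiset.replicate j 1 = B1 + B2) : ∃ a b, a + b = j ∧ B1 = Multiset.replicate a 1 ∧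
      B2 = Multiset.replicate b 1 := by
  refine ⟨B1.card, B2.card, ?_, ?_, ?_⟩
  · rw [← Multiset.card_add, ← h, Multiset.card_replicate]
  · refine Multiset.eq_replicate_card.2 fun b hb => Multiset.eq_of_mem_replicate (n := j) ?_
    rw [h]; exact Multiset.mem_add.2 (Or.inl hb)
  · refine Multiset.eq_replicate_card.2 fun b hb => Multiset.eq_of_mem_replicate (n := j) ?_
    rw [h]; exact Multiset.mem_add.2 (Or.inr hb)

theorem rev_aux (hN : 2 ≤ N) {B1 B2 : Multiset (ZMod (2 * N))}
    (hB : Multiset.replicate (2 * N + N - 2) 1 = B1 + B2) (h1 : B1 ≠ 0) (hs : B1.sum = 0)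
    (hG : Good ({0} + {(N : ZMod (2 * N))}) B2) : False := by
  obtain ⟨j, c, hjc, rfl, rfl⟩ := rep_le hB
  have hj : j ≠ 0 := by rintro rfl; simp at h1
  rw [Multiset.sum_replicate, nsmul_one, ZMod.natCast_eq_zero_iff] at hs
  have hj2 := Nat.le_of_dvd (Nat.pos_of_ne_zero hj) hs
  obtain ⟨X, Y, U, V, hA, hXY, hUV, he⟩ := hG
  obtain ⟨u, v, huv, rfl, rfl⟩ := rep_le hUV
  have hc := congrArg Multiset.card hA
  simp only [Multiset.card_add, Multiset.card_singleton] at hc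
  obtain ⟨x, rfl⟩ := Multiset.card_eq_one.1 (show X.card = 1 by omega)
  obtain ⟨y, rfl⟩ := Multiset.card_eq_one.1 (show Y.card = 1 by omega)
  simp only [Multiset.sum_singleton, Multiset.sum_replicate, nsmul_one] at he
  have hx : x ∈ ({0} + {(N : ZMod (2 * N))} : Multiset _) := by rw [hA]; simp
  have hx' : x = 0 ∨ x = N := by simpa using hx
  rcases hx' with rfl | rfl
  · have := add_left_cancel hA
    rw [Multiset.singleton_inj] at this
    subst this
    have he' : ((N + u : ℕ) : ZMod (2 * N)) = (v : ℕ) := by push_cast; simpa using he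
    rw [ZMod.natCast_eq_natCast_iff'] at he'
    rw [Nat.mod_eq_of_lt (by omega), Nat.mod_eq_of_lt (by omega)] at he'
    omega
  · rw [add_comm] at hA
    have := add_left_cancel hA
    rw [Multiset.singleton_inj] at this
    subst this
    have he' : ((u : ℕ) : ZMod (2 * N)) = (N + v : ℕ) := by push_cast; simpa using he
    rw [ZMod.natCast_eq_natCast_iff'] at he'
    rw [Nat.mod_eq_of_lt (by omega), Nat.mod_eq_of_lt (by omega)] at he'
    omega

theorem reverse_std (hN : 2 ≤ N) : IsMinimalProductOne
    (seq ({0} + {(N : ZMod (2 * N))}) (Multiset.replicate (2 * N + N - 2) 1)) := by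
  refine ⟨seq_ne_zero ?_, productOne_of_good (sing_ne _ _) ?_, ?_⟩
  · rw [add_assoc]; exact sing_ne _ _
  · refine ⟨{0}, {(N : ZMod (2 * N))}, Multiset.replicate (N - 1) 1,
      Multiset.replicate (2 * N - 1) 1, rfl, by simp, ?_, ?_⟩
    · rw [← Multiset.replicate_add]; congr 1; omega
    · simp only [Multiset.sum_singleton, Multiset.sum_replicate, nsmul_one, zero_add]
      rw [← Nat.cast_add]; congr 1; omega
  · intro T1 T2 ht1 ht2 hp1 hp2 hS
    obtain ⟨A1, B1, rfl⟩ := exists_seq T1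
    obtain ⟨A2, B2, rfl⟩ := exists_seq T2
    rw [← seq_add] at hS
    obtain ⟨hA, hB⟩ := seq_inj hS
    obtain ⟨g1, z1⟩ := good_of_productOne hp1
    obtain ⟨g2, z2⟩ := good_of_productOne hp2
    have ev : ∀ {A B : Multiset (ZMod (2 * N))}, Good A B → ∃ k, A.card = k + k := by
      rintro A B ⟨X, Y, U, V, rfl, h, -, -⟩
      exact ⟨X.card, by rw [Multiset.card_add, h]⟩
    obtain ⟨k1, e1⟩ := ev g1
    obtain ⟨k2, e2⟩ := ev g2
    have hc := congrArg Multiset.card hA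
    simp only [Multiset.card_add, Multiset.card_singleton] at hc
    have : A1.card = 0 ∨ A2.card = 0 := by omega
    rcases this with h | h
    · obtain rfl := Multiset.card_eq_zero.1 h
      rw [zero_add] at hA
      subst hA
      exact rev_aux hN hB (by rintro rfl; simp [seq] at ht1) (z1 rfl) g2
    · obtain rfl := Multiset.card_eq_zero.1 h
      rw [add_zero] at hA
      subst hA
      rw [add_comm B1 B2] at hB
      exact rev_aux hN hB (by rintro rfl; simp [seq] at ht2) (z2 rfl) g1

theorem reverse (hN : 2 ≤ N) {G : Type*} [Group G] (e : G ≃* DihedralGroup (2 * N)) {α τ : G}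
    (hcl : Subgroup.closure {α, τ} = ⊤) (hα : α ^ (2 * N) = 1) (hτ : τ ^ 2 = 1)
    (hc : τ * α = α⁻¹ * τ) :
    IsMinimalProductOne (Multiset.replicate (2 * N + N - 2) α + {τ, α ^ N * τ}) := by
  obtain ⟨f, hf1, hf2⟩ := lift_exists hα hτ hc
  have hr1 : f (r 1) = α := by simpa using hf1 1
  have hsurj : Function.Surjective f := by
    rw [← MonoidHom.range_eq_top, ← top_le_iff, ← hcl, Subgroup.closure_le]
    rintro x (rfl | rfl)
    · exact ⟨r 1, hr1⟩
    · exact ⟨sr 0, hf2⟩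
  have hbij : Function.Bijective f := by
    have h1 : Function.Surjective (e ∘ f) := e.surjective.comp hsurj
    have h2 := Finite.injective_iff_surjective.2 h1
    exact ⟨h2.of_comp, hsurj⟩
  have := IsMinimalProductOne_map (MulEquiv.ofBijective f hbij) (reverse_std hN)
  convert this using 1
  have hsr : f (sr (N : ZMod (2 * N))) = α ^ N * τ := by
    rw [← hf1, ← hf2, ← map_mul, r_mul_sr]
    congr 2
    have : ((2 * N : ℕ) : ZMod (2 * N)) = 0 := ZMod.natCast_self _
    push_cast at this
    linear_combination this
  simp only [seq, Multiset.map_add, Multiset.map_singleton, Multiset.map_replicate,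
    MulEquiv.ofBijective_apply, hsr, hr1, hf2]
  rw [add_comm, Multiset.insert_eq_cons, ← Multiset.singleton_add]

theorem closure_std (g : (ZMod (2 * N))ˣ) (y : ZMod (2 * N)) :
    Subgroup.closure {r (g : ZMod (2 * N)), sr y} = ⊤ := by
  rw [eq_top_iff]
  have hr : ∀ i : ZMod (2 * N), r i ∈ Subgroup.closure {r (g : ZMod (2 * N)), sr y} := by
    intro i
    have : r i = r (g : ZMod (2 * N)) ^ ((↑g⁻¹ : ZMod (2 * N)) * i).val := by
      rw [r_pow, ZMod.natCast_zmod_val, Units.mul_inv_cancel_left]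
    rw [this]
    exact Subgroup.pow_mem _ (Subgroup.subset_closure (by simp)) _
  rintro (i | i) -
  · exact hr i
  · have : sr i = sr y * r (i - y) := by rw [sr_mul_r]; congr 1; ring
    rw [this]
    exact Subgroup.mul_mem _ (Subgroup.subset_closure (by simp)) (hr _)

theorem main (hN : 2 ≤ N) {G : Type*} [Group G] (e : G ≃* DihedralGroup (2 * N))
    (S : Multiset G) (hcard : Multiset.card S = 3 * N) :
    IsMinimalProductOne S ↔
      ∃ α τ : G, Subgroup.closure {α, τ} = ⊤ ∧ α ^ (2 * N) = 1 ∧ τ ^ 2 = 1 ∧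
        τ * α = α⁻¹ * τ ∧
        S = Multiset.replicate (2 * N + N - 2) α + {τ, α ^ N * τ} := by
  constructor
  · intro h
    obtain ⟨g, y, hS⟩ := forward hN (by simpa using hcard) (IsMinimalProductOne_map e h)
    refine ⟨e.symm (r g), e.symm (sr y), ?_, ?_, ?_, ?_, ?_⟩
    · have h1 := MonoidHom.map_closure e.symm.toMonoidHom {r (g : ZMod (2 * N)), sr y}
      rw [closure_std, Set.image_pair] at h1
      refine h1.symm.trans ?_
      rw [← MonoidHom.range_eq_map, MonoidHom.range_eq_top]
      exact e.symm.surjective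
    · rw [← map_pow, r_pow, ZMod.natCast_self, mul_zero, r_zero, map_one]
    · rw [← map_pow, pow_two, sr_mul_self, map_one]
    · rw [← map_inv, ← map_mul, ← map_mul, inv_r, sr_mul_r, r_mul_sr, sub_neg_eq_add]
    · have h1 := congrArg (Multiset.map e.symm) hS
      rw [Multiset.map_map] at h1
      rw [← map_pow, ← map_mul, r_pow, r_mul_sr, mul_comm (g : ZMod (2 * N))]
      simpa using h1
  · rintro ⟨α, τ, h1, h2, h3, h4, rfl⟩
    exact reverse hN e h1 h2 h3 h4

end reverse
end DihMin

theorem minimal_product_one_of_maximal_length_dihedral_even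
    (n : ℕ) (hn : 4 ≤ n) (heven : Even n)
    (G : Type*) [Group G] (hG : Nonempty (G ≃* DihedralGroup n))
    (S : Multiset G) (hcard : Multiset.card S = 3 * n / 2) :
    IsMinimalProductOne S ↔
      ∃ α τ : G, Subgroup.closure {α, τ} = ⊤ ∧ α ^ n = 1 ∧ τ ^ 2 = 1 ∧
        τ * α = α⁻¹ * τ ∧
        S = Multiset.replicate (n + n / 2 - 2) α + {τ, α ^ (n / 2) * τ} := by
  obtain ⟨N, hN⟩ := heven
  rw [← two_mul] at hN
  subst hN
  obtain ⟨e⟩ := hG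
  haveI : NeZero N := ⟨by omega⟩
  have h2 : 2 * N / 2 = N := by omega
  rw [h2]
  exact DihMin.main (by omega) e S (by omega)
end
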